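/- arXiv:1809.04304 — 7 statements merged into one kernel-verified Lean document; each statement's English description precedes it below -/
import Mathlib

section
/- Let n ≥ 2 and let T = (a_1, …, a_k) be a tuple of integers with 0 ≤ a_1 < a_2 < ⋯ < a_k < n, and assume either a_1 ≥ 2, or k ≥ 3 with a_1 = 1, a_2 = 3 and a_3 ≥ 5. Then the set of pairs { (x, y) ∈ ℤ × ℤ : y² = g_T(x) } is finite. -/
open Polynomial Finset

/-- For a non-negative integer `a`, the polynomial `p_a(x) = ∏_{i=0}^{a} (x + i)` over `ℤ`. -/
noncomputable def pP (a : ℕ) : Polynomial ℤ :=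
  ∏ i ∈ Finset.range (a + 1), (X + C (i : ℤ))

namespace Pf

/-- the derivation on rational power series -/
noncomputable abbrev dd : PowerSeries ℚ → PowerSeries ℚ := fun f => PowerSeries.derivative ℚ f

/-- Taylor expansion of an integer polynomial at a rational point -/
noncomputable def theta (z : ℚ) : ℤ[X] →+* PowerSeries ℚ :=
  Polynomial.eval₂RingHom (Int.castRingHom (PowerSeries ℚ)) (PowerSeries.C z + PowerSeries.X)

lemma theta_X (z : ℚ) : theta z X = PowerSeries.C z + PowerSeries.X := by
  simp [theta]

lemma theta_C (z : ℚ) (n : ℤ) : theta z (C n) = (n : PowerSeries ℚ) := by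
  simp [theta]

lemma theta_deriv (z : ℚ) (p : ℤ[X]) :
    PowerSeries.derivative ℚ (theta z p) = theta z (derivative p) := by
  induction p using Polynomial.induction_on' with
  | add p q hp hq => simp [hp, hq]
  | monomial n a =>
    rw [← C_mul_X_pow_eq_monomial]
    simp only [map_mul, map_pow, theta_X, theta_C, derivative_mul, derivative_C, derivative_X_pow,
      Derivation.leibniz, Derivation.leibniz_pow]
    have : PowerSeries.derivative ℚ ((a : PowerSeries ℚ)) = 0 := by
      have : (a : PowerSeries ℚ) = PowerSeries.C (a : ℚ) := by simp
      rw [this, PowerSeries.derivative_C]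
    simp [this, theta_X]

lemma theta_const (z : ℚ) (p : ℤ[X]) :
    PowerSeries.constantCoeff (theta z p) = p.aeval z := by
  induction p using Polynomial.induction_on' with
  | add p q hp hq => simp [hp, hq]
  | monomial n a =>
    rw [← C_mul_X_pow_eq_monomial]
    simp [theta_X, theta_C]

/-- iterated derivative polynomials -/
noncomputable def bseq (E G a : ℤ[X]) : ℕ → ℤ[X]
  | 0 => a
  | l + 1 => 2 * (G * E) * derivative (bseq E G a l)
      + (G * derivative E - 2 * (l : ℤ[X]) * derivative (G * E)) * bseq E G a l

lemma ode (z : ℚ) (E G a : ℤ[X]) (c : ℚ) (ρ : PowerSeries ℚ)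
    (hρ : PowerSeries.C c * ρ ^ 2 = theta z E) (l : ℕ) :
    theta z (bseq E G a l) * ρ =
      (2 * theta z (G * E)) ^ l * (dd^[l] (theta z a * ρ)) := by
  have h1 : 2 * theta z E * dd ρ = theta z (derivative E) * ρ := by
    have := congrArg (PowerSeries.derivative ℚ) hρ
    rw [theta_deriv] at this
    simp only [Derivation.leibniz, Derivation.leibniz_pow, PowerSeries.derivative_C] at this
    rw [← this, ← hρ]
    simp [dd]
    ring
  induction l with
  | zero => simp [bseq]
  | succ l ih =>
    rw [Function.iterate_succ_apply']
    set y := dd^[l] (theta z a * ρ)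
    have h2 := congrArg (PowerSeries.derivative ℚ) ih
    simp only [Derivation.leibniz, Derivation.leibniz_pow, theta_deriv, smul_eq_mul] at h2
    have h20 : PowerSeries.derivative ℚ (2 : PowerSeries ℚ) = 0 := by
      have : (2 : PowerSeries ℚ) = PowerSeries.C 2 := (map_ofNat PowerSeries.C 2).symm
      rw [this, PowerSeries.derivative_C]
    simp only [h20, theta_deriv] at h2
    simp only [bseq, map_add, map_sub, map_mul, map_natCast, map_ofNat] at *
    have h3 : (2 * (theta z G * theta z E)) * (theta z (bseq E G a l) * dd ρ) =
        theta z G * theta z (derivative E) * theta z (bseq E G a l) * ρ := by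
      linear_combination theta z G * theta z (bseq E G a l) * h1
    have h4 : (2 * (theta z G * theta z E)) * ((l • (2 * (theta z G * theta z E)) ^ (l - 1)) * y) =
       l * ((2 * (theta z G * theta z E)) ^ l * y) := by
      rcases l with _ | l
      · simp
      · simp [pow_succ]; ring
    simp only [dd, derivative_mul, map_add, map_mul, Derivation.leibniz, smul_eq_mul, nsmul_eq_mul] at *
    linear_combination (2 * (theta z G * theta z E)) * h2 - h3 + 2 * (theta z (derivative G) * theta z E + theta z G * theta z (derivative E)) * (h4 - l * ih)

lemma sq_coeff (ρ : PowerSeries ℚ) (h0 : PowerSeries.coeff 0 ρ = 1) (n : ℕ) :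
    PowerSeries.coeff (n + 1) (ρ ^ 2) = 2 * PowerSeries.coeff (n + 1) ρ +
      ∑ i ∈ range n, PowerSeries.coeff (i + 1) ρ * PowerSeries.coeff (n - i) ρ := by
  rw [pow_two, PowerSeries.coeff_mul, Finset.Nat.sum_antidiagonal_eq_sum_range_succ_mk]
  rw [Finset.sum_range_succ, Finset.sum_range_succ']
  simp only [h0, Nat.sub_self, Nat.sub_zero, Nat.add_sub_add_right]
  ring

/-- coefficients of the square root -/
noncomputable def sqc (P : ℕ → ℚ) : ℕ → ℚ
  | 0 => 1
  | n + 1 => (P (n + 1) - ∑ i : Fin n, sqc P (i + 1) * sqc P (n - i)) / 2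

lemma exists_sqrt (P : PowerSeries ℚ) (h : PowerSeries.coeff 0 P = 1) :
    ∃ ρ : PowerSeries ℚ, PowerSeries.coeff 0 ρ = 1 ∧ ρ ^ 2 = P := by
  refine ⟨PowerSeries.mk (sqc fun n => PowerSeries.coeff n P), ?_, ?_⟩
  · rw [PowerSeries.coeff_mk]; simp [sqc]
  · ext n
    rcases n with _ | n
    · rw [pow_two, PowerSeries.coeff_mul]
      simp [sqc]
      simpa using h.symm
    · rw [sq_coeff _ (by rw [PowerSeries.coeff_mk]; simp [sqc])]
      simp only [PowerSeries.coeff_mk]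
      rw [sqc, Finset.sum_range (fun i => sqc (fun n => (PowerSeries.coeff n) P) (i + 1) * sqc (fun n => (PowerSeries.coeff n) P) (n - i))]
      ring

lemma sqrt_int (ρ : PowerSeries ℚ) (h0 : PowerSeries.coeff 0 ρ = 1)
    (h : ∀ n, ∃ k : ℤ, PowerSeries.coeff (n + 1) (ρ ^ 2) = 4 * (k : ℚ)) (n : ℕ) :
    ∃ k : ℤ, PowerSeries.coeff (n + 1) ρ = 2 * (k : ℚ) := by
  induction n using Nat.strong_induction_on with
  | _ n ih =>
    obtain ⟨k, hk⟩ := h n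
    rw [sq_coeff _ h0] at hk
    have : ∃ t : ℤ, ∑ i ∈ range n, PowerSeries.coeff (i + 1) ρ * PowerSeries.coeff (n - i) ρ = 4 * (t : ℚ) := by
      have : ∀ i ∈ range n, ∃ t : ℤ, PowerSeries.coeff (i + 1) ρ * PowerSeries.coeff (n - i) ρ = 4 * (t : ℚ) := by
        intro i hi
        rw [mem_range] at hi
        obtain ⟨s, hs⟩ := ih i hi
        obtain ⟨t, ht⟩ := ih (n - i - 1) (by omega)
        rw [show n - i - 1 + 1 = n - i by omega] at ht
        exact ⟨s * t, by rw [hs, ht]; push_cast; ring⟩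
      choose! t ht using this
      exact ⟨∑ i ∈ range n, t i, by rw [Finset.sum_congr rfl ht]; push_cast; rw [Finset.mul_sum]⟩
    obtain ⟨t, ht⟩ := this
    rw [ht] at hk
    exact ⟨k - t, by push_cast; linarith⟩

lemma sqrt_int' (ρ : PowerSeries ℚ) (h0 : PowerSeries.coeff 0 ρ = 1)
    (h : ∀ n, ∃ k : ℤ, PowerSeries.coeff (n + 1) (ρ ^ 2) = 4 * (k : ℚ)) (n : ℕ) :
    ∃ k : ℤ, PowerSeries.coeff n ρ = (k : ℚ) := by
  rcases n with _ | n
  · exact ⟨1, by simpa using h0⟩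
  · obtain ⟨k, hk⟩ := sqrt_int ρ h0 h n
    exact ⟨2 * k, by rw [hk]; push_cast; ring⟩

lemma catalan_le (n : ℕ) : catalan n ≤ 4 ^ n := by
  rw [catalan_eq_centralBinom_div]
  calc n.centralBinom / (n + 1) ≤ n.centralBinom := Nat.div_le_self _ _
    _ ≤ 2 ^ (2 * n) := by rw [Nat.centralBinom]; exact Nat.choose_le_two_pow _ _
    _ = 4 ^ n := by rw [pow_mul]; norm_num

lemma one_le_catalan (n : ℕ) : 1 ≤ catalan n := by
  induction n with
  | zero => simp
  | succ n ih =>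
    rw [catalan_succ]
    calc 1 ≤ catalan 0 * catalan n := by simpa using ih
      _ ≤ _ := by
        have := Finset.single_le_sum (f := fun i : Fin n.succ => catalan i * catalan (n - i)) (s := univ) (by simp) (Finset.mem_univ 0)
        simpa using this

lemma sqrt_bound (ρ : PowerSeries ℚ) (h0 : PowerSeries.coeff 0 ρ = 1) (B : ℚ) (hB : 1 ≤ B)
    (h : ∀ n, |PowerSeries.coeff (n + 1) (ρ ^ 2)| ≤ B ^ (n + 1)) (n : ℕ) :
    |PowerSeries.coeff (n + 1) ρ| ≤ B ^ (n + 1) * catalan n := by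
  induction n using Nat.strong_induction_on with
  | _ n ih =>
    have hk := h n
    rw [sq_coeff _ h0] at hk
    have hc : (1 : ℚ) ≤ catalan n := by exact_mod_cast one_le_catalan n
    have hs : |∑ i ∈ range n, PowerSeries.coeff (i + 1) ρ * PowerSeries.coeff (n - i) ρ| ≤ B ^ (n + 1) * catalan n := by
      rcases n with _ | n
      · simp; linarith
      · calc _ ≤ ∑ i ∈ range (n + 1), |PowerSeries.coeff (i + 1) ρ * PowerSeries.coeff (n + 1 - i) ρ| := Finset.abs_sum_le_sum_abs _ _
          _ ≤ ∑ i ∈ range (n + 1), B ^ (n + 1 + 1) * ((catalan i : ℚ) * catalan (n - i)) := by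
            apply Finset.sum_le_sum
            intro i hi
            rw [mem_range] at hi
            have e1 := ih i hi
            have e2 := ih (n - i) (by omega)
            rw [show n - i + 1 = n + 1 - i by omega] at e2
            rw [abs_mul]
            calc _ ≤ (B ^ (i + 1) * catalan i) * (B ^ (n + 1 - i) * catalan (n - i)) := by gcongr
              _ = B ^ (i + 1 + (n + 1 - i)) * ((catalan i : ℚ) * catalan (n - i)) := by rw [pow_add]; ring
              _ = _ := by rw [show i + 1 + (n + 1 - i) = n + 1 + 1 by omega]
          _ = _ := by
            rw [← Finset.mul_sum, catalan_succ, Finset.sum_range]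
            push_cast; rfl
    have : 2 * |PowerSeries.coeff (n + 1) ρ| ≤ B ^ (n + 1) + B ^ (n + 1) * catalan n := by
      have e : 2 * PowerSeries.coeff (n + 1) ρ = (2 * PowerSeries.coeff (n + 1) ρ + ∑ i ∈ range n, PowerSeries.coeff (i + 1) ρ * PowerSeries.coeff (n - i) ρ) - ∑ i ∈ range n, PowerSeries.coeff (i + 1) ρ * PowerSeries.coeff (n - i) ρ := by ring
      calc 2 * |PowerSeries.coeff (n + 1) ρ| = |2 * PowerSeries.coeff (n + 1) ρ| := by rw [abs_mul]; simp
        _ ≤ _ := by rw [e]; exact (abs_sub _ _).trans (add_le_add hk hs)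
    have hp : 0 < B ^ (n + 1) := by positivity
    nlinarith

lemma sqrt_bound' (ρ : PowerSeries ℚ) (h0 : PowerSeries.coeff 0 ρ = 1) (B : ℚ) (hB : 1 ≤ B)
    (h : ∀ n, |PowerSeries.coeff (n + 1) (ρ ^ 2)| ≤ B ^ (n + 1)) (n : ℕ) :
    |PowerSeries.coeff n ρ| ≤ (4 * B) ^ n := by
  rcases n with _ | n
  · rw [h0]; simp
  · refine (sqrt_bound ρ h0 B hB h n).trans ?_
    rw [mul_pow, mul_comm]
    gcongr
    calc (catalan n : ℚ) ≤ 4 ^ n := by exact_mod_cast catalan_le n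
      _ ≤ 4 ^ (n + 1) := by gcongr <;> norm_num

end Pf

namespace Pf

lemma prop_of_wronsk (f g : PowerSeries ℚ) (hg : g ≠ 0) (h : dd f * g = f * dd g) :
    ∃ c : ℚ, f = PowerSeries.C c * g := by
  classical
  have key : ∀ h g : PowerSeries ℚ, ∀ r s : ℕ, dd h * g = h * dd g →
      (∀ i < s, PowerSeries.coeff i h = 0) → (∀ i < r, PowerSeries.coeff i g = 0) →
      (s : ℚ) * (PowerSeries.coeff s h * PowerSeries.coeff r g) = r * (PowerSeries.coeff s h * PowerSeries.coeff r g) := by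
    intro h g r s e hs hr
    have e2 : (PowerSeries.X * dd h) * g = h * (PowerSeries.X * dd g) := by
      linear_combination PowerSeries.X * e
    have cX : ∀ f : PowerSeries ℚ, ∀ n, PowerSeries.coeff n (PowerSeries.X * dd f) = n * PowerSeries.coeff n f := by
      intro f n
      rcases n with _ | n
      · simp
      · rw [PowerSeries.coeff_succ_X_mul, dd, PowerSeries.coeff_derivative]; push_cast; ring
    have e3 := congrArg (PowerSeries.coeff (s + r)) e2
    rw [PowerSeries.coeff_mul, PowerSeries.coeff_mul] at e3
    rw [Finset.sum_eq_single (s, r), Finset.sum_eq_single (s, r)] at e3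
    · simp only [cX] at e3
      linear_combination e3
    · rintro ⟨i, j⟩ hij hne
      rw [HasAntidiagonal.mem_antidiagonal] at hij
      simp only at hij ⊢
      rcases lt_trichotomy i s with h1 | h1 | h1
      · rw [hs i h1]; simp
      · exfalso; apply hne; subst h1; congr 1; omega
      · rw [cX, hr j (by omega)]; simp
    · intro hh; exfalso; apply hh; simp
    · rintro ⟨i, j⟩ hij hne
      rw [HasAntidiagonal.mem_antidiagonal] at hij
      simp only at hij ⊢
      rcases lt_trichotomy i s with h1 | h1 | h1
      · rw [cX, hs i h1]; simp
      · exfalso; apply hne; subst h1; congr 1; omega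
      · rw [hr j (by omega)]; simp
    · intro hh; exfalso; apply hh; simp
  have first : ∀ f : PowerSeries ℚ, f ≠ 0 → ∃ r, PowerSeries.coeff r f ≠ 0 ∧ ∀ i < r, PowerSeries.coeff i f = 0 := by
    intro f hf
    have : ∃ r, PowerSeries.coeff r f ≠ 0 := by
      by_contra! hh
      exact hf (by ext n; simpa using hh n)
    exact ⟨Nat.find this, Nat.find_spec this, fun i hi => by simpa using Nat.find_min this hi⟩
  obtain ⟨r, hr, hr'⟩ := first g hg
  refine ⟨PowerSeries.coeff r f / PowerSeries.coeff r g, ?_⟩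
  set c := PowerSeries.coeff r f / PowerSeries.coeff r g with hc
  by_contra hne
  obtain ⟨s, hs, hs'⟩ := first (f - PowerSeries.C c * g) (sub_ne_zero.mpr hne)
  have e : dd (f - PowerSeries.C c * g) * g = (f - PowerSeries.C c * g) * dd g := by
    have : dd (f - PowerSeries.C c * g) = dd f - PowerSeries.C c * dd g := by
      simp [dd, PowerSeries.derivative_C]
    rw [this]
    linear_combination h
  have := key _ g r s e hs' hr'
  have hsr : (s : ℚ) = r := by
    have hz : PowerSeries.coeff s (f - PowerSeries.C c * g) * PowerSeries.coeff r g ≠ 0 := mul_ne_zero hs hr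
    exact mul_right_cancel₀ hz this
  have hsr' : s = r := by exact_mod_cast hsr
  subst hsr'
  apply hs
  rw [map_sub, PowerSeries.coeff_C_mul, hc]
  field_simp
  simp

/-- Wronskian matrix -/
noncomputable def wmat (n : ℕ) (y : Fin n → PowerSeries ℚ) : Matrix (Fin n) (Fin n) (PowerSeries ℚ) :=
  Matrix.of fun i j => dd^[i] (y j)

lemma wronsk (n : ℕ) : ∀ (y : Fin n → PowerSeries ℚ), LinearIndependent ℚ y → (wmat n y).det ≠ 0 := by
  induction n with
  | zero => intro y _; simp
  | succ n ih =>
    intro y hy hdet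
    have ih' := ih (y ∘ Fin.castSucc) (hy.comp _ (Fin.castSucc_injective n))
    have kill : ∀ w : Fin (n + 1) → PowerSeries ℚ, w (Fin.last n) = 0 →
        (∀ i : ℕ, i < n → ∑ j, dd^[i] (y j) * w j = 0) → w = 0 := by
      intro w hw hi
      by_contra hne
      apply ih'
      apply Matrix.exists_mulVec_eq_zero_iff.mp
      refine ⟨w ∘ Fin.castSucc, ?_, ?_⟩
      · intro h0
        apply hne
        funext j
        refine Fin.lastCases ?_ (fun j => ?_) j
        · simpa using hw
        · simpa using congrFun h0 j
      · funext i
        have := hi i i.2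
        rw [Fin.sum_univ_castSucc, hw] at this
        simpa [Matrix.mulVec, dotProduct, wmat] using this
    obtain ⟨v, hv, hv0⟩ := Matrix.exists_mulVec_eq_zero_iff.mpr hdet
    have hrow : ∀ i : ℕ, i < n + 1 → ∑ j, dd^[i] (y j) * v j = 0 := by
      intro i hi
      have := congrFun hv0 ⟨i, hi⟩
      simpa [Matrix.mulVec, dotProduct, wmat] using this
    have hl : v (Fin.last n) ≠ 0 := fun h0 => hv (kill v h0 fun i hi => hrow i (by omega))
    have hrow' : ∀ i : ℕ, i < n → ∑ j, dd^[i] (y j) * dd (v j) = 0 := by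
      intro i hi
      have h1 := congrArg (PowerSeries.derivative ℚ) (hrow i (by omega))
      rw [map_sum] at h1
      simp only [Derivation.leibniz, smul_eq_mul, map_zero] at h1
      rw [Finset.sum_add_distrib] at h1
      have h2 := hrow (i + 1) (by omega)
      simp only [Function.iterate_succ_apply'] at h2
      have h3 : ∑ j, v j * PowerSeries.derivative ℚ (dd^[i] (y j)) = 0 := by
        rw [← h2]; exact Finset.sum_congr rfl fun j _ => mul_comm _ _
      rw [h3, add_zero] at h1
      exact h1
    have hw := kill (fun j => v (Fin.last n) * dd (v j) - dd (v (Fin.last n)) * v j) (by simp [mul_comm])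
      (by
        intro i hi
        have : ∀ j, dd^[i] (y j) * (v (Fin.last n) * dd (v j) - dd (v (Fin.last n)) * v j) =
          v (Fin.last n) * (dd^[i] (y j) * dd (v j)) - dd (v (Fin.last n)) * (dd^[i] (y j) * v j) := by
          intro j; ring
        simp only [this]
        rw [Finset.sum_sub_distrib, ← Finset.mul_sum, ← Finset.mul_sum, hrow' i hi, hrow i (by omega)]
        simp)
    have hp : ∀ j, ∃ c : ℚ, v j = PowerSeries.C c * v (Fin.last n) := by
      intro j
      apply prop_of_wronsk _ _ hl
      have := congrFun hw j
      simp only [Pi.zero_apply] at this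
      linear_combination this
    choose c hc using hp
    have h0 := hrow 0 (by omega)
    have h1 : (∑ j, c j • y j) * v (Fin.last n) = 0 := by
      rw [← h0, Finset.sum_mul]
      refine Finset.sum_congr rfl fun j _ => ?_
      rw [hc j, PowerSeries.smul_eq_C_mul]
      simp
      ring
    have h2 := (mul_eq_zero.mp h1).resolve_right hl
    have h3 := Fintype.linearIndependent_iff.mp hy c h2 (Fin.last n)
    apply hl
    rw [hc, h3]; simp

end Pf

namespace Pf

/-- power series with integer coefficients -/
noncomputable abbrev RZ : Subring (PowerSeries ℚ) := (PowerSeries.map (Int.castRingHom ℚ)).range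

lemma coeff_RZ {f : PowerSeries ℚ} (hf : f ∈ RZ) (n : ℕ) : ∃ k : ℤ, PowerSeries.coeff n f = (k : ℚ) := by
  obtain ⟨g, rfl⟩ := hf
  exact ⟨PowerSeries.coeff n g, by simp⟩

lemma X_mem_RZ : (PowerSeries.X : PowerSeries ℚ) ∈ RZ := ⟨PowerSeries.X, by simp⟩

lemma int_theta (x : ℕ) (hx : 0 < x) (p : ℤ[X]) (M : ℕ) (hM : p.natDegree ≤ M) :
    (x : PowerSeries ℚ) ^ M * theta (1 / (x : ℚ)) p ∈ RZ := by
  rw [p.as_sum_range_C_mul_X_pow' (n := M + 1) (by omega), map_sum, Finset.mul_sum]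
  apply Subring.sum_mem
  intro i hi
  rw [mem_range] at hi
  rw [map_mul, map_pow, theta_X, theta_C]
  have hC : (x : PowerSeries ℚ) * PowerSeries.C (1 / (x : ℚ)) = 1 := by
    rw [show (x : PowerSeries ℚ) = PowerSeries.C (x : ℚ) by simp, ← map_mul]
    rw [mul_one_div_cancel (by positivity)]; simp
  have e : (x : PowerSeries ℚ) ^ M * ((p.coeff i : PowerSeries ℚ) * (PowerSeries.C (1 / (x : ℚ)) + PowerSeries.X) ^ i)
     = (p.coeff i : PowerSeries ℚ) * (x : PowerSeries ℚ) ^ (M - i) * (1 + (x : PowerSeries ℚ) * PowerSeries.X) ^ i := by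
    rw [← hC, ← mul_add, mul_pow]
    rw [show M = M - i + i by omega, pow_add, show M - i + i - i = M - i by omega]
    ring
  rw [e]
  refine Subring.mul_mem _ (Subring.mul_mem _ ?_ (Subring.pow_mem _ ?_ _)) (Subring.pow_mem _ (Subring.add_mem _ (Subring.one_mem _) (Subring.mul_mem _ ?_ X_mem_RZ)) _)
  · exact intCast_mem _ _
  · exact natCast_mem _ _
  · exact natCast_mem _ _

lemma int_theta_coeff (x : ℕ) (hx : 0 < x) (p : ℤ[X]) (M : ℕ) (hM : p.natDegree ≤ M) (j : ℕ) :
    ∃ k : ℤ, (x : ℚ) ^ M * PowerSeries.coeff j (theta (1 / (x : ℚ)) p) = (k : ℚ) := by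
  obtain ⟨k, hk⟩ := coeff_RZ (int_theta x hx p M hM) j
  refine ⟨k, ?_⟩
  rw [← hk, show (x : PowerSeries ℚ) ^ M = PowerSeries.C ((x : ℚ) ^ M) by simp, PowerSeries.coeff_C_mul]

lemma int_eval (x : ℕ) (hx : 0 < x) (p : ℤ[X]) (M : ℕ) (hM : p.natDegree ≤ M) :
    ∃ k : ℤ, (x : ℚ) ^ M * p.aeval (1 / (x : ℚ)) = (k : ℚ) := by
  have := int_theta_coeff x hx p M hM 0
  rwa [PowerSeries.coeff_zero_eq_constantCoeff_apply, theta_const] at this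

lemma rho_int (x : ℕ) (hx : 0 < x) (E G : ℤ[X]) (D : ℕ) (hD : G.natDegree + E.natDegree ≤ D)
    (hE : E.aeval (1 / (x : ℚ)) ≠ 0) (ρ : PowerSeries ℚ) (h0 : PowerSeries.coeff 0 ρ = 1)
    (hρ : PowerSeries.C (E.aeval (1 / (x : ℚ))) * ρ ^ 2 = theta (1 / (x : ℚ)) E) (j : ℕ) :
    ∃ k : ℤ, (4 * (G * E).aeval (1 / (x : ℚ)) * (x : ℚ) ^ D) ^ j * PowerSeries.coeff j ρ = (k : ℚ) := by
  set τ : ℚ := 4 * (G * E).aeval (1 / (x : ℚ)) * (x : ℚ) ^ D with hτ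
  have hτi : ∃ t : ℤ, τ = (t : ℚ) := by
    obtain ⟨k, hk⟩ := int_eval x hx (G * E) D (natDegree_mul_le.trans hD)
    exact ⟨4 * k, by rw [hτ]; push_cast; rw [← hk]; ring⟩
  obtain ⟨t, ht⟩ := hτi
  have main := sqrt_int' (PowerSeries.rescale τ ρ) (by rw [PowerSeries.coeff_rescale]; simpa using h0) (by
    intro n
    rw [← map_pow, PowerSeries.coeff_rescale]
    have e1 : PowerSeries.coeff (n + 1) (ρ ^ 2) = PowerSeries.coeff (n + 1) (theta (1 / (x : ℚ)) E) / E.aeval (1 / (x : ℚ)) := by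
      rw [← hρ, PowerSeries.coeff_C_mul]; field_simp
    obtain ⟨k1, hk1⟩ := int_theta_coeff x hx E E.natDegree le_rfl (n + 1)
    obtain ⟨k2, hk2⟩ := int_eval x hx G G.natDegree le_rfl
    refine ⟨t ^ n * k1 * k2 * x ^ (D - (G.natDegree + E.natDegree)), ?_⟩
    push_cast
    rw [← hk1, ← hk2, e1, pow_succ, ← ht]
    nth_rewrite 2 [hτ]
    rw [map_mul]
    have : (x : ℚ) ^ D = x ^ G.natDegree * x ^ E.natDegree * (x : ℚ) ^ (D - (G.natDegree + E.natDegree)) := by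
      rw [← pow_add, ← pow_add]; congr 1; omega
    rw [this]
    field_simp) j
  simpa [PowerSeries.coeff_rescale] using main

lemma b_eval (z : ℚ) (E G a : ℤ[X]) (c : ℚ) (ρ : PowerSeries ℚ)
    (hρ : PowerSeries.C c * ρ ^ 2 = theta z E) (h0 : PowerSeries.coeff 0 ρ = 1) (l : ℕ) :
    (bseq E G a l).aeval z = (2 * (G * E).aeval z) ^ l * ((l.factorial : ℚ) * PowerSeries.coeff l (theta z a * ρ)) := by
  have := congrArg PowerSeries.constantCoeff (ode z E G a c ρ hρ l)
  rw [map_mul, map_mul, map_pow, map_mul, theta_const, theta_const] at this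
  rw [PowerSeries.coeff_zero_eq_constantCoeff_apply] at h0
  rw [h0, mul_one] at this
  rw [this]
  have h2 : PowerSeries.constantCoeff (2 : PowerSeries ℚ) = 2 := map_ofNat _ 2
  rw [h2]
  congr 1
  have := PowerSeries.constantCoeff_iterate_derivative (R := ℚ) (theta z a * ρ) l
  convert this using 1

lemma b_int (x : ℕ) (hx : 0 < x) (E G a : ℤ[X]) (D N : ℕ) (hD : G.natDegree + E.natDegree ≤ D)
    (hN : a.natDegree ≤ N)
    (hE : E.aeval (1 / (x : ℚ)) ≠ 0) (ρ : PowerSeries ℚ) (h0 : PowerSeries.coeff 0 ρ = 1)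
    (hρ : PowerSeries.C (E.aeval (1 / (x : ℚ))) * ρ ^ 2 = theta (1 / (x : ℚ)) E) (l : ℕ) :
    ∃ k : ℤ, 2 ^ l * (x : ℚ) ^ (N + l * D) * (bseq E G a l).aeval (1 / (x : ℚ)) = (l.factorial : ℚ) * (k : ℚ) := by
  rw [b_eval _ E G a _ ρ hρ h0]
  set τ : ℚ := 4 * (G * E).aeval (1 / (x : ℚ)) * (x : ℚ) ^ D with hτ
  have hτi : ∃ t : ℤ, τ = (t : ℚ) := by
    obtain ⟨k, hk⟩ := int_eval x hx (G * E) D (natDegree_mul_le.trans hD)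
    exact ⟨4 * k, by rw [hτ]; push_cast; rw [← hk]; ring⟩
  obtain ⟨t, ht⟩ := hτi
  have hs : ∀ p ∈ antidiagonal l, ∃ k : ℤ, (x : ℚ) ^ N * τ ^ l * (PowerSeries.coeff p.1 (theta (1 / (x : ℚ)) a) * PowerSeries.coeff p.2 ρ) = (k : ℚ) := by
    rintro ⟨i, j⟩ hij
    rw [HasAntidiagonal.mem_antidiagonal] at hij
    simp only at hij ⊢
    obtain ⟨k1, hk1⟩ := int_theta_coeff x hx a N hN i
    obtain ⟨k2, hk2⟩ := rho_int x hx E G D hD hE ρ h0 hρ j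
    refine ⟨t ^ i * k1 * k2, ?_⟩
    push_cast
    rw [← hk1, ← hk2, ← ht, ← hτ, ← hij, pow_add]
    ring
  choose! k hk using hs
  refine ⟨∑ p ∈ antidiagonal l, k p, ?_⟩
  push_cast
  rw [← Finset.sum_congr rfl hk, ← Finset.mul_sum, ← PowerSeries.coeff_mul, hτ]
  have h4 : (4 : ℚ) ^ l = 2 ^ l * 2 ^ l := by rw [← mul_pow]; norm_num
  rw [mul_pow, mul_pow, mul_pow, h4, ← pow_mul, pow_add, mul_comm D l]
  ring

end Pf

namespace Pf

/-- the sum of the absolute values of the coefficients -/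
noncomputable def l1 (p : ℤ[X]) : ℝ := ∑ i ∈ p.support, |(p.coeff i : ℝ)|

lemma l1_eq (p : ℤ[X]) (s : Finset ℕ) (h : p.support ⊆ s) : l1 p = ∑ i ∈ s, |(p.coeff i : ℝ)| := by
  apply Finset.sum_subset h
  intro i _ hi
  rw [notMem_support_iff.mp hi]; simp

lemma l1_nonneg (p : ℤ[X]) : 0 ≤ l1 p := Finset.sum_nonneg fun _ _ => abs_nonneg _

lemma l1_zero : l1 0 = 0 := by simp [l1]

lemma l1_add (p q : ℤ[X]) : l1 (p + q) ≤ l1 p + l1 q := by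
  classical
  rw [l1_eq (p + q) (p.support ∪ q.support) support_add, l1_eq p (p.support ∪ q.support) subset_union_left,
    l1_eq q (p.support ∪ q.support) subset_union_right, ← Finset.sum_add_distrib]
  apply Finset.sum_le_sum
  intro i _
  rw [coeff_add]; push_cast
  exact abs_add_le _ _

lemma l1_neg (p : ℤ[X]) : l1 (-p) = l1 p := by simp [l1]

lemma l1_sub (p q : ℤ[X]) : l1 (p - q) ≤ l1 p + l1 q := by
  rw [sub_eq_add_neg, ← l1_neg q]; exact l1_add _ _

lemma l1_sum {ι : Type*} (s : Finset ι) (f : ι → ℤ[X]) : l1 (∑ i ∈ s, f i) ≤ ∑ i ∈ s, l1 (f i) := by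
  classical
  induction s using Finset.induction_on with
  | empty => simp [l1_zero]
  | insert a s ha ih =>
    rw [Finset.sum_insert ha, Finset.sum_insert ha]
    exact (l1_add _ _).trans (by linarith)

lemma l1_monomial (n : ℕ) (c : ℤ) : l1 (monomial n c) = |(c : ℝ)| := by
  rw [l1_eq _ {n} (support_monomial_subset _ _)]
  simp

lemma l1_mul (p q : ℤ[X]) : l1 (p * q) ≤ l1 p * l1 q := by
  rw [mul_eq_sum_sum]
  refine (l1_sum _ _).trans ?_
  rw [l1, l1, Finset.sum_mul_sum]
  apply Finset.sum_le_sum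
  intro i _
  rw [Polynomial.sum_def]
  refine (l1_sum _ _).trans ?_
  apply Finset.sum_le_sum
  intro j _
  rw [l1_monomial]; push_cast; rw [abs_mul]

lemma l1_one : l1 1 = 1 := by
  have := l1_monomial 0 1
  simpa using this

lemma l1_intCast (n : ℤ) : l1 (n : ℤ[X]) = |(n : ℝ)| := by
  have := l1_monomial 0 n
  simpa using this

lemma l1_natCast (n : ℕ) : l1 (n : ℤ[X]) = n := by
  have := l1_intCast n
  simpa using this

lemma l1_two : l1 2 = 2 := by
  have := l1_natCast 2
  simpa using this

lemma l1_prod {ι : Type*} (s : Finset ι) (f : ι → ℤ[X]) : l1 (∏ i ∈ s, f i) ≤ ∏ i ∈ s, l1 (f i) := by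
  classical
  induction s using Finset.induction_on with
  | empty => simp [l1_one]
  | insert a s ha ih =>
    rw [Finset.prod_insert ha, Finset.prod_insert ha]
    exact (l1_mul _ _).trans (mul_le_mul_of_nonneg_left ih (l1_nonneg _))

lemma l1_deriv (p : ℤ[X]) : l1 (derivative p) ≤ p.natDegree * l1 p := by
  rw [derivative_apply, Polynomial.sum_def]
  refine (l1_sum _ _).trans ?_
  rw [l1, Finset.mul_sum]
  apply Finset.sum_le_sum
  intro i hi
  rw [C_mul_X_pow_eq_monomial, l1_monomial]
  push_cast
  rw [abs_mul, mul_comm, Nat.abs_cast]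
  have : (i : ℝ) ≤ p.natDegree := by exact_mod_cast le_natDegree_of_mem_supp i hi
  gcongr

lemma coeff_le_l1 (p : ℤ[X]) (i : ℕ) : |(p.coeff i : ℝ)| ≤ l1 p := by
  by_cases hi : i ∈ p.support
  · exact Finset.single_le_sum (f := fun i => |(p.coeff i : ℝ)|) (fun _ _ => abs_nonneg _) hi
  · rw [notMem_support_iff.mp hi]; simpa using l1_nonneg p

lemma l1_eval (p : ℤ[X]) (z : ℝ) (hz : |z| ≤ 1) : |p.aeval z| ≤ l1 p := by
  rw [aeval_eq_sum_range' (n := p.natDegree + 1) (by omega), l1_eq p (range (p.natDegree + 1)) (by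
    intro i hi; rw [mem_range]; have := le_natDegree_of_mem_supp i hi; omega)]
  refine (Finset.abs_sum_le_sum_abs _ _).trans (Finset.sum_le_sum fun i _ => ?_)
  rw [zsmul_eq_mul, abs_mul, abs_pow]
  exact mul_le_of_le_one_right (abs_nonneg _) (pow_le_one₀ (abs_nonneg _) hz)

lemma l1_le_of_coeff (p : ℤ[X]) (N : ℕ) (hN : p.natDegree < N) (A : ℝ) (h : ∀ i, |(p.coeff i : ℝ)| ≤ A) :
    l1 p ≤ N * A := by
  rw [l1_eq p (range N) (by
    intro i hi; rw [mem_range]; have := le_natDegree_of_mem_supp i hi; omega)]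
  refine (Finset.sum_le_sum fun i _ => h i).trans ?_
  simp

lemma bseq_natDegree (E G a : ℤ[X]) (D N : ℕ) (hD : G.natDegree + E.natDegree ≤ D)
    (hN : a.natDegree ≤ N) (l : ℕ) : (bseq E G a l).natDegree ≤ N + l * D := by
  induction l with
  | zero => simpa [bseq] using hN
  | succ l ih =>
    rw [bseq]
    have hGE : (G * E).natDegree ≤ D := natDegree_mul_le.trans hD
    have h1 : (2 * (G * E)).natDegree ≤ D := by
      refine natDegree_mul_le.trans ?_
      rw [show (2 : ℤ[X]) = C 2 by rfl, natDegree_C]; omega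
    have h2 : (G * derivative E).natDegree ≤ D := by
      refine natDegree_mul_le.trans ?_
      have := natDegree_derivative_le E
      omega
    have h3 : (2 * (l : ℤ[X]) * derivative (G * E)).natDegree ≤ D := by
      refine natDegree_mul_le.trans ?_
      have := natDegree_derivative_le (G * E)
      have : (2 * (l : ℤ[X])).natDegree = 0 := by
        rw [show (2 * (l : ℤ[X])) = C (2 * (l : ℤ)) by simp, natDegree_C]
      omega
    have h4 := natDegree_derivative_le (bseq E G a l)
    have hl : N + (l + 1) * D = N + l * D + D := by ring
    rw [hl]
    refine natDegree_add_le_of_degree_le ?_ ?_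
    · exact natDegree_mul_le.trans (by omega)
    · refine natDegree_mul_le.trans ?_
      have := natDegree_sub_le_of_le h2 h3
      rw [max_self] at this
      omega

lemma bseq_l1 (E G a : ℤ[X]) (D N : ℕ) (hD : G.natDegree + E.natDegree ≤ D)
    (hN : a.natDegree ≤ N) (hN1 : 1 ≤ N) (K : ℝ) (hK1 : l1 (G * E) ≤ K) (hK2 : l1 (G * derivative E) ≤ K)
    (hK3 : l1 (derivative (G * E)) ≤ K) (l : ℕ) (hl : l ≤ N) :
    l1 (bseq E G a l) ≤ (K * (2 * D + 5) * N) ^ l * l1 a := by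
  have hK : 0 ≤ K := (l1_nonneg _).trans hK1
  induction l with
  | zero => simp [bseq]
  | succ l ih =>
    have ih' := ih (by omega)
    have hb := l1_nonneg (bseq E G a l)
    have step : l1 (bseq E G a (l + 1)) ≤ (K * (2 * D + 5) * N) * l1 (bseq E G a l) := by
      rw [bseq]
      have h1 : l1 (2 * (G * E) * derivative (bseq E G a l)) ≤ 2 * K * ((N + l * D) * l1 (bseq E G a l)) := by
        refine (l1_mul _ _).trans ?_
        have e1 : l1 (2 * (G * E)) ≤ 2 * K := by
          refine (l1_mul _ _).trans ?_
          rw [l1_two]; linarith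
        have e2 : l1 (derivative (bseq E G a l)) ≤ (N + l * D) * l1 (bseq E G a l) := by
          refine (l1_deriv _).trans ?_
          have : ((bseq E G a l).natDegree : ℝ) ≤ N + l * D := by
            exact_mod_cast bseq_natDegree E G a D N hD hN l
          gcongr
        exact mul_le_mul e1 e2 (l1_nonneg _) (by linarith)
      have h2 : l1 ((G * derivative E - 2 * (l : ℤ[X]) * derivative (G * E)) * bseq E G a l) ≤
          (K + 2 * l * K) * l1 (bseq E G a l) := by
        refine (l1_mul _ _).trans ?_
        refine mul_le_mul_of_nonneg_right ?_ hb
        refine (l1_sub _ _).trans (add_le_add hK2 ?_)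
        refine (l1_mul _ _).trans ?_
        have e1 : l1 (2 * (l : ℤ[X])) ≤ 2 * l := by
          refine (l1_mul _ _).trans ?_
          rw [l1_two, l1_natCast]
        exact mul_le_mul e1 hK3 (l1_nonneg _) (by positivity)
      refine (l1_add _ _).trans ((add_le_add h1 h2).trans ?_)
      have hlN : (l : ℝ) ≤ N := by exact_mod_cast (by omega : l ≤ N)
      have hN1' : (1 : ℝ) ≤ N := by exact_mod_cast hN1
      have hc : 2 * K * (N + l * D) + (K + 2 * l * K) ≤ K * (2 * D + 5) * N := by
        have : 2 * (N + l * D : ℝ) + (1 + 2 * l) ≤ (2 * D + 5) * N := by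
          have : (l : ℝ) * D ≤ N * D := by gcongr
          nlinarith
        calc _ = K * (2 * (N + l * D : ℝ) + (1 + 2 * l)) := by ring
          _ ≤ K * ((2 * D + 5) * N) := by gcongr
          _ = _ := by ring
      calc _ = (2 * K * (N + l * D) + (K + 2 * l * K)) * l1 (bseq E G a l) := by ring
        _ ≤ _ := by gcongr
    refine step.trans ?_
    rw [pow_succ']
    rw [mul_assoc (K * (2 * D + 5) * N)]
    gcongr

lemma l1_det (r : ℕ) (M : Matrix (Fin r) (Fin r) ℤ[X]) (B : ℝ) (h : ∀ i j, l1 (M i j) ≤ B) :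
    l1 M.det ≤ r.factorial * B ^ r := by
  rw [Matrix.det_apply]
  refine (l1_sum _ _).trans ?_
  have : ∀ σ ∈ (univ : Finset (Equiv.Perm (Fin r))), l1 (Equiv.Perm.sign σ • ∏ i, M (σ i) i) ≤ B ^ r := by
    intro σ _
    have e : l1 (Equiv.Perm.sign σ • ∏ i, M (σ i) i) = l1 (∏ i, M (σ i) i) := by
      rcases Int.units_eq_one_or (Equiv.Perm.sign σ) with h | h <;> rw [h] <;> simp [l1_neg]
    rw [e]
    refine (l1_prod _ _).trans ?_
    calc ∏ i, l1 (M (σ i) i) ≤ ∏ i : Fin r, B := Finset.prod_le_prod (fun _ _ => l1_nonneg _) fun i _ => h _ _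
      _ = B ^ r := by simp
  refine (Finset.sum_le_sum this).trans ?_
  simp [Fintype.card_perm]

end Pf

namespace Pf

lemma theta_taylor (z : ℚ) (p : ℤ[X]) :
    theta z p = ((taylor z (p.map (Int.castRingHom ℚ)) : ℚ[X]) : PowerSeries ℚ) := by
  induction p using Polynomial.induction_on' with
  | add p q hp hq => simp [hp, hq, Polynomial.map_add]
  | monomial n a =>
    rw [← C_mul_X_pow_eq_monomial]
    rw [map_mul, map_pow, theta_X, theta_C, Polynomial.map_mul, taylor_mul]
    have h1 : ((taylor z (Polynomial.map (Int.castRingHom ℚ) (C a)) : ℚ[X]) : PowerSeries ℚ) = (a : PowerSeries ℚ) := by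
      rw [map_C, taylor_C, Polynomial.coe_C]; simp
    rw [Polynomial.coe_mul, h1]
    simp [add_comm]

lemma theta_injective (z : ℚ) (p : ℤ[X]) (h : theta z p = 0) : p = 0 := by
  rw [theta_taylor] at h
  have h1 : taylor z (p.map (Int.castRingHom ℚ)) = 0 := by exact_mod_cast h
  rw [taylor_eq_zero] at h1
  exact (Polynomial.map_eq_zero_iff (Int.cast_injective (α := ℚ))).mp h1

lemma lc_of_theta_dvd (x : ℕ) (hx : 0 < x) (W : ℤ[X]) (hW : W ≠ 0) (q : ℕ)
    (h : PowerSeries.X ^ q ∣ theta (1 / (x : ℚ)) W) : (x : ℝ) ^ q ≤ l1 W := by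
  have h1 : (X - C (1 / (x : ℚ))) ^ q ∣ W.map (Int.castRingHom ℚ) := by
    rw [theta_taylor, PowerSeries.X_pow_dvd_iff] at h
    have h2 : X ^ q ∣ taylor (1 / (x : ℚ)) (W.map (Int.castRingHom ℚ)) := by
      rw [Polynomial.X_pow_dvd_iff]
      intro d hd
      have := h d hd
      rwa [Polynomial.coeff_coe] at this
    obtain ⟨r, hr⟩ := h2
    refine ⟨taylor (-(1 / (x : ℚ))) r, ?_⟩
    have := congrArg (taylor (-(1 / (x : ℚ)))) hr
    rw [taylor_taylor, neg_add_cancel, taylor_zero, taylor_mul, taylor_pow, taylor_X] at this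
    rw [this, map_neg, sub_eq_add_neg]
  have hx' : (x : ℚ) ≠ 0 := by positivity
  have hprim : ∀ q : ℕ, ((C (x : ℤ) * X - 1) ^ q : ℤ[X]).IsPrimitive := by
    have h1 : (C (x : ℤ) * X - 1 : ℤ[X]).IsPrimitive := by
      rw [isPrimitive_iff_isUnit_of_C_dvd]
      intro r hr
      rw [C_dvd_iff_dvd_coeff] at hr
      have := hr 0
      simp at this
      exact isUnit_of_dvd_one this
    intro q
    induction q with
    | zero => simpa using isPrimitive_one
    | succ q ih => rw [pow_succ]; exact ih.mul h1
  have h2 : (C (x : ℤ) * X - 1) ^ q ∣ W := by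
    rw [IsPrimitive.Int.dvd_iff_map_cast_dvd_map_cast _ _ (hprim q)]
    refine dvd_trans ?_ h1
    refine ⟨C ((1 / (x : ℚ)) ^ q), ?_⟩
    rw [Polynomial.map_pow, map_pow, ← mul_pow]
    congr 1
    simp only [Polynomial.map_sub, Polynomial.map_mul, map_C, map_X, Polynomial.map_one]
    have : C (x : ℚ) * C (1 / (x : ℚ)) = 1 := by
      rw [← C_mul, mul_one_div_cancel hx', C_1]
    simp only [eq_intCast, Int.cast_natCast]
    linear_combination (-X) * this
  obtain ⟨V, hV⟩ := h2
  have hlc : W.leadingCoeff = (x : ℤ) ^ q * V.leadingCoeff := by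
    rw [hV, leadingCoeff_mul, leadingCoeff_pow]
    congr 2
    have : (C (x : ℤ) * X - 1 : ℤ[X]) = C (x : ℤ) * X + C (-1) := by simp [sub_eq_add_neg]
    rw [this, leadingCoeff_linear]
    exact_mod_cast hx.ne'
  have hV0 : V.leadingCoeff ≠ 0 := by
    intro h0
    rw [h0, mul_zero] at hlc
    exact hW (leadingCoeff_eq_zero.mp hlc)
  refine le_trans ?_ (coeff_le_l1 W W.natDegree)
  rw [coeff_natDegree, hlc]
  push_cast
  rw [abs_mul, abs_pow, Nat.abs_cast]
  have : (1 : ℝ) ≤ |(V.leadingCoeff : ℝ)| := by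
    exact_mod_cast Int.one_le_abs hV0
  exact le_mul_of_one_le_right (by positivity) this

lemma nonvan {ι : Type} [Fintype ι] (E G a : ι → ℤ[X]) (Δ : ℤ[X]) (hΔ : Δ ≠ 0) (hGE : ∀ k, G k * E k = Δ)
    (x : ℕ) (hx : 0 < x) (ρ : ι → PowerSeries ℚ) (c : ι → ℚ)
    (hρ : ∀ k, PowerSeries.C (c k) * ρ k ^ 2 = theta (1 / (x : ℚ)) (E k))
    (h0 : ∀ k, PowerSeries.coeff 0 (ρ k) = 1) (ν : ι → ℚ)
    (hΦ : ∑ k, ν k • (theta (1 / (x : ℚ)) (a k) * ρ k) ≠ 0) (L : ℕ)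
    (hL : ∀ l < L, PowerSeries.coeff l (∑ k, ν k • (theta (1 / (x : ℚ)) (a k) * ρ k)) = 0)
    (B : ℝ) (hB1 : 1 ≤ B) (hB : ∀ l < Fintype.card ι, ∀ k, l1 (bseq (E k) (G k) (a k) l) ≤ B) :
    (x : ℝ) ^ (L - Fintype.card ι) ≤ (Fintype.card ι).factorial * B ^ (Fintype.card ι) := by
  classical
  set z : ℚ := 1 / (x : ℚ) with hz
  set y : ι → PowerSeries ℚ := fun k => theta z (a k) * ρ k with hy
  set Φ : PowerSeries ℚ := ∑ k, ν k • y k with hΦd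
  obtain ⟨κ', f', hf', hspan', hli'⟩ := exists_linearIndependent' ℚ y
  haveI : Finite κ' := Finite.of_injective f' hf'
  haveI := Fintype.ofFinite κ'
  set r := Fintype.card κ' with hr
  let eqv := (Fintype.equivFin κ').symm
  set f : Fin r → ι := f' ∘ eqv with hf
  have hli : LinearIndependent ℚ (y ∘ f) := by
    have := hli'.comp eqv eqv.injective
    exact this
  have hspan : Submodule.span ℚ (Set.range (y ∘ f)) = Submodule.span ℚ (Set.range y) := by
    rw [← hspan', hf, ← Function.comp_assoc, Set.range_comp (y ∘ f') eqv]
    rw [Equiv.range_eq_univ, Set.image_univ]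
  have hrd : r ≤ Fintype.card ι := Fintype.card_le_of_injective f' hf'
  have hΦm : Φ ∈ Submodule.span ℚ (Set.range (y ∘ f)) := by
    rw [hspan]
    exact Submodule.sum_mem _ fun k _ => Submodule.smul_mem _ _ (Submodule.subset_span ⟨k, rfl⟩)
  obtain ⟨w, hw⟩ := (Submodule.mem_span_range_iff_exists_fun ℚ).mp hΦm
  have : ∃ j, w j ≠ 0 := by
    by_contra! hh
    apply hΦ
    rw [← hw]
    simp [hh]
  obtain ⟨j0, hj0⟩ := this
  have hWr := wronsk r (y ∘ f) hli
  have dvdΦ : ∀ i : Fin r, PowerSeries.X ^ (L - Fintype.card ι) ∣ dd^[i] Φ := by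
    intro i
    rw [PowerSeries.X_pow_dvd_iff]
    intro t ht
    have := PowerSeries.coeff_iterate_derivative (R := ℚ) Φ i t
    have h2 : PowerSeries.coeff (t + i) Φ = 0 := hL _ (by have := i.2; omega)
    rw [h2, mul_zero] at this
    convert this using 1
  have hvec : (wmat r (y ∘ f)).mulVec (fun j => PowerSeries.C (w j)) = fun i : Fin r => dd^[i] Φ := by
    funext i
    rw [← hw]
    have lin : ∀ (i : ℕ) , dd^[i] (∑ j, w j • (y ∘ f) j) = ∑ j, w j • dd^[i] ((y ∘ f) j) := by
      intro i
      induction i with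
      | zero => simp
      | succ i ih =>
        rw [Function.iterate_succ_apply', ih]
        simp only [dd, map_sum, map_smul, Function.iterate_succ_apply']
        refine Finset.sum_congr rfl fun j _ => ?_
        rw [Derivation.map_smul]
    rw [lin]
    simp only [Matrix.mulVec, dotProduct, wmat, Matrix.of_apply]
    refine Finset.sum_congr rfl fun j _ => ?_
    rw [PowerSeries.smul_eq_C_mul, mul_comm]
  have hdetdvd : PowerSeries.X ^ (L - Fintype.card ι) ∣ (wmat r (y ∘ f)).det := by
    have h1 : (wmat r (y ∘ f)).adjugate.mulVec ((wmat r (y ∘ f)).mulVec (fun j => PowerSeries.C (w j))) j0 =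
       (wmat r (y ∘ f)).det * PowerSeries.C (w j0) := by
      rw [Matrix.mulVec_mulVec, Matrix.adjugate_mul, Matrix.smul_mulVec, Matrix.one_mulVec]
      simp
    rw [hvec] at h1
    have h2 : PowerSeries.X ^ (L - Fintype.card ι) ∣ (wmat r (y ∘ f)).det * PowerSeries.C (w j0) := by
      rw [← h1]
      simp only [Matrix.mulVec, dotProduct]
      exact Finset.dvd_sum fun i _ => Dvd.dvd.mul_left (dvdΦ i) _
    have hu : IsUnit (PowerSeries.C (w j0)) := (isUnit_iff_ne_zero.mpr hj0).map PowerSeries.C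
    exact (hu.dvd_mul_right).mp h2
  set Wm : Matrix (Fin r) (Fin r) ℤ[X] := Matrix.of fun i j => bseq (E (f j)) (G (f j)) (a (f j)) i with hWm
  have hrel : theta z Wm.det * ∏ j, ρ (f j) = (∏ i : Fin r, (2 * theta z Δ) ^ (i : ℕ)) * (wmat r (y ∘ f)).det := by
    rw [← Matrix.det_mul_column, RingHom.map_det, mul_comm, ← Matrix.det_mul_row]
    congr 1
    ext1 i j
    simp only [Matrix.of_apply, RingHom.mapMatrix_apply, Matrix.map_apply, hWm, wmat]
    rw [mul_comm, ode z _ _ _ _ _ (hρ (f j)), hGE]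
    rfl
  have hθΔ : theta z Δ ≠ 0 := fun h => hΔ (theta_injective z Δ h)
  have hW0 : Wm.det ≠ 0 := by
    intro h
    rw [h, map_zero, zero_mul] at hrel
    have h2 : (2 : PowerSeries ℚ) ≠ 0 := by
      rw [← map_ofNat PowerSeries.C 2]
      intro hh
      have := congrArg PowerSeries.constantCoeff hh
      simp at this
    exact (mul_ne_zero (Finset.prod_ne_zero_iff.mpr fun i _ => pow_ne_zero _ (mul_ne_zero h2 hθΔ)) hWr) hrel.symm
  have hun : IsUnit (∏ j, ρ (f j)) := by
    rw [PowerSeries.isUnit_iff_constantCoeff, map_prod]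
    rw [Finset.prod_eq_one]
    · exact isUnit_one
    · intro j _
      have := h0 (f j)
      rwa [PowerSeries.coeff_zero_eq_constantCoeff_apply] at this
  have hdv : PowerSeries.X ^ (L - Fintype.card ι) ∣ theta z Wm.det := by
    rw [← hun.dvd_mul_right, hrel]
    exact Dvd.dvd.mul_left hdetdvd _
  refine (lc_of_theta_dvd x hx _ hW0 _ hdv).trans ?_
  refine (l1_det r Wm B (fun i j => hB i (lt_of_lt_of_le i.2 hrd) (f j))).trans ?_
  have h1 : (r.factorial : ℝ) ≤ (Fintype.card ι).factorial := by
    exact_mod_cast Nat.factorial_le hrd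
  gcongr

end Pf

namespace Pf

/-- the polynomial is not a square up to rational functions -/
def NS (E : ℤ[X]) : Prop := ∀ A B : ℚ[X], A ^ 2 * E.map (Int.castRingHom ℚ) = B ^ 2 → A = 0

lemma ns_key (E : ℚ[X]) (q : ℚ) (A B : ℚ[X]) (hA : A ≠ 0) (h : A ^ 2 * E = B ^ 2) (F : ℚ[X]) (i : ℕ)
    (hE : E = (X - C q) ^ i * F) (hF : F.eval q ≠ 0) : Even i ∧ ∃ t : ℚ, F.eval q = t ^ 2 := by
  have hF0 : F ≠ 0 := by rintro rfl; simp at hF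
  have hE0 : E ≠ 0 := by rw [hE]; exact mul_ne_zero (pow_ne_zero _ (X_sub_C_ne_zero q)) hF0
  have hB : B ≠ 0 := by
    rintro rfl
    rw [zero_pow two_ne_zero] at h
    exact mul_ne_zero (pow_ne_zero 2 hA) hE0 h
  obtain ⟨A', hA', hA1⟩ := exists_eq_pow_rootMultiplicity_mul_and_not_dvd A hA q
  obtain ⟨B', hB', hB1⟩ := exists_eq_pow_rootMultiplicity_mul_and_not_dvd B hB q
  set r := rootMultiplicity q A
  set s := rootMultiplicity q B
  rw [dvd_iff_isRoot, IsRoot] at hA1 hB1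
  have h1 : (X - C q) ^ (2 * r + i) * (A' ^ 2 * F) = (X - C q) ^ (2 * s) * B' ^ 2 := by
    have : A ^ 2 * E = (X - C q) ^ (2 * r + i) * (A' ^ 2 * F) := by
      rw [hE, hA']; ring
    rw [← this, h, hB']; ring
  have hx := X_sub_C_ne_zero q
  have hlt : ∀ (m n : ℕ) (U V : ℚ[X]), (X - C q) ^ m * U = (X - C q) ^ n * V → V.eval q ≠ 0 → m ≤ n := by
    intro m n U V hh hV
    by_contra! hc
    apply hV
    rw [show m = n + (m - n - 1 + 1) by omega, pow_add, mul_assoc] at hh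
    have := mul_left_cancel₀ (pow_ne_zero n hx) hh
    rw [← this]
    simp
  have e1 := hlt _ _ _ _ h1 (by simpa using hB1)
  have e2 := hlt _ _ _ _ h1.symm (by simpa using ⟨hA1, hF⟩)
  have e : 2 * r + i = 2 * s := le_antisymm e1 e2
  rw [e] at h1
  have h2 := congrArg (eval q) (mul_left_cancel₀ (pow_ne_zero _ hx) h1)
  simp at h2
  refine ⟨⟨s - r, by omega⟩, B'.eval q / A'.eval q, ?_⟩
  field_simp
  linarith

lemma ns_simple (E : ℤ[X]) (q : ℚ) (F : ℚ[X]) (hE : E.map (Int.castRingHom ℚ) = (X - C q) * F)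
    (hF : F.eval q ≠ 0) : NS E := by
  intro A B h
  by_contra hA
  have := (ns_key _ q A B hA h F 1 (by simpa using hE) hF).1
  simp at this

lemma ns_value (E : ℤ[X]) (q : ℚ) (hF : ¬ ∃ t : ℚ, E.aeval q = t ^ 2) : NS E := by
  intro A B h
  by_contra hA
  have e : (E.map (Int.castRingHom ℚ)).eval q = E.aeval q := by
    rw [eval_map, aeval_def]; rfl
  have := (ns_key _ q A B hA h (E.map (Int.castRingHom ℚ)) 0 (by simp) (by
    rw [e]; intro h0; exact hF ⟨0, by simpa using h0⟩)).2
  rw [e] at this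
  exact hF this

lemma ns_scale (E : ℤ[X]) (hE : NS E) (h0 : E.coeff 0 = 1) (κ : ℚ) (hκ : κ ≠ 0) (A B : ℚ[X])
    (h : C κ * A ^ 2 * E.map (Int.castRingHom ℚ) = B ^ 2) : A = 0 := by
  by_contra hA
  have hk := ns_key (C κ * E.map (Int.castRingHom ℚ)) 0 A B hA (by rw [← h]; ring)
    (C κ * E.map (Int.castRingHom ℚ)) 0 (by simp) (by
      rw [eval_mul, eval_C, ← coeff_zero_eq_eval_zero, coeff_map, h0]; simpa using hκ)
  obtain ⟨t, ht⟩ := hk.2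
  rw [eval_mul, eval_C, ← coeff_zero_eq_eval_zero, coeff_map, h0] at ht
  simp at ht
  have ht0 : t ≠ 0 := by rintro rfl; simp at ht; exact hκ ht
  apply hA
  apply hE A (C (1 / t) * B)
  rw [mul_pow, ← h, ht, ← C_pow]
  have : C ((1 / t) ^ 2) * C (t ^ 2) = (1 : ℚ[X]) := by
    rw [← C_mul, ← mul_pow, one_div_mul_cancel ht0]; simp
  linear_combination (-(A ^ 2 * E.map (Int.castRingHom ℚ))) * this

/-- Taylor expansion of rational polynomials -/
noncomputable def thetaQ (z : ℚ) : ℚ[X] →+* PowerSeries ℚ :=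
  (Polynomial.coeToPowerSeries.ringHom).comp (taylorAlgHom z : ℚ[X] →+* ℚ[X])

lemma thetaQ_apply (z : ℚ) (p : ℚ[X]) : thetaQ z p = ((taylor z p : ℚ[X]) : PowerSeries ℚ) := rfl

lemma thetaQ_map (z : ℚ) (p : ℤ[X]) : thetaQ z (p.map (Int.castRingHom ℚ)) = theta z p := by
  rw [theta_taylor, thetaQ_apply]

lemma thetaQ_C (z c : ℚ) : thetaQ z (C c) = PowerSeries.C c := by
  rw [thetaQ_apply, taylor_C, Polynomial.coe_C]

lemma thetaQ_inj (z : ℚ) : Function.Injective (thetaQ z) := by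
  rw [injective_iff_map_eq_zero]
  intro p h
  rw [thetaQ_apply] at h
  have h1 : taylor z p = 0 := by exact_mod_cast h
  rwa [taylor_eq_zero] at h1

lemma indep (z : ℚ) (E1 E2 : ℤ[X]) (h1 : NS E1) (h2 : NS E2) (h12 : NS (E1 * E2))
    (hE1 : E1.coeff 0 = 1) (hE2 : E2.coeff 0 = 1) (e1 e2 : ℚ) (he1 : e1 ≠ 0) (he2 : e2 ≠ 0)
    (ρ1 ρ2 : PowerSeries ℚ) (hρ1 : PowerSeries.C e1 * ρ1 ^ 2 = theta z E1)
    (hρ2 : PowerSeries.C e2 * ρ2 ^ 2 = theta z E2) (P0 P1 P2 : ℤ[X])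
    (h : theta z P0 + theta z P1 * ρ1 + theta z P2 * ρ2 = 0) : P0 = 0 ∧ P1 = 0 ∧ P2 = 0 := by
  have map0 : ∀ P : ℤ[X], P.map (Int.castRingHom ℚ) = 0 → P = 0 := fun P hP =>
    (Polynomial.map_eq_zero_iff (Int.cast_injective (α := ℚ))).mp hP
  have key : ∀ (E : ℤ[X]) (κ : ℚ) (A B : ℚ[X]), NS E → E.coeff 0 = 1 → κ ≠ 0 →
      PowerSeries.C κ * thetaQ z A ^ 2 * theta z E = thetaQ z B ^ 2 → A = 0 := by
    intro E κ A B hE h0 hκ hh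
    apply ns_scale E hE h0 κ hκ A B
    apply thetaQ_inj z
    rw [map_mul, map_mul, map_pow, map_pow, thetaQ_map, thetaQ_C, hh]
  have hA : C (2 : ℚ) * P1.map (Int.castRingHom ℚ) * P2.map (Int.castRingHom ℚ) = 0 := by
    apply key (E1 * E2) (e1 * e2) _ (C (e1 * e2) * P0.map (Int.castRingHom ℚ) ^ 2 - C e2 * P1.map (Int.castRingHom ℚ) ^ 2 * E1.map (Int.castRingHom ℚ)
      - C e1 * P2.map (Int.castRingHom ℚ) ^ 2 * E2.map (Int.castRingHom ℚ)) h12 (by rw [mul_coeff_zero, hE1, hE2]; norm_num) (mul_ne_zero he1 he2)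
    simp only [map_sub, map_mul, map_pow, thetaQ_map, thetaQ_C]
    rw [← hρ1, ← hρ2]
    have hP : theta z P0 = - (theta z P1 * ρ1 + theta z P2 * ρ2) := by linear_combination h
    rw [hP, show PowerSeries.C (2 : ℚ) = 2 from map_ofNat _ 2]
    ring
  have c2 : (C (2 : ℚ)) ≠ 0 := by simp
  have : P1 = 0 ∨ P2 = 0 := by
    rcases mul_eq_zero.mp hA with hh | hh
    · left; exact map0 _ ((mul_eq_zero.mp hh).resolve_left c2)
    · right; exact map0 _ hh
  have fin0 : ∀ P : ℤ[X], theta z P = 0 → P = 0 := theta_injective z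
  rcases this with hh | hh
  · subst hh
    have hP2 : P2 = 0 := by
      apply map0
      apply key E2 e2⁻¹ _ (P0.map (Int.castRingHom ℚ)) h2 hE2 (inv_ne_zero he2)
      rw [thetaQ_map, thetaQ_map, ← hρ2]
      have hc : PowerSeries.C e2⁻¹ * PowerSeries.C e2 = 1 := by
        rw [← map_mul, inv_mul_cancel₀ he2, map_one]
      have hP : theta z P0 = - (theta z P2 * ρ2) := by
        rw [map_zero] at h; linear_combination h
      rw [hP]
      linear_combination (theta z P2 * ρ2) ^ 2 * hc
    subst hP2
    simp only [map_zero, zero_mul, add_zero] at h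
    exact ⟨fin0 _ h, rfl, rfl⟩
  · subst hh
    have hP1 : P1 = 0 := by
      apply map0
      apply key E1 e1⁻¹ _ (P0.map (Int.castRingHom ℚ)) h1 hE1 (inv_ne_zero he1)
      rw [thetaQ_map, thetaQ_map, ← hρ1]
      have hc : PowerSeries.C e1⁻¹ * PowerSeries.C e1 = 1 := by
        rw [← map_mul, inv_mul_cancel₀ he1, map_one]
      have hP : theta z P0 = - (theta z P1 * ρ1) := by
        rw [map_zero] at h; linear_combination h
      rw [hP]
      linear_combination (theta z P1 * ρ1) ^ 2 * hc
    subst hP1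
    simp only [map_zero, zero_mul, add_zero] at h
    exact ⟨fin0 _ h, rfl, rfl⟩

end Pf

namespace Pf

lemma siegel' {α β : Type} [Fintype α] [Fintype β] (A : Matrix α β ℤ) (q R : ℕ) (hq : 1 ≤ q) (hR : 1 ≤ R)
    (hα : Fintype.card α = q * R) (hβ : Fintype.card β = q * (R + 1)) (M : ℝ) (hM : 1 ≤ M)
    (hA : ∀ i j, |(A i j : ℝ)| ≤ M) :
    ∃ t : β → ℤ, t ≠ 0 ∧ A.mulVec t = 0 ∧ ∀ j, |(t j : ℝ)| ≤ (q * (R + 1) * M) ^ R := by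
  obtain ⟨t, ht, ht0, hn⟩ := Int.Matrix.exists_ne_zero_int_vec_norm_le A (by rw [hα, hβ]; nlinarith) (by rw [hα]; positivity)
  refine ⟨t, ht, ht0, fun j => ?_⟩
  have h1 : |(t j : ℝ)| ≤ ‖t‖ := by
    have := norm_le_pi_norm t j
    rwa [Int.norm_eq_abs] at this
  refine h1.trans (hn.trans ?_)
  have he : ((Fintype.card α : ℝ) / (Fintype.card β - Fintype.card α)) = (R : ℝ) := by
    rw [hα, hβ]; push_cast
    have : (q : ℝ) ≠ 0 := by positivity
    rw [show (q : ℝ) * (R + 1) - q * R = q by ring]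
    field_simp
  rw [he, Real.rpow_natCast]
  have hmax : max 1 (@norm (Matrix α β ℤ) (Matrix.seminormedAddCommGroup).toNorm A) ≤ M := by
    apply max_le hM
    rw [Matrix.norm_le_iff (by linarith)]
    intro i j
    rw [Int.norm_eq_abs]
    exact hA i j
  rw [hβ]
  push_cast
  gcongr

lemma theta_zero_coeff (p : ℤ[X]) (j : ℕ) : PowerSeries.coeff j (theta 0 p) = (p.coeff j : ℚ) := by
  rw [theta_taylor, taylor_zero, Polynomial.coeff_coe, coeff_map]; simp

lemma sum_alpha (e I : ℕ) : ∑ b : Fin e, 2 * e * I * (4 * (e - (b : ℕ)) + 1) = 2 * e ^ 2 * I * (2 * e + 3) := by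
  rw [← Finset.mul_sum]
  have : ∀ e : ℕ, ∑ b : Fin e, (4 * (e - (b : ℕ)) + 1) = e * (2 * e + 3) := by
    intro e
    induction e with
    | zero => simp
    | succ e ih =>
      rw [Fin.sum_univ_succ]
      simp only [Fin.val_zero, Fin.val_succ, Nat.add_sub_add_right, ih]
      simp only [Nat.sub_zero]
      ring
  rw [this]; ring

lemma siegel_step (e C : ℕ) (he : 1 ≤ e) (hC : 1 ≤ C) : ∃ C2 : ℕ, 1 ≤ C2 ∧
    ∀ (ι : Type) [Fintype ι], Fintype.card ι = e + 2 → ∀ (φ ε : ι → PowerSeries ℚ),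
    (∀ k j, ∃ t : ℤ, 4 ^ j * PowerSeries.coeff j (φ k) = (t : ℚ)) →
    (∀ k j, ∃ t : ℤ, 4 ^ j * PowerSeries.coeff j (ε k) = (t : ℚ)) →
    (∀ k j, |PowerSeries.coeff j (φ k)| ≤ (C : ℚ) ^ j) → (∀ k j, |PowerSeries.coeff j (ε k)| ≤ (C : ℚ) ^ j) →
    ∀ I : ℕ, 1 ≤ I → ∃ a : ι → ℤ[X], (∃ k, a k ≠ 0) ∧ (∀ k, (a k).natDegree < 4 * e ^ 2 * I) ∧
      (∀ k j, |(((a k).coeff j : ℤ) : ℝ)| ≤ (C2 : ℝ) ^ I) ∧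
      ∀ b < e, PowerSeries.X ^ (2 * e * I * (4 * (e - b) + 1)) ∣
        ∑ k, PowerSeries.C (PowerSeries.coeff b (φ k)) * (theta 0 (a k) * ε k) := by
  refine ⟨(4 * e ^ 2 * (e + 2) * 2 * (4 * C) ^ (e + 2 * e * (4 * e + 1))) ^ (2 * e + 3), ?_, ?_⟩
  · apply Nat.one_le_pow; positivity
  intro ι _ hcard φ ε hφ hε hφC hεC I hI
  classical
  choose P hP using hφ
  choose Q hQ using hε
  set N := 4 * e ^ 2 * I with hN
  set α : Fin e → ℕ := fun b => 2 * e * I * (4 * (e - (b : ℕ)) + 1) with hα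
  let A : Matrix (Σ b : Fin e, Fin (α b)) (ι × Fin N) ℤ := Matrix.of fun r c =>
    if (c.2 : ℕ) ≤ (r.2 : ℕ) then P c.1 r.1 * Q c.1 (r.2 - c.2) * 4 ^ (c.2 : ℕ) else 0
  have hA : ∀ i j, |(A i j : ℝ)| ≤ ((4 * C : ℝ)) ^ (e + 2 * e * I * (4 * e + 1)) := by
    rintro ⟨b, t⟩ ⟨k, j⟩
    have hC' : (1 : ℝ) ≤ C := by exact_mod_cast hC
    have h41 : (1 : ℝ) ≤ 4 * C := by linarith
    simp only [A, Matrix.of_apply]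
    split_ifs with h
    · have e1 : |(P k b : ℝ)| ≤ (4 * C) ^ (b : ℕ) := by
        have h1 : |(P k b : ℚ)| ≤ (4 * C) ^ (b : ℕ) := by
          rw [← hP, abs_mul, mul_pow, abs_of_pos (by positivity : (0 : ℚ) < 4 ^ (b : ℕ))]
          have := hφC k b
          gcongr
        exact_mod_cast h1
      have e2 : |(Q k (t - j) : ℝ)| ≤ (4 * C) ^ ((t : ℕ) - j) := by
        have h1 : |(Q k (t - j) : ℚ)| ≤ (4 * C) ^ ((t : ℕ) - j) := by
          rw [← hQ, abs_mul, mul_pow, abs_of_pos (by positivity : (0 : ℚ) < 4 ^ ((t : ℕ) - j))]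
          have := hεC k (t - j)
          gcongr
        exact_mod_cast h1
      have e3 : (4 : ℝ) ^ (j : ℕ) ≤ (4 * C) ^ (j : ℕ) := by gcongr; linarith
      push_cast
      rw [abs_mul, abs_mul, abs_of_pos (by positivity : (0 : ℝ) < 4 ^ (j : ℕ))]
      calc _ ≤ (4 * C : ℝ) ^ (b : ℕ) * (4 * C) ^ ((t : ℕ) - j) * (4 * C) ^ (j : ℕ) := by gcongr
        _ = (4 * C : ℝ) ^ ((b : ℕ) + ((t : ℕ) - j) + j) := by rw [← pow_add, ← pow_add]
        _ ≤ _ := by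
          apply pow_le_pow_right₀ h41
          have h1 := b.2
          have h2 := t.2
          have h3 : α b ≤ 2 * e * I * (4 * e + 1) := by
            simp only [hα]
            apply Nat.mul_le_mul_left
            omega
          omega
    · simp
  obtain ⟨t, ht, ht0, htb⟩ := siegel' A (2 * e ^ 2 * I) (2 * e + 3) (Nat.one_le_iff_ne_zero.mpr (by positivity)) (by omega)
    (by rw [Fintype.card_sigma]; simp only [Fintype.card_fin]; exact sum_alpha e I)
    (by rw [Fintype.card_prod, hcard, Fintype.card_fin, hN]; ring) _ (by
      apply one_le_pow₀
      have hC' : (1 : ℝ) ≤ C := by exact_mod_cast hC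
      linarith) hA
  refine ⟨fun k => ∑ j : Fin N, monomial (j : ℕ) (t (k, j)), ?_, ?_, ?_, ?_⟩
  · by_contra! hh
    apply ht
    funext ⟨k, j⟩
    have := congrArg (fun p => coeff p (j : ℕ)) (hh k)
    simp only [finset_sum_coeff, coeff_monomial, coeff_zero] at this
    rw [Finset.sum_eq_single j] at this
    · simpa using this
    · intro i _ hi
      rw [if_neg]; intro h; exact hi (Fin.ext h)
    · simp
  · intro k
    have hN0 : 0 < N := by positivity
    refine lt_of_le_of_lt (natDegree_sum_le_of_forall_le (n := N - 1) _ _ ?_) (by omega)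
    intro j _
    exact (natDegree_monomial_le _).trans (by have := j.2; omega)
  · intro k j
    have hb : (0 : ℝ) ≤ (((4 * e ^ 2 * (e + 2) * 2 * (4 * C) ^ (e + 2 * e * (4 * e + 1))) ^ (2 * e + 3) : ℕ) : ℝ) ^ I := by positivity
    have key : ∀ j, |(t j : ℝ)| ≤ (((4 * e ^ 2 * (e + 2) * 2 * (4 * C) ^ (e + 2 * e * (4 * e + 1))) ^ (2 * e + 3) : ℕ) : ℝ) ^ I := by
      intro j
      refine (htb j).trans ?_
      push_cast
      rw [← pow_mul, mul_comm (2 * e + 3) I, pow_mul _ I]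
      apply pow_le_pow_left₀ (by positivity)
      have hC' : (1 : ℝ) ≤ C := by exact_mod_cast hC
      have h41 : (1 : ℝ) ≤ 4 * C := by linarith
      have hI2 : (I : ℝ) ≤ 2 ^ I := by exact_mod_cast (Nat.lt_two_pow_self).le
      have he' : (1 : ℝ) ≤ e := by exact_mod_cast he
      have h1 : (4 * e ^ 2 * (e + 2) : ℝ) ≤ (4 * e ^ 2 * (e + 2)) ^ I := by
        apply le_self_pow₀ _ (by omega)
        nlinarith
      have h2 : ((4 * C : ℝ)) ^ (e + 2 * e * I * (4 * e + 1)) ≤ ((4 * C) ^ (e + 2 * e * (4 * e + 1))) ^ I := by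
        rw [← pow_mul]
        apply pow_le_pow_right₀ h41
        nlinarith
      calc _ = (4 * e ^ 2 * (e + 2) : ℝ) * I * (4 * C : ℝ) ^ (e + 2 * e * I * (4 * e + 1)) := by ring
        _ ≤ (4 * e ^ 2 * (e + 2) : ℝ) ^ I * 2 ^ I * ((4 * C) ^ (e + 2 * e * (4 * e + 1))) ^ I := by gcongr
        _ = _ := by rw [← mul_pow, ← mul_pow]
    rw [finset_sum_coeff]
    simp only [coeff_monomial]
    by_cases hj : j < N
    · rw [Finset.sum_eq_single ⟨j, hj⟩]
      · simpa using key (k, ⟨j, hj⟩)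
      · intro i _ hi
        rw [if_neg]; intro h; exact hi (Fin.ext h)
      · simp
    · rw [Finset.sum_eq_zero]
      · simpa using hb
      · intro i _
        rw [if_neg]; intro h; exact hj (h ▸ i.2)
  · intro b hb
    rw [PowerSeries.X_pow_dvd_iff]
    intro s hs
    have h1 := congrFun ht0 ⟨⟨b, hb⟩, ⟨s, hs⟩⟩
    simp only [Matrix.mulVec, dotProduct, A, Matrix.of_apply, Pi.zero_apply] at h1
    rw [Fintype.sum_prod_type] at h1
    have h2 : (4 : ℚ) ^ (b + s) * PowerSeries.coeff s (∑ k, PowerSeries.C (PowerSeries.coeff b (φ k)) * (theta 0 (∑ j : Fin N, monomial (j : ℕ) (t (k, j))) * ε k)) = 0 := by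
      have h3 := congrArg (Int.cast : ℤ → ℚ) h1
      rw [Int.cast_zero] at h3
      refine Eq.trans ?_ h3
      push_cast
      rw [map_sum, Finset.mul_sum]
      refine Finset.sum_congr rfl fun k _ => ?_
      rw [PowerSeries.coeff_C_mul, map_sum, Finset.sum_mul, map_sum, Finset.mul_sum, Finset.mul_sum]
      refine Finset.sum_congr rfl fun j _ => ?_
      have : theta 0 (monomial (j : ℕ) (t (k, j))) = PowerSeries.C (t (k, j) : ℚ) * PowerSeries.X ^ (j : ℕ) := by
        rw [← C_mul_X_pow_eq_monomial, map_mul, map_pow, theta_X, theta_C]; simp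
      rw [this, mul_assoc, PowerSeries.coeff_C_mul, PowerSeries.coeff_X_pow_mul']
      split_ifs with hjs
      · rw [← hP, ← hQ]
        have : (4 : ℚ) ^ (b + s) = 4 ^ b * 4 ^ (s - j) * 4 ^ (j : ℕ) := by
          rw [← pow_add, ← pow_add]; congr 1; omega
        rw [this]; ring
      · simp
    exact (mul_eq_zero.mp h2).resolve_left (by positivity)

end Pf

namespace Pf

/-- absolutely convergent evaluation of a power series at a real point -/
def Ev (f : PowerSeries ℚ) (z v : ℝ) : Prop :=
  Summable (fun j => ‖((PowerSeries.coeff j f : ℚ) : ℝ) * z ^ j‖) ∧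
    ∑' j, ((PowerSeries.coeff j f : ℚ) : ℝ) * z ^ j = v

lemma Ev.hasSum {f : PowerSeries ℚ} {z v : ℝ} (h : Ev f z v) :
    HasSum (fun j => ((PowerSeries.coeff j f : ℚ) : ℝ) * z ^ j) v := by
  have := h.1.of_norm.hasSum
  rwa [h.2] at this

lemma Ev.unique {f : PowerSeries ℚ} {z v w : ℝ} (h : Ev f z v) (h' : Ev f z w) : v = w := by
  rw [← h.2, h'.2]

lemma Ev.mul {f g : PowerSeries ℚ} {z v w : ℝ} (hf : Ev f z v) (hg : Ev g z w) : Ev (f * g) z (v * w) := by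
  have e : ∀ n, ∑ kl ∈ antidiagonal n, (((PowerSeries.coeff kl.1 f : ℚ) : ℝ) * z ^ kl.1) * (((PowerSeries.coeff kl.2 g : ℚ) : ℝ) * z ^ kl.2)
      = ((PowerSeries.coeff n (f * g) : ℚ) : ℝ) * z ^ n := by
    intro n
    rw [PowerSeries.coeff_mul]
    push_cast
    rw [Finset.sum_mul]
    refine Finset.sum_congr rfl fun p hp => ?_
    rw [HasAntidiagonal.mem_antidiagonal] at hp
    rw [← hp, pow_add]; ring
  refine ⟨?_, ?_⟩
  · have := summable_norm_sum_mul_antidiagonal_of_summable_norm hf.1 hg.1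
    simpa only [e] using this
  · have := tsum_mul_tsum_eq_tsum_sum_antidiagonal_of_summable_norm hf.1 hg.1
    simp only [e] at this
    rw [← this, hf.2, hg.2]

lemma Ev.add {f g : PowerSeries ℚ} {z v w : ℝ} (hf : Ev f z v) (hg : Ev g z w) : Ev (f + g) z (v + w) := by
  have e : ∀ n, ((PowerSeries.coeff n (f + g) : ℚ) : ℝ) * z ^ n = ((PowerSeries.coeff n f : ℚ) : ℝ) * z ^ n + ((PowerSeries.coeff n g : ℚ) : ℝ) * z ^ n := by
    intro n; rw [map_add]; push_cast; ring
  refine ⟨?_, ?_⟩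
  · simp only [e]
    exact Summable.of_nonneg_of_le (fun _ => norm_nonneg _) (fun _ => norm_add_le _ _) (hf.1.add hg.1)
  · simp only [e]
    exact (hf.hasSum.add hg.hasSum).tsum_eq

lemma Ev.zero (z : ℝ) : Ev 0 z 0 := by
  constructor <;> simp [summable_zero]

lemma Ev.sum {ι : Type*} (s : Finset ι) (f : ι → PowerSeries ℚ) (z : ℝ) (v : ι → ℝ) (h : ∀ i, Ev (f i) z (v i)) :
    Ev (∑ i ∈ s, f i) z (∑ i ∈ s, v i) := by
  classical
  induction s using Finset.induction_on with
  | empty => simpa using Ev.zero z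
  | insert a s ha ih =>
    rw [Finset.sum_insert ha, Finset.sum_insert ha]
    exact (h a).add ih

lemma Ev.ofC (c : ℚ) (z : ℝ) : Ev (PowerSeries.C c) z c := by
  have h0 : ∀ j ∉ ({0} : Finset ℕ), ((PowerSeries.coeff j (PowerSeries.C c) : ℚ) : ℝ) * z ^ j = 0 := by
    intro j hj
    rw [mem_singleton] at hj
    rw [PowerSeries.coeff_C, if_neg hj]; simp
  refine ⟨?_, ?_⟩
  · apply summable_of_ne_finset_zero (s := {0})
    intro j hj; rw [h0 j hj, norm_zero]
  · rw [tsum_eq_sum h0]; simp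

lemma Ev.theta (p : ℤ[X]) (z : ℝ) : Ev (theta 0 p) z (p.aeval z) := by
  have h0 : ∀ j ∉ range (p.natDegree + 1), ((PowerSeries.coeff j (Pf.theta 0 p) : ℚ) : ℝ) * z ^ j = 0 := by
    intro j hj
    rw [mem_range] at hj
    rw [theta_zero_coeff, coeff_eq_zero_of_natDegree_lt (by omega)]; simp
  refine ⟨?_, ?_⟩
  · apply summable_of_ne_finset_zero (s := range (p.natDegree + 1))
    intro j hj; rw [h0 j hj, norm_zero]
  · rw [tsum_eq_sum h0, aeval_eq_sum_range' (n := p.natDegree + 1) (by omega)]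
    refine Finset.sum_congr rfl fun j _ => ?_
    rw [theta_zero_coeff, zsmul_eq_mul]; push_cast; rfl

lemma term_le (f : PowerSeries ℚ) (C M z : ℝ) (hz : 0 ≤ z)
    (h : ∀ j, |((PowerSeries.coeff j f : ℚ) : ℝ)| ≤ M * C ^ j) (j : ℕ) :
    ‖((PowerSeries.coeff j f : ℚ) : ℝ) * z ^ j‖ ≤ M * (C * z) ^ j := by
  rw [norm_mul, norm_pow, Real.norm_eq_abs, Real.norm_eq_abs, abs_of_nonneg hz, mul_pow, ← mul_assoc]
  have := h j
  gcongr

lemma Ev.exists (f : PowerSeries ℚ) (C M z : ℝ) (hC : 0 ≤ C) (hz : 0 ≤ z) (hCz : C * z ≤ 1 / 2)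
    (h : ∀ j, |((PowerSeries.coeff j f : ℚ) : ℝ)| ≤ M * C ^ j) : ∃ v, Ev f z v := by
  refine ⟨_, ?_, rfl⟩
  refine Summable.of_nonneg_of_le (fun _ => norm_nonneg _) (term_le f C M z hz h) ?_
  exact (summable_geometric_of_lt_one (by positivity) (by linarith)).mul_left _

lemma Ev.bound {f : PowerSeries ℚ} {C M z v : ℝ} (hv : Ev f z v) (hC : 0 ≤ C) (hz : 0 ≤ z) (hCz : C * z ≤ 1 / 2)
    (h : ∀ j, |((PowerSeries.coeff j f : ℚ) : ℝ)| ≤ M * C ^ j) (e : ℕ) (q : ℝ)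
    (hq : q = ∑ j ∈ range e, ((PowerSeries.coeff j f : ℚ) : ℝ) * z ^ j) : |v - q| ≤ 2 * M * (C * z) ^ e := by
  have h1 := hv.1.of_norm.sum_add_tsum_nat_add e
  rw [hv.2, ← hq] at h1
  have h2 : v - q = ∑' i, ((PowerSeries.coeff (i + e) f : ℚ) : ℝ) * z ^ (i + e) := by rw [← h1]; ring
  rw [h2, ← Real.norm_eq_abs]
  have hg : HasSum (fun i => M * (C * z) ^ e * (C * z) ^ i) (M * (C * z) ^ e * (1 - C * z)⁻¹) :=
    (hasSum_geometric_of_lt_one (by positivity) (by linarith)).mul_left _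
  refine (tsum_of_norm_bounded hg ?_).trans ?_
  · intro i
    refine (term_le f C M z hz h (i + e)).trans (le_of_eq ?_)
    rw [pow_add]; ring
  · have hM : 0 ≤ M := by
      have := (abs_nonneg _).trans (h 0); simpa using this
    have : (1 - C * z)⁻¹ ≤ 2 := by
      rw [inv_le_comm₀ (by linarith) (by norm_num)]; linarith
    have h0 : 0 ≤ M * (C * z) ^ e := by positivity
    nlinarith

lemma coeff_mul_bound (p : ℤ[X]) (ε : PowerSeries ℚ) (C : ℕ) (hC : 1 ≤ C)
    (hε : ∀ j, |PowerSeries.coeff j ε| ≤ (C : ℚ) ^ j) (j : ℕ) :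
    |((PowerSeries.coeff j (theta 0 p * ε) : ℚ) : ℝ)| ≤ l1 p * (C : ℝ) ^ j := by
  classical
  rw [PowerSeries.coeff_mul]
  push_cast
  refine (Finset.abs_sum_le_sum_abs _ _).trans ?_
  have hC' : (1 : ℝ) ≤ C := by exact_mod_cast hC
  have hε' : ∀ j, |((PowerSeries.coeff j ε : ℚ) : ℝ)| ≤ (C : ℝ) ^ j := fun j => by exact_mod_cast hε j
  calc _ ≤ ∑ x ∈ antidiagonal j, |(p.coeff x.1 : ℝ)| * (C : ℝ) ^ j := by
        apply Finset.sum_le_sum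
        intro x hx
        rw [HasAntidiagonal.mem_antidiagonal] at hx
        rw [abs_mul, theta_zero_coeff]
        push_cast
        have h1 := hε' x.2
        have h2 : (C : ℝ) ^ x.2 ≤ (C : ℝ) ^ j := pow_le_pow_right₀ hC' (by omega)
        gcongr
        exact h1.trans h2
    _ = (∑ i ∈ range (j + 1), |(p.coeff i : ℝ)|) * (C : ℝ) ^ j := by
        rw [← Finset.sum_mul, Finset.Nat.sum_antidiagonal_eq_sum_range_succ_mk]
    _ ≤ _ := by
        gcongr
        rw [l1_eq p (range (j + 1) ∪ p.support) subset_union_right]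
        exact Finset.sum_le_sum_of_subset_of_nonneg subset_union_left fun _ _ _ => abs_nonneg _

lemma upper {ι : Type} [Fintype ι] (e C : ℕ) (hC : 1 ≤ C) (φ ε : ι → PowerSeries ℚ)
    (hφ : ∀ k j, |PowerSeries.coeff j (φ k)| ≤ (C : ℚ) ^ j) (hε : ∀ k j, |PowerSeries.coeff j (ε k)| ≤ (C : ℚ) ^ j)
    (p : ι → ℤ[X]) (B : ℝ) (hB : ∀ k, l1 (p k) ≤ B) (β : ℕ → ℕ)
    (hdvd : ∀ b < e, PowerSeries.X ^ (β b) ∣ ∑ k, PowerSeries.C (PowerSeries.coeff b (φ k)) * (theta 0 (p k) * ε k))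
    (z1 z2 : ℝ) (hz1 : 0 ≤ z1) (hz2 : 0 ≤ z2) (hz1' : C * z1 ≤ 1 / 2) (hz2' : C * z2 ≤ 1 / 2)
    (εv φv : ι → ℝ) (hεv : ∀ k, Ev (ε k) z1 (εv k)) (hφv : ∀ k, Ev (φ k) z2 (φv k)) :
    |∑ k, φv k * (aeval z1 (p k) * εv k)| ≤
      Fintype.card ι * B * (2 * ∑ b ∈ range e, (C * z2) ^ b * (C * z1) ^ (β b) + 4 * (C * z2) ^ e) := by
  have hC' : (1 : ℝ) ≤ C := by exact_mod_cast hC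
  have hz11 : z1 ≤ 1 := by nlinarith
  have hε' : ∀ k j, |((PowerSeries.coeff j (ε k) : ℚ) : ℝ)| ≤ 1 * (C : ℝ) ^ j := fun k j => by
    rw [one_mul]; exact_mod_cast hε k j
  have hφ' : ∀ k j, |((PowerSeries.coeff j (φ k) : ℚ) : ℝ)| ≤ 1 * (C : ℝ) ^ j := fun k j => by
    rw [one_mul]; exact_mod_cast hφ k j
  set g : ℕ → ℝ := fun b => ∑ k, ((PowerSeries.coeff b (φ k) : ℚ) : ℝ) * (aeval z1 (p k) * εv k) with hg
  set R : ι → ℝ := fun k => φv k - ∑ b ∈ range e, ((PowerSeries.coeff b (φ k) : ℚ) : ℝ) * z2 ^ b with hR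
  have hsplit : ∑ k, φv k * (aeval z1 (p k) * εv k) = ∑ b ∈ range e, z2 ^ b * g b + ∑ k, R k * (aeval z1 (p k) * εv k) := by
    simp only [hg, Finset.mul_sum]
    rw [Finset.sum_comm, ← Finset.sum_add_distrib]
    refine Finset.sum_congr rfl fun k _ => ?_
    rw [hR]
    simp only
    rw [sub_mul, Finset.sum_mul]
    have : ∀ b ∈ range e, z2 ^ b * (((PowerSeries.coeff b (φ k) : ℚ) : ℝ) * (aeval z1 (p k) * εv k)) =
      ((PowerSeries.coeff b (φ k) : ℚ) : ℝ) * z2 ^ b * (aeval z1 (p k) * εv k) := fun b _ => by ring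
    rw [Finset.sum_congr rfl this]
    ring
  have hgb : ∀ b ∈ range e, |z2 ^ b * g b| ≤ Fintype.card ι * B * (2 * ((C * z2) ^ b * (C * z1) ^ (β b))) := by
    intro b hb
    rw [mem_range] at hb
    have hev : Ev (∑ k, PowerSeries.C (PowerSeries.coeff b (φ k)) * (theta 0 (p k) * ε k)) z1 (g b) :=
      Ev.sum _ _ _ _ fun k => (Ev.ofC _ _).mul ((Ev.theta _ _).mul (hεv k))
    have hd := hdvd b hb
    rw [PowerSeries.X_pow_dvd_iff] at hd
    have hbd := hev.bound (C := C) (M := Fintype.card ι * (C ^ b * B)) (by positivity) hz1 hz1' (by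
      intro j
      rw [map_sum]
      push_cast
      refine (Finset.abs_sum_le_sum_abs _ _).trans ?_
      calc _ ≤ ∑ k : ι, ((C : ℝ) ^ b * (B * C ^ j)) := by
            apply Finset.sum_le_sum
            intro k _
            rw [PowerSeries.coeff_C_mul]
            push_cast
            rw [abs_mul]
            have h1 := hφ' k b
            have h2 := coeff_mul_bound (p k) (ε k) C hC (hε k) j
            have h3 := hB k
            rw [one_mul] at h1
            have h4 : l1 (p k) * (C : ℝ) ^ j ≤ B * C ^ j := by gcongr
            exact mul_le_mul h1 (h2.trans h4) (abs_nonneg _) (by positivity)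
        _ = _ := by simp; ring) (β b) 0 (by
      rw [Finset.sum_eq_zero]
      intro j hj
      rw [mem_range] at hj
      rw [hd j hj]; simp)
    rw [sub_zero] at hbd
    rw [abs_mul, abs_of_nonneg (by positivity : 0 ≤ z2 ^ b)]
    calc _ ≤ z2 ^ b * (2 * (Fintype.card ι * (C ^ b * B)) * (C * z1) ^ (β b)) := by gcongr
      _ = _ := by rw [mul_pow (C : ℝ) z2]; ring
  have hRb : ∀ k, |R k * (aeval z1 (p k) * εv k)| ≤ B * (4 * (C * z2) ^ e) := by
    intro k
    have h1 := (hφv k).bound (by positivity) hz2 hz2' (hφ' k) e _ rfl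
    have h2 := (hεv k).bound (by positivity) hz1 hz1' (hε' k) 0 0 (by simp)
    have h3 := (l1_eval (p k) z1 (by rw [abs_of_nonneg hz1]; exact hz11)).trans (hB k)
    rw [sub_zero, pow_zero] at h2
    have hB0 : 0 ≤ B := (l1_nonneg _).trans (hB k)
    rw [abs_mul, abs_mul]
    calc _ ≤ (2 * 1 * (C * z2) ^ e) * (B * (2 * 1 * 1)) := by gcongr
      _ = _ := by ring
  rw [hsplit]
  refine (abs_add_le _ _).trans ?_
  rw [mul_add]
  apply add_le_add
  · refine (Finset.abs_sum_le_sum_abs _ _).trans ((Finset.sum_le_sum hgb).trans (le_of_eq ?_))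
    rw [← Finset.mul_sum, ← Finset.mul_sum]
  · refine (Finset.abs_sum_le_sum_abs _ _).trans ((Finset.sum_le_sum fun k _ => hRb k).trans (le_of_eq ?_))
    simp; ring

end Pf

namespace Pf

lemma digits (X : ℕ) (hX : 0 < X) (m : ℕ) : ∀ (c : Fin (m + 1) → ℤ), (∀ i, |c i| < X) →
    ∑ i : Fin (m + 1), (X : ℤ) ^ (m - (i : ℕ)) * c i = 0 → ∀ i, c i = 0 := by
  induction m with
  | zero =>
    intro c _ h i
    have : i = 0 := Fin.ext (by have := i.2; simp)
    subst this
    rw [Fin.sum_univ_succ] at h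
    simpa using h
  | succ m ih =>
    intro c hc h
    rw [Fin.sum_univ_castSucc] at h
    have e : ∀ i : Fin (m + 1), (X : ℤ) ^ (m + 1 - ((Fin.castSucc i : Fin (m + 1 + 1)) : ℕ)) * c (Fin.castSucc i)
       = X * ((X : ℤ) ^ (m - (i : ℕ)) * c (Fin.castSucc i)) := by
      intro i
      rw [Fin.val_castSucc, show m + 1 - (i : ℕ) = m - i + 1 by have := i.2; omega, pow_succ]
      ring
    simp only [e] at h
    rw [← Finset.mul_sum] at h
    simp only [Fin.val_last, Nat.sub_self, pow_zero, one_mul] at h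
    have hl : c (Fin.last (m + 1)) = 0 := by
      apply Int.eq_zero_of_abs_lt_dvd (m := (X : ℤ)) ?_ (hc _)
      exact ⟨-∑ i : Fin (m + 1), (X : ℤ) ^ (m - (i : ℕ)) * c (Fin.castSucc i), by linarith⟩
    rw [hl, add_zero] at h
    have h2 := (mul_eq_zero.mp h).resolve_left (by exact_mod_cast hX.ne')
    have h3 := ih (fun i => c (Fin.castSucc i)) (fun i => hc _) h2
    intro i
    exact Fin.lastCases hl h3 i

/-- the chosen square root with constant term one -/
noncomputable def rt (P : PowerSeries ℚ) : PowerSeries ℚ :=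
  open Classical in if h : PowerSeries.coeff 0 P = 1 then (exists_sqrt P h).choose else 1

lemma rt_zero (P : PowerSeries ℚ) (h : PowerSeries.coeff 0 P = 1) : PowerSeries.coeff 0 (rt P) = 1 := by
  rw [rt, dif_pos h]; exact (exists_sqrt P h).choose_spec.1

lemma rt_sq (P : PowerSeries ℚ) (h : PowerSeries.coeff 0 P = 1) : rt P ^ 2 = P := by
  rw [rt, dif_pos h]; exact (exists_sqrt P h).choose_spec.2

lemma rt_one : rt 1 = 1 := by
  have h : PowerSeries.coeff 0 (1 : PowerSeries ℚ) = 1 := by simp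
  have h1 := rt_sq 1 h
  rcases mul_self_eq_one_iff.mp ((pow_two _).symm.trans h1) with h2 | h2
  · exact h2
  · have h3 := rt_zero 1 h
    rw [h2] at h3
    simp at h3
    norm_num at h3

lemma eps_int (E : ℤ[X]) (h0 : E.coeff 0 = 1) (j : ℕ) :
    ∃ t : ℤ, 4 ^ j * PowerSeries.coeff j (rt (theta 0 E)) = (t : ℚ) := by
  have h0' : PowerSeries.coeff 0 (theta 0 E) = 1 := by rw [theta_zero_coeff, h0]; simp
  have := sqrt_int' (PowerSeries.rescale 4 (rt (theta 0 E))) (by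
    rw [PowerSeries.coeff_rescale, rt_zero _ h0']; simp) (by
    intro n
    rw [← map_pow, rt_sq _ h0', PowerSeries.coeff_rescale, theta_zero_coeff]
    exact ⟨4 ^ n * E.coeff (n + 1), by push_cast; ring⟩) j
  simpa [PowerSeries.coeff_rescale] using this

lemma eps_bound (E : ℤ[X]) (h0 : E.coeff 0 = 1) (B : ℕ) (hB1 : 1 ≤ B) (hB : l1 E ≤ B) (j : ℕ) :
    |PowerSeries.coeff j (rt (theta 0 E))| ≤ ((4 * B : ℕ) : ℚ) ^ j := by
  have h0' : PowerSeries.coeff 0 (theta 0 E) = 1 := by rw [theta_zero_coeff, h0]; simp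
  have hB1' : (1 : ℚ) ≤ B := by exact_mod_cast hB1
  have := sqrt_bound' (rt (theta 0 E)) (rt_zero _ h0') B hB1' (by
    intro n
    rw [rt_sq _ h0', theta_zero_coeff]
    have h1 : |(E.coeff (n + 1) : ℝ)| ≤ B := (coeff_le_l1 E (n + 1)).trans hB
    have h2 : |(E.coeff (n + 1) : ℚ)| ≤ B := by exact_mod_cast h1
    exact h2.trans (le_self_pow₀ hB1' (by omega))) j
  push_cast
  exact this

lemma eps_ev (E : ℤ[X]) (h0 : E.coeff 0 = 1) (C : ℕ)
    (hC : ∀ j, |PowerSeries.coeff j (rt (theta 0 E))| ≤ (C : ℚ) ^ j) (z : ℝ) (hz : 0 ≤ z) (hz' : C * z ≤ 1 / 4) :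
    ∃ v, Ev (rt (theta 0 E)) z v ∧ 0 < v ∧ v ^ 2 = E.aeval z := by
  have h0' : PowerSeries.coeff 0 (theta 0 E) = 1 := by rw [theta_zero_coeff, h0]; simp
  have hC' : ∀ j, |((PowerSeries.coeff j (rt (theta 0 E)) : ℚ) : ℝ)| ≤ 1 * (C : ℝ) ^ j := fun j => by
    rw [one_mul]; exact_mod_cast hC j
  obtain ⟨v, hv⟩ := Ev.exists (rt (theta 0 E)) C 1 z (by positivity) hz (by linarith) hC'
  refine ⟨v, hv, ?_, ?_⟩
  · have := hv.bound (by positivity) hz (by linarith) hC' 1 1 (by rw [Finset.sum_range_one, rt_zero _ h0']; simp)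
    rw [abs_le] at this
    linarith [this.1]
  · have h1 := hv.mul hv
    rw [← pow_two, ← pow_two, rt_sq _ h0'] at h1
    exact h1.unique (Ev.theta E z)

lemma dvd_deriv {ι : Type} [Fintype ι] (E G a : ι → ℤ[X]) (Δ : ℤ[X]) (hGE : ∀ k, G k * E k = Δ) (ε : ι → PowerSeries ℚ)
    (hε : ∀ k, ε k ^ 2 = theta 0 (E k)) (w : ι → ℚ) (A l : ℕ)
    (h : PowerSeries.X ^ A ∣ ∑ k, PowerSeries.C (w k) * (theta 0 (a k) * ε k)) :
    PowerSeries.X ^ (A - l) ∣ ∑ k, PowerSeries.C (w k) * (theta 0 (bseq (E k) (G k) (a k) l) * ε k) := by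
  have lin : ∀ (i : ℕ) , dd^[i] (∑ k, PowerSeries.C (w k) * (theta 0 (a k) * ε k)) = ∑ k, PowerSeries.C (w k) * dd^[i] (theta 0 (a k) * ε k) := by
    intro i
    induction i with
    | zero => simp
    | succ i ih =>
      rw [Function.iterate_succ_apply', ih]
      simp only [dd, map_sum, Function.iterate_succ_apply']
      refine Finset.sum_congr rfl fun j _ => ?_
      rw [← PowerSeries.smul_eq_C_mul, ← PowerSeries.smul_eq_C_mul, Derivation.map_smul]
  have e : ∑ k, PowerSeries.C (w k) * (theta 0 (bseq (E k) (G k) (a k) l) * ε k) =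
      (2 * theta 0 Δ) ^ l * dd^[l] (∑ k, PowerSeries.C (w k) * (theta 0 (a k) * ε k)) := by
    rw [lin, Finset.mul_sum]
    refine Finset.sum_congr rfl fun k _ => ?_
    rw [ode 0 (E k) (G k) (a k) 1 (ε k) (by simpa using hε k) l, hGE]
    ring
  rw [e]
  apply Dvd.dvd.mul_left
  rw [PowerSeries.X_pow_dvd_iff] at h ⊢
  intro t ht
  have := PowerSeries.coeff_iterate_derivative (R := ℚ) (∑ k, PowerSeries.C (w k) * (theta 0 (a k) * ε k)) l t
  rw [h (t + l) (by omega), mul_zero] at this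
  convert this using 1

lemma aeval_cast (p : ℤ[X]) (z : ℚ) : p.aeval ((z : ℚ) : ℝ) = ((p.aeval z : ℚ) : ℝ) := by
  have := Polynomial.aeval_algebraMap_apply ℝ z p
  simpa using this

end Pf

namespace Pf

lemma vanish {ι : Type} [Fintype ι] (E G a : ι → ℤ[X]) (Δ : ℤ[X]) (hGE : ∀ k, G k * E k = Δ)
    (x : ℕ) (hx : 0 < x) (D N : ℕ) (hD : ∀ k, (G k).natDegree + (E k).natDegree ≤ D)
    (hN : ∀ k, (a k).natDegree ≤ N) (hE : ∀ k, (E k).aeval (1 / (x : ℚ)) ≠ 0)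
    (hΔ : Δ.aeval (1 / (x : ℚ)) ≠ 0)
    (ρ : ι → PowerSeries ℚ) (h0 : ∀ k, PowerSeries.coeff 0 (ρ k) = 1)
    (hρ : ∀ k, PowerSeries.C ((E k).aeval (1 / (x : ℚ))) * ρ k ^ 2 = theta (1 / (x : ℚ)) (E k))
    (ν : ι → ℤ) (S : ℝ) (hS : 0 ≤ S) (φv εv : ι → ℝ) (hν : ∀ k, (ν k : ℝ) = S * (φv k * εv k))
    (l : ℕ) (Z : ℝ)
    (hJ : |∑ k, φv k * ((bseq (E k) (G k) (a k) l).aeval (1 / (x : ℝ)) * εv k)| ≤ Z)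
    (hlt : 2 ^ l * (x : ℝ) ^ (N + l * D) * (S * Z) < l.factorial) :
    PowerSeries.coeff l (∑ k, (ν k : ℚ) • (theta (1 / (x : ℚ)) (a k) * ρ k)) = 0 := by
  choose t ht using fun k => b_int x hx (E k) (G k) (a k) D N (hD k) (hN k) (hE k) (ρ k) (h0 k) (hρ k) l
  have hbe := fun k => b_eval (1 / (x : ℚ)) (E k) (G k) (a k) _ (ρ k) (hρ k) (h0 k) l
  have hfac : (l.factorial : ℝ) > 0 := by exact_mod_cast Nat.factorial_pos l
  have hfacQ : (l.factorial : ℚ) ≠ 0 := by exact_mod_cast (Nat.factorial_pos l).ne'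
  -- the integer
  have hT : (2 : ℚ) ^ l * (x : ℚ) ^ (N + l * D) * ∑ k, (ν k : ℚ) * (bseq (E k) (G k) (a k) l).aeval (1 / (x : ℚ))
      = l.factorial * ((∑ k, ν k * t k : ℤ) : ℚ) := by
    push_cast
    rw [Finset.mul_sum, Finset.mul_sum]
    refine Finset.sum_congr rfl fun k _ => ?_
    linear_combination (ν k : ℚ) * ht k
  have hTR : (2 : ℝ) ^ l * (x : ℝ) ^ (N + l * D) * ∑ k, (ν k : ℝ) * (bseq (E k) (G k) (a k) l).aeval (1 / (x : ℝ))
      = l.factorial * ((∑ k, ν k * t k : ℤ) : ℝ) := by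
    have : ∀ k, (bseq (E k) (G k) (a k) l).aeval (1 / (x : ℝ)) =
        (((bseq (E k) (G k) (a k) l).aeval (1 / (x : ℚ)) : ℚ) : ℝ) := fun k => by
      rw [← aeval_cast]; push_cast; rfl
    simp only [this]
    exact_mod_cast hT
  have hsum : ∑ k, (ν k : ℝ) * (bseq (E k) (G k) (a k) l).aeval (1 / (x : ℝ)) =
      S * ∑ k, φv k * ((bseq (E k) (G k) (a k) l).aeval (1 / (x : ℝ)) * εv k) := by
    rw [Finset.mul_sum]
    refine Finset.sum_congr rfl fun k _ => ?_
    rw [hν]; ring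
  have hT0 : (∑ k, ν k * t k : ℤ) = 0 := by
    rw [hsum] at hTR
    have h1 : (l.factorial : ℝ) * |((∑ k, ν k * t k : ℤ) : ℝ)| < l.factorial * 1 := by
      rw [← abs_of_pos hfac, ← abs_mul, abs_of_pos hfac, ← hTR, abs_mul, abs_mul S, abs_of_nonneg hS,
        abs_of_nonneg (show (0 : ℝ) ≤ 2 ^ l * (x : ℝ) ^ (N + l * D) by positivity), mul_one]
      refine lt_of_le_of_lt ?_ hlt
      gcongr
    have h2 := lt_of_mul_lt_mul_left h1 hfac.le
    have h3 : |(∑ k, ν k * t k : ℤ)| < 1 := by exact_mod_cast h2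
    exact Int.abs_lt_one_iff.mp h3
  rw [hT0] at hT
  have hx' : (x : ℚ) ≠ 0 := by exact_mod_cast hx.ne'
  have h5 : ∑ k, (ν k : ℚ) * (bseq (E k) (G k) (a k) l).aeval (1 / (x : ℚ)) = 0 := by
    have := hT
    simp only [Int.cast_zero, mul_zero] at this
    exact (mul_eq_zero.mp this).resolve_left (by positivity)
  have h6 : ∑ k, (ν k : ℚ) * (bseq (E k) (G k) (a k) l).aeval (1 / (x : ℚ)) =
      ((2 * Δ.aeval (1 / (x : ℚ))) ^ l * l.factorial) *
       PowerSeries.coeff l (∑ k, (ν k : ℚ) • (theta (1 / (x : ℚ)) (a k) * ρ k)) := by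
    rw [map_sum, Finset.mul_sum]
    refine Finset.sum_congr rfl fun k _ => ?_
    rw [hbe, hGE, PowerSeries.coeff_smul]
    simp only [smul_eq_mul]
    ring
  rw [h5] at h6
  exact (mul_eq_zero.mp h6.symm).resolve_left (mul_ne_zero (pow_ne_zero _ (mul_ne_zero two_ne_zero hΔ)) hfacQ)

abbrev Idx (m : ℕ) : Type := Fin (m + 1) ⊕ (Fin (m + 1) ⊕ Unit)

def sel {α : Type} (m : ℕ) (u v : Fin (m + 1) → α) (w : α) : Idx m → α :=
  Sum.elim u (Sum.elim v (fun _ => w))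

lemma sel_sum {α : Type} [AddCommMonoid α] (m : ℕ) (f : Idx m → α) :
    ∑ k, f k = ∑ i, f (Sum.inl i) + (∑ i, f (Sum.inr (Sum.inl i)) + f (Sum.inr (Sum.inr ()))) := by
  rw [Fintype.sum_sum_type, Fintype.sum_sum_type]; simp

lemma sel_card (m : ℕ) : Fintype.card (Idx m) = 2 * m + 3 := by
  simp [Idx]; omega

lemma phi_ne (m : ℕ) (E2 : ℤ[X]) (h2 : E2.coeff 0 = 1) (ns1 : NS (1 + X)) (ns2 : NS E2) (ns12 : NS ((1 + X) * E2))
    (z e1 e2 : ℚ) (he1 : e1 ≠ 0) (he2 : e2 ≠ 0) (ρ : Idx m → PowerSeries ℚ) (ρ1 ρ2 : PowerSeries ℚ)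
    (hρ : ρ = sel m (fun _ => 1) (fun _ => ρ1) ρ2)
    (hρ1 : PowerSeries.C e1 * ρ1 ^ 2 = theta z (1 + X)) (hρ2 : PowerSeries.C e2 * ρ2 ^ 2 = theta z E2)
    (x2 u v n2 : ℕ) (hu : 0 < u) (hv : 0 < v) (hn2 : 0 < n2) (hx2 : 0 < x2)
    (ν : Idx m → ℤ) (hν : ν = sel (α := ℤ) m (fun i => (u : ℤ) * (x2 : ℤ) ^ (m - (i : ℕ))) (fun i => (v : ℤ) * (x2 : ℤ) ^ (m - (i : ℕ))) (n2 : ℤ))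
    (a : Idx m → ℤ[X]) (ha : ∃ k, a k ≠ 0) (hb : ∀ k j, |(a k).coeff j| < x2) :
    ∑ k, (ν k : ℚ) • (theta z (a k) * ρ k) ≠ 0 := by
  intro h
  have key := indep z (1 + X) E2 ns1 ns2 ns12 (by simp) h2 e1 e2 he1 he2 ρ1 ρ2 hρ1 hρ2
    (∑ i : Fin (m + 1), C (ν (Sum.inl i)) * a (Sum.inl i))
    (∑ i : Fin (m + 1), C (ν (Sum.inr (Sum.inl i))) * a (Sum.inr (Sum.inl i)))
    (C (ν (Sum.inr (Sum.inr ()))) * a (Sum.inr (Sum.inr ()))) (by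
      rw [sel_sum] at h
      rw [← h, map_sum, map_sum, Finset.sum_mul, map_mul, theta_C]
      have hc : ∀ (t : ℤ) (f : PowerSeries ℚ), (t : PowerSeries ℚ) * f = (t : ℚ) • f := by
        intro t f
        rw [PowerSeries.smul_eq_C_mul]; simp
      simp only [map_mul, theta_C, hρ, sel, Sum.elim_inl, Sum.elim_inr, mul_one, hc, mul_assoc, smul_mul_assoc, add_assoc])
  obtain ⟨k0, k1, k2⟩ := key
  have aux : ∀ (w : ℕ) (_ : 0 < w) (b : Fin (m + 1) → ℤ[X]), (∀ i j, |(b i).coeff j| < x2) →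
      ∑ i : Fin (m + 1), C ((w : ℤ) * (x2 : ℤ) ^ (m - (i : ℕ))) * b i = 0 → ∀ i, b i = 0 := by
    intro w hw b hb' hs i
    ext j
    rw [coeff_zero]
    refine digits x2 hx2 m (fun i => (b i).coeff j) (fun i => hb' i j) ?_ i
    have h3 := congrArg (fun p => coeff p j) hs
    simp only [finset_sum_coeff, coeff_C_mul, coeff_zero] at h3
    have h4 : (w : ℤ) * ∑ i : Fin (m + 1), (x2 : ℤ) ^ (m - (i : ℕ)) * (b i).coeff j = 0 := by
      rw [← h3, Finset.mul_sum]
      exact Finset.sum_congr rfl fun i _ => by ring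
    exact (mul_eq_zero.mp h4).resolve_left (by exact_mod_cast hw.ne')
  rw [hν] at k0 k1 k2
  simp only [sel, Sum.elim_inl, Sum.elim_inr] at k0 k1 k2
  obtain ⟨k, hk⟩ := ha
  apply hk
  rcases k with i | i | i
  · exact aux u hu (fun i => a (Sum.inl i)) (fun i j => hb _ j) k0 i
  · exact aux v hv (fun i => a (Sum.inr (Sum.inl i))) (fun i j => hb _ j) k1 i
  · refine (mul_eq_zero.mp k2).resolve_left ?_
    simp [hn2.ne']

end Pf

namespace Pf

lemma ns_one_add_X : NS (1 + X) := by
  refine ns_simple (1 + X) (-1) 1 ?_ (by simp)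
  simp; ring

lemma nu_eq (m : ℕ) (x1 x2 n0 n1 n2 : ℕ) (hx1 : 0 < x1) (hx2 : 0 < x2) (E2 : ℤ[X])
    (q0 : n0 ^ 2 = x1 * x2) (q1 : n1 ^ 2 = (x1 + 1) * (x2 + 1))
    (q2 : (n2 : ℚ) ^ 2 = ((x1 : ℚ) * x2) ^ (2 * m + 1) * (E2.aeval (1 / (x1 : ℚ)) * E2.aeval (1 / (x2 : ℚ))))
    (v1 v2 : Idx m → ℝ) (hv1 : ∀ k, 0 < v1 k) (hv2 : ∀ k, 0 < v2 k)
    (s1 : ∀ k, v1 k ^ 2 = (sel m (fun _ => 1) (fun _ => 1 + X) E2 k).aeval (1 / (x1 : ℝ)))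
    (s2 : ∀ k, v2 k ^ 2 = (sel m (fun _ => 1) (fun _ => 1 + X) E2 k).aeval (1 / (x2 : ℝ))) (k : Idx m) :
    ((sel (α := ℤ) m (fun i => ((n0 * x1 ^ m : ℕ) : ℤ) * (x2 : ℤ) ^ (m - (i : ℕ)))
      (fun i => ((n1 * x1 ^ m : ℕ) : ℤ) * (x2 : ℤ) ^ (m - (i : ℕ))) (n2 : ℤ) k : ℤ) : ℝ) =
    ((n0 : ℝ) * x1 ^ m * x2 ^ m) * (((1 / (x2 : ℝ)) ^ (sel m (fun i => (i : ℕ)) (fun i => (i : ℕ)) 0 k) * v2 k) * v1 k) := by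
  have hx1R : (x1 : ℝ) ≠ 0 := by exact_mod_cast hx1.ne'
  have hx2R : (x2 : ℝ) ≠ 0 := by exact_mod_cast hx2.ne'
  have q0R : (n0 : ℝ) ^ 2 = x1 * x2 := by exact_mod_cast q0
  have q1R : (n1 : ℝ) ^ 2 = (x1 + 1) * (x2 + 1) := by exact_mod_cast q1
  have q2R : (n2 : ℝ) ^ 2 = ((x1 : ℝ) * x2) ^ (2 * m + 1) * (E2.aeval (1 / (x1 : ℝ)) * E2.aeval (1 / (x2 : ℝ))) := by
    have e1 := aeval_cast E2 (1 / (x1 : ℚ))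
    have e2 := aeval_cast E2 (1 / (x2 : ℚ))
    push_cast at e1 e2
    rw [e1, e2]
    exact_mod_cast q2
  have red : ∀ i : Fin (m + 1), (x2 : ℝ) ^ m * (1 / (x2 : ℝ)) ^ (i : ℕ) = (x2 : ℝ) ^ (m - (i : ℕ)) := by
    intro i
    rw [pow_sub₀ _ hx2R (by have := i.2; omega)]
    simp
  have p1 := hv1 k
  have p2 := hv2 k
  have t1 := s1 k
  have t2 := s2 k
  rw [← pow_left_inj₀ (n := 2) ?_ (by positivity) two_ne_zero]
  · rcases k with i | i | i
    · simp only [sel, Sum.elim_inl, Sum.elim_inr] at t1 t2 ⊢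
      push_cast
      rw [← red i]
      simp only [map_one] at t1 t2
      simp only [mul_pow, t1, t2]; ring
    · simp only [sel, Sum.elim_inl, Sum.elim_inr] at t1 t2 ⊢
      push_cast
      rw [← red i]
      simp only [map_one, map_add, aeval_X] at t1 t2
      simp only [mul_pow, t1, t2, q0R, q1R]
      field_simp
    · simp only [sel, Sum.elim_inl, Sum.elim_inr] at t1 t2 ⊢
      push_cast
      simp only [mul_pow, t1, t2, q0R, q2R]
      ring
  · rcases k with i | i | i <;> simp only [sel, Sum.elim_inl, Sum.elim_inr] <;> positivity

set_option maxHeartbeats 400000 in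
theorem inner (m : ℕ) (E2 : ℤ[X]) (h2 : E2.coeff 0 = 1) (hdeg : E2.natDegree ≤ 2 * m + 1) (ns2 : NS E2)
    (ns12 : NS ((1 + X) * E2)) :
    ∃ (Cc C2 : ℕ) (M : ℝ), 1 ≤ Cc ∧ 1 ≤ C2 ∧ 1 ≤ M ∧ ∀ (e d : ℕ), e = 2 * m + 1 → d = 2 * m + 3 →
      ∀ x1 x2 n0 n1 n2 I L N : ℕ, N = 4 * e ^ 2 * I →
      4 * Cc ≤ x1 → 4 * Cc ≤ x2 → n0 ^ 2 = x1 * x2 → n1 ^ 2 = (x1 + 1) * (x2 + 1) →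
      (n2 : ℚ) ^ 2 = ((x1 : ℚ) * x2) ^ (2 * m + 1) * (E2.aeval (1 / (x1 : ℚ)) * E2.aeval (1 / (x2 : ℚ))) →
      C2 ^ I < x2 → 1 ≤ I → d ≤ N → L ≤ N →
      (∀ l < L, 2 ^ l * (x1 : ℝ) ^ (N + l * (e + 1)) * (((n0 : ℝ) * x1 ^ m * x2 ^ m) *
        (d * ((M * N) ^ l * (N * (C2 : ℝ) ^ I)) *
        (2 * ∑ b ∈ range e, (Cc * (1 / (x2 : ℝ))) ^ b * (Cc * (1 / (x1 : ℝ))) ^ (2 * e * I * (4 * (e - b) + 1) - l)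
          + 4 * (Cc * (1 / (x2 : ℝ))) ^ e))) < l.factorial) →
      (x1 : ℝ) ^ (L - d) ≤ d.factorial * ((M * N) ^ d * (N * (C2 : ℝ) ^ I)) ^ d := by
  obtain ⟨B, hB⟩ := exists_nat_ge (l1 1 + l1 (1 + X) + l1 E2 + 1)
  have b1 := l1_nonneg (1 : ℤ[X])
  have b2 := l1_nonneg (1 + X : ℤ[X])
  have b3 := l1_nonneg E2
  have hB1 : 1 ≤ B := by
    have : (1 : ℝ) ≤ B := by linarith
    exact_mod_cast this
  set E : Idx m → ℤ[X] := sel m (fun _ => 1) (fun _ => 1 + X) E2 with hEdef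
  set G : Idx m → ℤ[X] := sel m (fun _ => (1 + X) * E2) (fun _ => E2) (1 + X) with hGdef
  set ix : Idx m → ℕ := sel m (fun i => (i : ℕ)) (fun i => (i : ℕ)) 0 with hix
  have hE0 : ∀ k, (E k).coeff 0 = 1 := by
    rintro (i | i | i) <;> simp [hEdef, sel, h2]
  have hGE : ∀ k, G k * E k = (1 + X) * E2 := by
    rintro (i | i | i) <;> simp [hEdef, hGdef, sel] ; ring
  have hEl : ∀ k, l1 (E k) ≤ B := by
    rintro (i | i | i) <;> simp only [hEdef, sel, Sum.elim_inl, Sum.elim_inr] <;> linarith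
  have d1 : (1 + X : ℤ[X]).natDegree ≤ 1 := by compute_degree
  have hD : ∀ k, (G k).natDegree + (E k).natDegree ≤ (2 * m + 1) + 1 := by
    rintro (i | i | i) <;> simp only [hEdef, hGdef, sel, Sum.elim_inl, Sum.elim_inr]
    · have := natDegree_mul_le (p := (1 + X : ℤ[X])) (q := E2)
      simp only [natDegree_one]; omega
    · omega
    · omega
  obtain ⟨Cc, hCc⟩ : ∃ Cc : ℕ, Cc = 4 * B := ⟨_, rfl⟩
  set ε : Idx m → PowerSeries ℚ := fun k => rt (theta 0 (E k)) with hε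
  set φ : Idx m → PowerSeries ℚ := fun k => PowerSeries.X ^ (ix k) * ε k with hφ
  have hCc1 : 1 ≤ Cc := by omega
  have hCcQ : (1 : ℚ) ≤ Cc := by exact_mod_cast hCc1
  have eb : ∀ k j, |PowerSeries.coeff j (ε k)| ≤ (Cc : ℚ) ^ j := fun k j => by
    rw [hCc]; exact eps_bound (E k) (hE0 k) B hB1 (hEl k) j
  have pb : ∀ k j, |PowerSeries.coeff j (φ k)| ≤ (Cc : ℚ) ^ j := fun k j => by
    simp only [hφ, PowerSeries.coeff_X_pow_mul']
    split_ifs with h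
    · exact (eb k _).trans (pow_le_pow_right₀ hCcQ (by omega))
    · simp
  have ei : ∀ k j, ∃ t : ℤ, 4 ^ j * PowerSeries.coeff j (ε k) = (t : ℚ) := fun k j => eps_int (E k) (hE0 k) j
  have pi : ∀ k j, ∃ t : ℤ, 4 ^ j * PowerSeries.coeff j (φ k) = (t : ℚ) := fun k j => by
    simp only [hφ, PowerSeries.coeff_X_pow_mul']
    split_ifs with h
    · obtain ⟨t, ht⟩ := ei k (j - ix k)
      refine ⟨4 ^ (ix k) * t, ?_⟩
      push_cast
      rw [← ht, ← mul_assoc, ← pow_add]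
      congr 3; omega
    · exact ⟨0, by simp⟩
  obtain ⟨C2, hC2, hsieg⟩ := siegel_step (2 * m + 1) Cc (by omega) hCc1
  set K : ℝ := 1 + ∑ k, (l1 (G k * E k) + l1 (G k * derivative (E k)) + l1 (derivative (G k * E k))) with hK
  have hnn : ∀ k, 0 ≤ (l1 (G k * E k) + l1 (G k * derivative (E k)) + l1 (derivative (G k * E k))) := fun k =>
    add_nonneg (add_nonneg (l1_nonneg _) (l1_nonneg _)) (l1_nonneg _)
  have hKk : ∀ k, (l1 (G k * E k) + l1 (G k * derivative (E k)) + l1 (derivative (G k * E k))) ≤ K := fun k => by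
    have := Finset.single_le_sum (fun k _ => hnn k) (Finset.mem_univ k)
    linarith
  have hK1 : 1 ≤ K := by
    have := Finset.sum_nonneg (fun k (_ : k ∈ Finset.univ) => hnn k)
    linarith
  set M : ℝ := K * (2 * ((2 * m + 1 + 1 : ℕ) : ℝ) + 5) with hM
  have hM1 : 1 ≤ M := by
    have : (0 : ℝ) ≤ ((2 * m + 1 + 1 : ℕ) : ℝ) := by positivity
    nlinarith
  refine ⟨Cc, C2, M, hCc1, hC2, hM1, ?_⟩
  rintro e d rfl rfl x1 x2 n0 n1 n2 I L N hN hx1 hx2 q0 q1 q2 hC2x hI hdN hLN hnum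
  have px1 : 0 < x1 := by omega
  have px2 : 0 < x2 := by omega
  obtain ⟨a, ha0, hadeg, hacoef, hadvd⟩ := hsieg (Idx m) (sel_card m) φ ε pi ei pb eb I hI
  rw [← hN] at hadeg
  have zb : ∀ x : ℕ, 4 * Cc ≤ x → (Cc : ℝ) * (1 / (x : ℝ)) ≤ 1 / 4 := by
    intro x hx
    have h1 : (0 : ℝ) < x := by
      have : 0 < x := by omega
      exact_mod_cast this
    have h2 : 4 * (Cc : ℝ) ≤ x := by exact_mod_cast hx
    rw [mul_one_div, div_le_iff₀ h1]; linarith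
  choose v1 hv1 pv1 sv1 using fun k => eps_ev (E k) (hE0 k) Cc (eb k) (1 / (x1 : ℝ)) (by positivity) (zb x1 hx1)
  choose v2 hv2 pv2 sv2 using fun k => eps_ev (E k) (hE0 k) Cc (eb k) (1 / (x2 : ℝ)) (by positivity) (zb x2 hx2)
  have hE1 : ∀ k, (E k).aeval (1 / (x1 : ℚ)) ≠ 0 := by
    intro k h
    have h3 := aeval_cast (E k) (1 / (x1 : ℚ))
    rw [h] at h3
    push_cast at h3
    have := sv1 k
    rw [h3] at this
    have := pow_pos (pv1 k) 2
    linarith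
  have hΔ1 : ((1 + X) * E2).aeval (1 / (x1 : ℚ)) ≠ 0 := by
    rw [map_mul]
    exact mul_ne_zero (hE1 (Sum.inr (Sum.inl 0))) (hE1 (Sum.inr (Sum.inr ())))
  have hΔ : (1 + X) * E2 ≠ 0 := fun h => hΔ1 (by rw [h, map_zero])
  set ρ : Idx m → PowerSeries ℚ := fun k =>
    rt (PowerSeries.C ((E k).aeval (1 / (x1 : ℚ)))⁻¹ * theta (1 / (x1 : ℚ)) (E k)) with hρdef
  have hc0 : ∀ k, PowerSeries.coeff 0 (PowerSeries.C ((E k).aeval (1 / (x1 : ℚ)))⁻¹ * theta (1 / (x1 : ℚ)) (E k)) = 1 := by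
    intro k
    rw [PowerSeries.coeff_C_mul, PowerSeries.coeff_zero_eq_constantCoeff_apply, theta_const, inv_mul_cancel₀ (hE1 k)]
  have hρ0 : ∀ k, PowerSeries.coeff 0 (ρ k) = 1 := fun k => rt_zero _ (hc0 k)
  have hρ : ∀ k, PowerSeries.C ((E k).aeval (1 / (x1 : ℚ))) * ρ k ^ 2 = theta (1 / (x1 : ℚ)) (E k) := by
    intro k
    rw [hρdef]
    simp only
    rw [rt_sq _ (hc0 k), ← mul_assoc, ← map_mul, mul_inv_cancel₀ (hE1 k), map_one, one_mul]
  set ν : Idx m → ℤ := sel (α := ℤ) m (fun i => ((n0 * x1 ^ m : ℕ) : ℤ) * (x2 : ℤ) ^ (m - (i : ℕ)))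
      (fun i => ((n1 * x1 ^ m : ℕ) : ℤ) * (x2 : ℤ) ^ (m - (i : ℕ))) (n2 : ℤ) with hνdef
  have hν := nu_eq m x1 x2 n0 n1 n2 px1 px2 E2 q0 q1 q2 v1 v2 pv1 pv2 sv1 sv2
  have hn0 : 0 < n0 := by
    rcases Nat.eq_zero_or_pos n0 with h | h
    · rw [h] at q0
      have := Nat.mul_pos px1 px2
      simp at q0; omega
    · exact h
  have hn1 : 0 < n1 := by
    rcases Nat.eq_zero_or_pos n1 with h | h
    · rw [h] at q1
      simp at q1
    · exact h
  have hn2 : 0 < n2 := by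
    rcases Nat.eq_zero_or_pos n2 with h | h
    · have := hν (Sum.inr (Sum.inr ()))
      simp only [sel, Sum.elim_inr, h] at this
      have p1 := pv1 (Sum.inr (Sum.inr ()))
      have p2 := pv2 (Sum.inr (Sum.inr ()))
      have : (0 : ℝ) < 0 := by
        nth_rw 2 [show (0 : ℝ) = ((((0 : ℕ) : ℤ)) : ℝ) by simp]
        rw [this]
        have a1 : (0 : ℝ) < n0 := by exact_mod_cast hn0
        have a2 : (0 : ℝ) < x1 := by exact_mod_cast px1
        have a3 : (0 : ℝ) < x2 := by exact_mod_cast px2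
        positivity
      exact absurd this (lt_irrefl _)
    · exact h
  have hl1a : ∀ k, l1 (a k) ≤ N * (C2 : ℝ) ^ I := fun k => l1_le_of_coeff (a k) N (hadeg k) _ (hacoef k)
  have hN1 : 1 ≤ N := by omega
  have hNR : (1 : ℝ) ≤ N := by exact_mod_cast hN1
  have hC2R : (1 : ℝ) ≤ C2 := by exact_mod_cast hC2
  have hMN : 1 ≤ M * N := by nlinarith
  have hbl : ∀ l ≤ N, ∀ k, l1 (bseq (E k) (G k) (a k) l) ≤ (M * N) ^ l * (N * (C2 : ℝ) ^ I) := by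
    intro l hl k
    have n1 := l1_nonneg (G k * E k)
    have n2 := l1_nonneg (G k * derivative (E k))
    have n3 := l1_nonneg (derivative (G k * E k))
    have := hKk k
    refine (bseq_l1 (E k) (G k) (a k) (2 * m + 1 + 1) N (hD k) (hadeg k).le hN1 K (by linarith) (by linarith) (by linarith) l hl).trans ?_
    rw [← hM]
    exact mul_le_mul_of_nonneg_left (hl1a k) (pow_nonneg (by linarith) _)
  have main := nonvan E G a ((1 + X) * E2) hΔ hGE x1 px1 ρ (fun k => (E k).aeval (1 / (x1 : ℚ))) hρ hρ0 (fun k => (ν k : ℚ))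
    (phi_ne m E2 h2 ns_one_add_X ns2 ns12 (1 / (x1 : ℚ)) _ _ (hE1 (Sum.inr (Sum.inl 0))) (hE1 (Sum.inr (Sum.inr ()))) ρ
      (ρ (Sum.inr (Sum.inl 0))) (ρ (Sum.inr (Sum.inr ()))) (by
        funext k
        rcases k with i | i | i
        · simp only [hρdef, hEdef, sel, Sum.elim_inl]
          simp [rt_one]
        · simp only [hρdef, hEdef, sel, Sum.elim_inl, Sum.elim_inr]
        · simp only [hρdef, hEdef, sel, Sum.elim_inl, Sum.elim_inr])
      (hρ (Sum.inr (Sum.inl 0))) (hρ (Sum.inr (Sum.inr ()))) x2 (n0 * x1 ^ m) (n1 * x1 ^ m) n2 (by positivity)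
      (by positivity) hn2 px2 ν hνdef a ha0 (by
        intro k j
        have h5 : ((|(a k).coeff j| : ℤ) : ℝ) ≤ ((C2 ^ I : ℕ) : ℝ) := by push_cast; exact hacoef k j
        have h6 : |(a k).coeff j| ≤ ((C2 ^ I : ℕ) : ℤ) := by exact_mod_cast h5
        have h7 : ((C2 ^ I : ℕ) : ℤ) < x2 := by exact_mod_cast hC2x
        exact lt_of_le_of_lt h6 h7))
    L ?_ ((M * N) ^ (2 * m + 3) * (N * (C2 : ℝ) ^ I)) ?_ ?_
  · rw [sel_card] at main
    exact main
  · intro l hl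
    refine vanish E G a ((1 + X) * E2) hGE x1 px1 (2 * m + 1 + 1) N hD (fun k => (hadeg k).le) hE1 hΔ1 ρ hρ0 hρ ν
      ((n0 : ℝ) * x1 ^ m * x2 ^ m) (by positivity) (fun k => (1 / (x2 : ℝ)) ^ (ix k) * v2 k) v1 hν l _ ?_ (hnum l hl)
    have hup := upper (2 * m + 1) Cc hCc1 φ ε pb eb (fun k => bseq (E k) (G k) (a k) l) _ (hbl l (by omega))
      (fun b => 2 * (2 * m + 1) * I * (4 * (2 * m + 1 - b) + 1) - l) (fun b hb =>
        dvd_deriv E G a ((1 + X) * E2) hGE ε (fun k => rt_sq _ (by rw [theta_zero_coeff, hE0]; simp)) _ _ l (hadvd b hb))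
      (1 / (x1 : ℝ)) (1 / (x2 : ℝ)) (by positivity) (by positivity) (by linarith [zb x1 hx1]) (by linarith [zb x2 hx2])
      v1 (fun k => (1 / (x2 : ℝ)) ^ (ix k) * v2 k) hv1 (fun k => by
        have h1 := Ev.theta (X ^ (ix k)) (1 / (x2 : ℝ))
        have h2 := h1.mul (hv2 k)
        rw [map_pow, theta_X, map_pow, aeval_X] at h2
        simpa [hφ, hε] using h2)
    rw [sel_card] at hup
    exact hup
  · have a1 : 1 ≤ (M * N) ^ (2 * m + 3) := one_le_pow₀ hMN
    have a2 : 1 ≤ (C2 : ℝ) ^ I := one_le_pow₀ hC2R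
    have a3 : 1 ≤ (N : ℝ) * (C2 : ℝ) ^ I := by nlinarith
    nlinarith
  · intro l hl k
    rw [sel_card] at hl
    refine (hbl l (by omega) k).trans ?_
    exact mul_le_mul_of_nonneg_right (pow_le_pow_right₀ hMN (by omega)) (by positivity)

end Pf

namespace Pf

lemma big (Q P X : ℝ) (c J q : ℕ) (hQ : Q ≤ q) (hP : 0 ≤ P) (hX : P ≤ X) (hX2 : 2 ≤ X)
    (hJ : c + q + 1 ≤ J) : Q * P ^ J * X ^ c < X ^ (2 * J) := by
  have h1 : P ^ J ≤ X ^ J := pow_le_pow_left₀ hP hX J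
  have hX0 : 0 < X := by linarith
  have h2 : (q : ℝ) < X ^ q := by
    have : (q : ℝ) < 2 ^ q := by exact_mod_cast Nat.lt_two_pow_self
    exact lt_of_lt_of_le this (pow_le_pow_left₀ (by norm_num) hX2 q)
  have h3 : Q < X ^ q := lt_of_le_of_lt hQ h2
  have h4 : X ^ q * X ^ c ≤ X ^ J := by
    rw [← pow_add]; exact pow_le_pow_right₀ (by linarith) (by omega)
  have h5 : Q * X ^ c < X ^ J := lt_of_lt_of_le (mul_lt_mul_of_pos_right h3 (by positivity)) h4
  by_cases hQ0 : Q ≤ 0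
  · have : Q * P ^ J * X ^ c ≤ 0 := by
      have : 0 ≤ P ^ J * X ^ c := by positivity
      nlinarith
    have : 0 < X ^ (2 * J) := by positivity
    linarith
  · push Not at hQ0
    calc Q * P ^ J * X ^ c ≤ Q * X ^ J * X ^ c := by gcongr
      _ = X ^ J * (Q * X ^ c) := by ring
      _ < X ^ J * X ^ J := by gcongr
      _ = _ := by rw [← pow_add]; congr 1; omega

lemma S_bound1 (S X x y : ℝ) (hX : 0 ≤ X) (hy : 0 ≤ y) (hxX : X ^ 2 = x) (e w : ℕ)
    (hS : S ^ 2 = (x * y) ^ e) (h : y ≤ x ^ w) : S ≤ X ^ (e + w * e) := by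
  have hx : 0 ≤ x := by rw [← hxX]; positivity
  refine abs_le_of_sq_le_sq' ?_ (by positivity) |>.2
  have h1 : y ^ e ≤ (x ^ w) ^ e := pow_le_pow_left₀ hy h e
  calc S ^ 2 = x ^ e * y ^ e := by rw [hS, mul_pow]
    _ ≤ x ^ e * (x ^ w) ^ e := by gcongr
    _ = (X ^ 2) ^ e * ((X ^ 2) ^ w) ^ e := by rw [hxX]
    _ = _ := by ring

lemma S_bound2 (S X x y : ℝ) (hX : 0 ≤ X) (hy : 0 ≤ y) (hxX : X ^ 2 = x) (e w : ℕ)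
    (hS : S ^ 2 = (x * y) ^ e) (h : x ^ w ≤ y) : S * X ^ (w * e) ≤ X ^ e * y ^ e := by
  have hx : 0 ≤ x := by rw [← hxX]; positivity
  refine abs_le_of_sq_le_sq' ?_ (by positivity) |>.2
  have h1 : (x ^ w) ^ e ≤ y ^ e := pow_le_pow_left₀ (by positivity) h e
  calc (S * X ^ (w * e)) ^ 2 = (x * y) ^ e * ((X ^ 2) ^ w) ^ e := by rw [mul_pow, hS]; ring
    _ = (x * y) ^ e * (x ^ w) ^ e := by rw [hxX]
    _ ≤ (x * y) ^ e * y ^ e := by gcongr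
    _ = (X ^ 2 * y) ^ e * y ^ e := by rw [hxX]
    _ = _ := by ring

lemma term_b (S X x y : ℝ) (hX : 1 ≤ X) (hS0 : 0 ≤ S) (hxX : X ^ 2 = x) (e b l J : ℕ) (he : 1 ≤ e)
    (hb : b < e) (hl : l ≤ J)
    (hS : S ^ 2 = (x * y) ^ e) (h1 : x ^ (16 * (8 * e + 1) * J) ≤ y) (h2 : y ≤ x ^ (16 * (8 * e + 1) * (J + 1))) :
    x ^ (4 * e ^ 2 * (16 * J) + l * (e + 1)) * S * (1 / y) ^ b * (1 / x) ^ (2 * e * (16 * J) * (4 * (e - b) + 1) - l)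
      ≤ X ^ (e + 16 * (8 * e + 1) * e) / X ^ (12 * J) := by
  have hx1 : 1 ≤ x := by rw [← hxX]; exact one_le_pow₀ hX
  have hy0 : 0 < y := lt_of_lt_of_le (by positivity) h1
  have s1 := S_bound1 S X x y (by linarith) hy0.le hxX e _ hS h2
  have s2 : (1 / y) ^ b ≤ 1 / x ^ (16 * (8 * e + 1) * J * b) := by
    rw [one_div_pow, pow_mul]
    apply one_div_le_one_div_of_le (by positivity)
    exact pow_le_pow_left₀ (by positivity) h1 b
  obtain ⟨t, rfl⟩ : ∃ t, e = b + t := ⟨e - b, by omega⟩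
  have hA : l + (J * (b + t) * (128 * t + 32) - J * (b+t)) ≤ 2 * (b + t) * (16 * J) * (4 * (b + t - b) + 1) := by
    rw [show b + t - b = t by omega]
    have : J ≤ J * (b + t) := by nlinarith
    have e1 : 2 * (b + t) * (16 * J) * (4 * t + 1) = J * (b + t) * (128 * t + 32) := by ring
    rw [e1]
    have : J * (b + t) ≤ J * (b + t) * (128 * t + 32) := by nlinarith [Nat.zero_le (J * (b+t) * t)]
    omega
  obtain ⟨r, hr⟩ : ∃ r, 2 * (b + t) * (16 * J) * (4 * (b + t - b) + 1) = l + r := ⟨_, (Nat.add_sub_of_le (by omega)).symm⟩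
  rw [hr, show l + r - l = r by omega]
  calc _ ≤ x ^ (4 * (b + t) ^ 2 * (16 * J) + l * ((b + t) + 1)) * X ^ ((b + t) + 16 * (8 * (b + t) + 1) * (J + 1) * (b + t)) *
          (1 / x ^ (16 * (8 * (b + t) + 1) * J * b)) * (1 / x) ^ r := by
        gcongr
    _ = X ^ (2 * (4 * (b + t) ^ 2 * (16 * J) + l * ((b + t) + 1)) + ((b + t) + 16 * (8 * (b + t) + 1) * (J + 1) * (b + t))) /
        X ^ (2 * (16 * (8 * (b + t) + 1) * J * b) + 2 * r) := by
      rw [← hxX, one_div_pow, pow_add X (2 * _), pow_add X (2 * (16 * _ * _ * _)), pow_mul X 2, pow_mul X 2, pow_mul X 2]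
      field_simp
    _ ≤ _ := by
      rw [div_le_div_iff₀ (by positivity) (by positivity), ← pow_add, ← pow_add]
      apply pow_le_pow_right₀ hX
      rw [show b + t - b = t by omega] at hr
      have hle : l * (b + t) ≤ J * (b + t) := Nat.mul_le_mul_right _ hl
      have hJe : J ≤ J * (b + t) := by nlinarith
      have hJb : 0 ≤ J * b := Nat.zero_le _
      nlinarith

lemma term_t (S X x y : ℝ) (hX : 1 ≤ X) (hS0 : 0 ≤ S) (hxX : X ^ 2 = x) (e l J : ℕ) (he : 1 ≤ e)
    (hl : l ≤ J)
    (hS : S ^ 2 = (x * y) ^ e) (h1 : x ^ (16 * (8 * e + 1) * J) ≤ y) :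
    x ^ (4 * e ^ 2 * (16 * J) + l * (e + 1)) * S * (1 / y) ^ e
      ≤ X ^ (e + 16 * (8 * e + 1) * e) / X ^ (12 * J) := by
  have hx1 : 1 ≤ x := by rw [← hxX]; exact one_le_pow₀ hX
  have hy0 : 0 < y := lt_of_lt_of_le (by positivity) h1
  have s1 := S_bound2 S X x y (by linarith) hy0.le hxX e _ hS h1
  have s2 : S * (1 / y) ^ e ≤ X ^ e / X ^ (16 * (8 * e + 1) * J * e) := by
    rw [one_div_pow, mul_one_div, div_le_div_iff₀ (by positivity) (by positivity)]
    exact s1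
  calc _ = x ^ (4 * e ^ 2 * (16 * J) + l * (e + 1)) * (S * (1 / y) ^ e) := by ring
    _ ≤ x ^ (4 * e ^ 2 * (16 * J) + l * (e + 1)) * (X ^ e / X ^ (16 * (8 * e + 1) * J * e)) := by gcongr
    _ = X ^ (2 * (4 * e ^ 2 * (16 * J) + l * (e + 1)) + e) / X ^ (16 * (8 * e + 1) * J * e) := by
      rw [← hxX, pow_add X (2 * _), pow_mul X 2]
      field_simp
    _ ≤ _ := by
      rw [div_le_div_iff₀ (by positivity) (by positivity), ← pow_add, ← pow_add]
      apply pow_le_pow_right₀ hX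
      have hle : l * e ≤ J * e := Nat.mul_le_mul_right _ hl
      have hJe : J ≤ J * e := by nlinarith
      nlinarith

end Pf

namespace Pf

lemma num_l (S X x y M Cc C2 : ℝ) (hX : 1 ≤ X) (hS0 : 0 ≤ S) (hxX : X ^ 2 = x) (hM : 1 ≤ M) (hC : 1 ≤ Cc) (hC2 : 1 ≤ C2)
    (e d l J N : ℕ) (hN : N = 4 * e ^ 2 * (16 * J)) (he : 1 ≤ e) (hl : l ≤ J)
    (hS : S ^ 2 = (x * y) ^ e) (h1 : x ^ (16 * (8 * e + 1) * J) ≤ y) (h2 : y ≤ x ^ (16 * (8 * e + 1) * (J + 1)))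
    (hbig : (d * 64 * e ^ 2 * (2 * e + 4) * Cc ^ e) * (Real.exp (128 * M * e ^ 2) * 2 * C2 ^ 16 * Cc ^ (160 * e ^ 2)) ^ J
      * X ^ (e + 16 * (8 * e + 1) * e) < X ^ (12 * J)) :
    2 ^ l * x ^ (N + l * (e + 1)) * (S *
        (d * ((M * N) ^ l * (N * C2 ^ (16 * J))) *
        (2 * ∑ b ∈ range e, (Cc * (1 / y)) ^ b * (Cc * (1 / x)) ^ (2 * e * (16 * J) * (4 * (e - b) + 1) - l)
          + 4 * (Cc * (1 / y)) ^ e))) < l.factorial := by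
  have hx1 : 1 ≤ x := by rw [← hxX]; exact one_le_pow₀ hX
  have hy0 : 0 < y := lt_of_lt_of_le (by positivity) h1
  set R : ℝ := X ^ (e + 16 * (8 * e + 1) * e) / X ^ (12 * J) with hR
  have hR0 : 0 ≤ R := by positivity
  have hfac : (0 : ℝ) < l.factorial := by exact_mod_cast Nat.factorial_pos l
  set W : ℝ := Cc ^ (e + 160 * e ^ 2 * J) with hW
  have hW0 : 0 ≤ W := by positivity
  have tb : ∀ b ∈ range e, x ^ (N + l * (e + 1)) * S * ((Cc * (1 / y)) ^ b * (Cc * (1 / x)) ^ (2 * e * (16 * J) * (4 * (e - b) + 1) - l)) ≤ W * R := by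
    intro b hb
    have hb := Finset.mem_range.mp hb
    have := term_b S X x y hX hS0 hxX e b l J he hb hl hS h1 h2
    rw [← hN] at this
    have hexp : b + (2 * e * (16 * J) * (4 * (e - b) + 1) - l) ≤ e + 160 * e ^ 2 * J := by
      have : 2 * e * (16 * J) * (4 * (e - b) + 1) ≤ 160 * e ^ 2 * J := by
        calc 2 * e * (16 * J) * (4 * (e - b) + 1) ≤ 2 * e * (16 * J) * (5 * e) := Nat.mul_le_mul_left _ (by omega)
          _ = _ := by ring
      omega
    calc _ = Cc ^ (b + (2 * e * (16 * J) * (4 * (e - b) + 1) - l)) *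
        (x ^ (N + l * (e + 1)) * S * (1 / y) ^ b * (1 / x) ^ (2 * e * (16 * J) * (4 * (e - b) + 1) - l)) := by
          rw [mul_pow, mul_pow, pow_add]; ring
      _ ≤ W * R := mul_le_mul (pow_le_pow_right₀ hC hexp) this (by positivity) hW0
  have tt : x ^ (N + l * (e + 1)) * S * (Cc * (1 / y)) ^ e ≤ W * R := by
    have := term_t S X x y hX hS0 hxX e l J he hl hS h1
    rw [← hN] at this
    calc _ = Cc ^ e * (x ^ (N + l * (e + 1)) * S * (1 / y) ^ e) := by rw [mul_pow]; ring
      _ ≤ W * R := mul_le_mul (pow_le_pow_right₀ hC (by omega)) this (by positivity) hW0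
  have ts : x ^ (N + l * (e + 1)) * S * (2 * ∑ b ∈ range e, (Cc * (1 / y)) ^ b * (Cc * (1 / x)) ^ (2 * e * (16 * J) * (4 * (e - b) + 1) - l)
          + 4 * (Cc * (1 / y)) ^ e) ≤ (2 * e + 4) * (W * R) := by
    have hs := Finset.sum_le_sum tb
    rw [← Finset.mul_sum] at hs
    simp only [sum_const, card_range, nsmul_eq_mul] at hs
    rw [mul_add]
    have e1 : ∀ a b : ℝ, a * (2 * b) = 2 * (a * b) := fun a b => by ring
    have e2 : ∀ a b : ℝ, a * (4 * b) = 4 * (a * b) := fun a b => by ring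
    rw [e1, e2]
    linarith
  have hexp : (2 * (M * N)) ^ l ≤ l.factorial * Real.exp (128 * M * e ^ 2) ^ J := by
    have := Real.pow_div_factorial_le_exp (2 * (M * N)) (by positivity) l
    rw [div_le_iff₀ hfac] at this
    refine this.trans (le_of_eq ?_)
    rw [← Real.exp_nat_mul, mul_comm, hN]
    congr 2
    push_cast; ring
  have hNJ : (N : ℝ) ≤ 64 * e ^ 2 * 2 ^ J := by
    have : (J : ℝ) ≤ 2 ^ J := by exact_mod_cast Nat.lt_two_pow_self.le
    rw [hN]; push_cast
    have h0 : (0 : ℝ) ≤ 64 * e ^ 2 := by positivity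
    nlinarith
  calc _ = (2 * (M * N)) ^ l * (d * N * C2 ^ (16 * J)) * (x ^ (N + l * (e + 1)) * S * (2 * ∑ b ∈ range e, (Cc * (1 / y)) ^ b * (Cc * (1 / x)) ^ (2 * e * (16 * J) * (4 * (e - b) + 1) - l)
          + 4 * (Cc * (1 / y)) ^ e)) := by rw [mul_pow]; ring
    _ ≤ (l.factorial * Real.exp (128 * M * e ^ 2) ^ J) * (d * (64 * e ^ 2 * 2 ^ J) * C2 ^ (16 * J)) * ((2 * e + 4) * (W * R)) := by
      gcongr
    _ = l.factorial * (((d * 64 * e ^ 2 * (2 * e + 4) * Cc ^ e) * (Real.exp (128 * M * e ^ 2) * 2 * C2 ^ 16 * Cc ^ (160 * e ^ 2)) ^ J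
      * X ^ (e + 16 * (8 * e + 1) * e)) / X ^ (12 * J)) := by
      rw [hW, hR]; simp only [mul_pow, pow_add, pow_mul]; ring
    _ < l.factorial * 1 := by
      gcongr
      rw [div_lt_one (by positivity)]
      exact hbig
    _ = _ := mul_one _

theorem core (m : ℕ) (E2 : ℤ[X]) (h2 : E2.coeff 0 = 1) (hdeg : E2.natDegree ≤ 2 * m + 1) (ns2 : NS E2)
    (ns12 : NS ((1 + X) * E2)) :
    ∃ X0 : ℕ, ∀ x1 ≥ X0, ∃ Y : ℕ, ∀ x2 ≥ Y, ∀ n0 n1 n2 : ℕ, n0 ^ 2 = x1 * x2 → n1 ^ 2 = (x1 + 1) * (x2 + 1) →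
      (n2 : ℚ) ^ 2 = ((x1 : ℚ) * x2) ^ (2 * m + 1) * (E2.aeval (1 / (x1 : ℚ)) * E2.aeval (1 / (x2 : ℚ))) → False := by
  obtain ⟨Cc, C2, M, hCc, hC2, hM, hin⟩ := inner m E2 h2 hdeg ns2 ns12
  obtain ⟨e, he⟩ : ∃ e, e = 2 * m + 1 := ⟨_, rfl⟩
  obtain ⟨d, hd⟩ : ∃ d, d = 2 * m + 3 := ⟨_, rfl⟩
  have hin := hin e d he hd
  have hCcR : (1 : ℝ) ≤ Cc := by exact_mod_cast hCc
  have hC2R : (1 : ℝ) ≤ C2 := by exact_mod_cast hC2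
  have he1 : 1 ≤ e := by omega
  set P1 : ℝ := Real.exp (128 * M * e ^ 2) * 2 * (C2 : ℝ) ^ 16 * (Cc : ℝ) ^ (160 * e ^ 2) with hP1
  set Q1 : ℝ := d * 64 * e ^ 2 * (2 * e + 4) * (Cc : ℝ) ^ e with hQ1
  set P2 : ℝ := 2 ^ (d * d + d) * (C2 : ℝ) ^ (16 * d) with hP2
  set Q2 : ℝ := d.factorial * (M * (64 * e ^ 2)) ^ (d * d) * (64 * e ^ 2) ^ d with hQ2
  obtain ⟨q1, hq1⟩ := exists_nat_ge Q1
  obtain ⟨q2, hq2⟩ := exists_nat_ge Q2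
  obtain ⟨Z, hZ⟩ := exists_nat_ge (P1 + P2 + 2)
  have hP10 : 0 ≤ P1 := by positivity
  have hP20 : 0 ≤ P2 := by positivity
  have hZ2 : 2 ≤ Z := by
    have : (2 : ℝ) ≤ Z := by linarith
    exact_mod_cast this
  clear_value P1 Q1 P2 Q2
  set c1 := e + 16 * (8 * e + 1) * e with hc1
  obtain ⟨J0, hJ0⟩ : ∃ J0, J0 = c1 + q1 + 1 + (2 * d + q2 + 1) + d := ⟨_, rfl⟩
  refine ⟨Z ^ 2 + 4 * Cc + C2 + 1, fun x1 hx1 => ⟨x1 ^ (16 * (8 * e + 1) * J0), fun x2 hx2 n0 n1 n2 q0 q1' q2' => ?_⟩⟩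
  have hx1Z : Z ^ 2 ≤ x1 := by omega
  have hZs : 2 ^ 2 ≤ Z ^ 2 := Nat.pow_le_pow_left hZ2 2
  have hx1' : 1 < x1 := by omega
  have hs : 0 < 16 * (8 * e + 1) := by omega
  set J := Nat.log x1 x2 / (16 * (8 * e + 1)) with hJ
  have hx2pos : 0 < x2 := lt_of_lt_of_le (by positivity) hx2
  have hJge : J0 ≤ J := by
    rw [hJ, Nat.le_div_iff_mul_le hs]
    apply Nat.le_log_of_pow_le hx1'
    rw [mul_comm]; exact hx2
  have hlow : x1 ^ (16 * (8 * e + 1) * J) ≤ x2 := by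
    refine (Nat.pow_le_pow_right (by omega) ?_).trans (Nat.pow_log_le_self x1 hx2pos.ne')
    rw [hJ]; exact Nat.mul_div_le _ _
  have hup : x2 ≤ x1 ^ (16 * (8 * e + 1) * (J + 1)) := by
    refine (Nat.lt_pow_succ_log_self hx1' x2).le.trans (Nat.pow_le_pow_right (by omega) ?_)
    rw [hJ]
    exact Nat.lt_mul_div_succ _ hs
  have hlowR : (x1 : ℝ) ^ (16 * (8 * e + 1) * J) ≤ x2 := by exact_mod_cast hlow
  have hupR : (x2 : ℝ) ≤ (x1 : ℝ) ^ (16 * (8 * e + 1) * (J + 1)) := by exact_mod_cast hup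
  clear_value J
  set X : ℝ := Real.sqrt x1 with hX
  have hXsq : X ^ 2 = x1 := Real.sq_sqrt (by positivity)
  have hXZ : (Z : ℝ) ≤ X := by
    apply Real.le_sqrt_of_sq_le
    exact_mod_cast hx1Z
  have hZR : (2 : ℝ) ≤ Z := by exact_mod_cast hZ2
  have hX2 : 2 ≤ X := by linarith
  have b1 := big Q1 P1 X c1 J q1 hq1 hP10 (by linarith) hX2 (by omega)
  have b2 := big Q2 P2 X (2 * d) J q2 hq2 hP20 (by linarith) hX2 (by omega)
  have hJ1 : 1 ≤ J := by omega
  obtain ⟨N, hN⟩ : ∃ N, N = 4 * e ^ 2 * (16 * J) := ⟨_, rfl⟩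
  have he2 : 1 ≤ e ^ 2 := Nat.one_le_pow _ _ he1
  have hNJ : J ≤ e ^ 2 * J := Nat.le_mul_of_pos_left _ he2
  have hN' : N = 64 * (e ^ 2 * J) := by rw [hN]; ring
  have concl := hin x1 x2 n0 n1 n2 (16 * J) (J + 1) N hN (by omega) (by
      have : x1 ^ 1 ≤ x1 ^ (16 * (8 * e + 1) * J) := Nat.pow_le_pow_right (by omega) (Nat.mul_pos hs hJ1)
      rw [pow_one] at this
      omega) q0 q1' q2' (by
      refine lt_of_lt_of_le ?_ hlow
      calc C2 ^ (16 * J) < x1 ^ (16 * J) := Nat.pow_lt_pow_left (by omega) (by omega)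
        _ ≤ _ := Nat.pow_le_pow_right (by omega) (Nat.mul_le_mul_right _ (by omega))) (by omega) (by omega) (by omega) (by
      intro l hl
      refine num_l _ X x1 x2 M Cc C2 (by linarith) (by positivity) hXsq hM hCcR hC2R e d l J N hN he1 (by omega) ?_ hlowR hupR ?_
      · have : (n0 : ℝ) ^ 2 = x1 * x2 := by exact_mod_cast q0
        rw [mul_pow, mul_pow, this, he]; ring
      · rw [← hP1, ← hQ1, ← hc1]
        exact lt_of_lt_of_le b1 (pow_le_pow_right₀ (by linarith) (by omega)))
  have hNR : (N : ℝ) ≤ 64 * e ^ 2 * 2 ^ J := by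
    have : (J : ℝ) ≤ 2 ^ J := by exact_mod_cast Nat.lt_two_pow_self.le
    rw [hN]; push_cast
    have h0 : (0 : ℝ) ≤ 64 * e ^ 2 := by positivity
    nlinarith
  have c2 : (d.factorial : ℝ) * ((M * N) ^ d * (N * (C2 : ℝ) ^ (16 * J))) ^ d ≤ Q2 * P2 ^ J := by
    calc _ ≤ (d.factorial : ℝ) * ((M * (64 * e ^ 2 * 2 ^ J)) ^ d * ((64 * e ^ 2 * 2 ^ J) * (C2 : ℝ) ^ (16 * J))) ^ d := by gcongr
      _ = Q2 * P2 ^ J := by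
        rw [hQ2, hP2]
        simp only [mul_pow, ← pow_mul, pow_add]
        ring
  have c3 : (x1 : ℝ) ^ (J + 1 - d) * X ^ (2 * d) = X ^ (2 * J + 2) := by
    rw [← hXsq, ← pow_mul, ← pow_add]; congr 1; omega
  have c4 : (x1 : ℝ) ^ (J + 1 - d) * X ^ (2 * d) ≤ Q2 * P2 ^ J * X ^ (2 * d) := by
    have := concl.trans c2
    gcongr
  have c5 : X ^ (2 * J) ≤ X ^ (2 * J + 2) := pow_le_pow_right₀ (by linarith) (by omega)
  linarith

end Pf

namespace Pf

lemma sqf (x : ℕ) (hx : 0 < x) (W y : ℤ) (h : (x : ℤ) * W = y ^ 2) :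
    ∃ a u : ℕ, x = u ^ 2 * a ∧ (a : ℤ) ∣ W := by
  obtain ⟨a, u, hau, hsq⟩ := Nat.sq_mul_squarefree x
  have hu : 0 < u := by
    rcases Nat.eq_zero_or_pos u with h | h
    · rw [h] at hau; simp at hau; omega
    · exact h
  have ha : 0 < a := Nat.pos_of_ne_zero hsq.ne_zero
  refine ⟨a, u, hau.symm, ?_⟩
  have h1 : (u : ℤ) ^ 2 ∣ y ^ 2 := ⟨a * W, by rw [← h, ← hau]; push_cast; ring⟩
  rw [Int.pow_dvd_pow_iff two_ne_zero] at h1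
  obtain ⟨y1, rfl⟩ := h1
  have hu' : (u : ℤ) ^ 2 ≠ 0 := by positivity
  have h2 : (a : ℤ) * W = y1 ^ 2 := by
    apply mul_left_cancel₀ hu'
    rw [← mul_pow, ← h, ← hau]; push_cast; ring
  have hsq' : Squarefree (a : ℤ) := Int.squarefree_natCast.mpr hsq
  have h3 : (a : ℤ) ∣ y1 := (hsq'.dvd_pow_iff_dvd two_ne_zero).mp ⟨W, h2.symm⟩
  obtain ⟨y2, rfl⟩ := h3
  refine ⟨y2 ^ 2, ?_⟩
  have ha' : (a : ℤ) ≠ 0 := by exact_mod_cast ha.ne'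
  apply mul_left_cancel₀ ha'
  rw [h2]; ring

lemma rev_eval (h : ℤ[X]) (q : ℚ) (hq : q ≠ 0) :
    h.reverse.aeval (1 / q) * q ^ h.natDegree = h.aeval q := by
  letI : Invertible q := invertibleOfNonzero hq
  have := eval₂_reverse_mul_pow (Int.castRingHom ℚ) q h
  rw [invOf_eq_inv] at this
  rw [one_div]
  exact this

theorem fin_fiber (h : ℤ[X]) (hm : h.Monic) (ns2 : NS h.reverse) (ns12 : NS ((1 + X) * h.reverse)) (a b : ℕ) :
    Set.Finite {x : ℕ | 0 < x ∧ (∃ y : ℤ, y ^ 2 = x * (x + 1) * h.eval (x : ℤ)) ∧ (∃ u, x = u ^ 2 * a) ∧ ∃ v, x + 1 = v ^ 2 * b} := by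
  by_contra hinf
  obtain ⟨m, hm2⟩ : ∃ m, h.natDegree = 2 * m + 1 ∨ h.natDegree = 2 * m := by
    rcases Nat.even_or_odd' h.natDegree with ⟨m, h1 | h1⟩
    · exact ⟨m, Or.inr h1⟩
    · exact ⟨m, Or.inl h1⟩
  obtain ⟨X0, hX0⟩ := core m h.reverse (by rw [coeff_zero_reverse]; exact hm)
    (by have := reverse_natDegree_le h; omega) ns2 ns12
  obtain ⟨x1, hx1, hx1X⟩ := Set.Infinite.exists_gt hinf X0
  obtain ⟨Y, hY⟩ := hX0 x1 hx1X.le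
  obtain ⟨x2, hx2, hx2Y⟩ := Set.Infinite.exists_gt hinf Y
  have hY := hY x2 hx2Y.le
  obtain ⟨p1, ⟨y1, hy1⟩, ⟨u1, hu1⟩, ⟨v1, hv1⟩⟩ := hx1
  obtain ⟨p2, ⟨y2, hy2⟩, ⟨u2, hu2⟩, ⟨v2, hv2⟩⟩ := hx2
  have q0 : (u1 * u2 * a) ^ 2 = x1 * x2 := by rw [hu1, hu2]; ring
  have q1 : (v1 * v2 * b) ^ 2 = (x1 + 1) * (x2 + 1) := by rw [hv1, hv2]; ring
  obtain ⟨n0, hn0⟩ : ∃ n0, n0 = u1 * u2 * a := ⟨_, rfl⟩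
  obtain ⟨n1, hn1⟩ : ∃ n1, n1 = v1 * v2 * b := ⟨_, rfl⟩
  rw [← hn0] at q0
  rw [← hn1] at q1
  have q0Z : (n0 : ℤ) ^ 2 = x1 * x2 := by exact_mod_cast q0
  have q1Z : (n1 : ℤ) ^ 2 = (x1 + 1) * (x2 + 1) := by exact_mod_cast q1
  have hprod : ((n0 : ℤ) * n1) ^ 2 * (h.eval (x1 : ℤ) * h.eval (x2 : ℤ)) = (y1 * y2) ^ 2 := by
    rw [mul_pow y1, hy1, hy2, mul_pow, q0Z, q1Z]; ring
  have hne : ((n0 : ℤ) * n1) ^ 2 ≠ 0 := by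
    rw [mul_pow, q0Z, q1Z]; positivity
  obtain ⟨w, hw⟩ : ((n0 : ℤ) * n1) ∣ y1 * y2 := by
    rw [← Int.pow_dvd_pow_iff two_ne_zero]
    exact ⟨_, hprod.symm⟩
  have hw2 : h.eval (x1 : ℤ) * h.eval (x2 : ℤ) = w ^ 2 := by
    apply mul_left_cancel₀ hne
    rw [hprod, hw]; ring
  have ev : ∀ x : ℕ, h.aeval (x : ℚ) = ((h.eval (x : ℤ) : ℤ) : ℚ) := by
    intro x
    have := Polynomial.aeval_algebraMap_apply ℚ (x : ℤ) h
    simpa using this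
  have r1 := rev_eval h (x1 : ℚ) (by exact_mod_cast p1.ne')
  have r2 := rev_eval h (x2 : ℚ) (by exact_mod_cast p2.ne')
  rw [ev] at r1 r2
  have hw2Q : ((h.eval (x1 : ℤ) : ℤ) : ℚ) * ((h.eval (x2 : ℤ) : ℤ) : ℚ) = (w : ℚ) ^ 2 := by exact_mod_cast hw2
  have q0Q : (n0 : ℚ) ^ 2 = x1 * x2 := by exact_mod_cast q0
  have wabs : ((w.natAbs : ℕ) : ℚ) ^ 2 = (w : ℚ) ^ 2 := by
    rw [Nat.cast_natAbs]; push_cast; rw [sq_abs]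
  rcases hm2 with hm2 | hm2
  · refine hY n0 n1 w.natAbs q0 q1 ?_
    rw [wabs, ← hw2Q, ← r1, ← r2, hm2]; ring
  · refine hY n0 n1 (n0 * w.natAbs) q0 q1 ?_
    push_cast
    rw [mul_pow, wabs, ← hw2Q, q0Q, ← r1, ← r2, hm2]; ring

theorem finG (h : ℤ[X]) (hm : h.Monic) (h0 : h.eval 0 ≠ 0) (h1 : h.eval (-1) ≠ 0) (ns2 : NS h.reverse) :
    Set.Finite {x : ℕ | ∃ y : ℤ, y ^ 2 = x * (x + 1) * h.eval (x : ℤ)} := by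
  have ns12 : NS ((1 + X) * h.reverse) := by
    refine ns_simple _ (-1) (h.reverse.map (Int.castRingHom ℚ)) (by rw [Polynomial.map_mul]; congr 1; simp [add_comm]) ?_
    have := rev_eval h (-1) (by norm_num)
    intro h3
    have h4 : h.reverse.aeval (1 / (-1 : ℚ)) = 0 := by
      rw [aeval_def, ← eval_map]
      rw [show (1 / (-1 : ℚ)) = -1 by norm_num]
      exact h3
    rw [h4, zero_mul] at this
    have h5 := Polynomial.aeval_algebraMap_apply ℚ (-1 : ℤ) h
    simp at h5
    rw [h5] at this
    exact h1 (by exact_mod_cast this.symm)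
  have hfin : Set.Finite (⋃ a ∈ Finset.range ((h.eval 0).natAbs + 1), ⋃ b ∈ Finset.range ((h.eval (-1)).natAbs + 1),
     {x : ℕ | 0 < x ∧ (∃ y : ℤ, y ^ 2 = x * (x + 1) * h.eval (x : ℤ)) ∧ (∃ u, x = u ^ 2 * a) ∧ ∃ v, x + 1 = v ^ 2 * b}) := by
    apply Set.Finite.biUnion (Finset.finite_toSet _)
    intro a _
    apply Set.Finite.biUnion (Finset.finite_toSet _)
    intro b _
    exact fin_fiber h hm ns2 ns12 a b
  refine (hfin.union (Set.finite_singleton 0)).subset ?_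
  rintro x ⟨y, hy⟩
  rcases Nat.eq_zero_or_pos x with hx | hx
  · right; exact hx
  left
  obtain ⟨a, u, hau, ha⟩ := sqf x hx ((x + 1) * h.eval (x : ℤ)) y (by rw [hy]; ring)
  obtain ⟨b, v, hbv, hb⟩ := sqf (x + 1) (by omega) (x * h.eval (x : ℤ)) y (by rw [hy]; push_cast; ring)
  have ha2 : (a : ℤ) ∣ h.eval 0 := by
    have e1 := sub_dvd_eval_sub (x : ℤ) 0 h
    rw [sub_zero] at e1
    have hax : (a : ℤ) ∣ x := ⟨u ^ 2, by rw [hau]; push_cast; ring⟩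
    have e2 := hax.trans e1
    have e3 : h.eval 0 = (x + 1) * h.eval (x : ℤ) - x * h.eval (x : ℤ) - (h.eval (x : ℤ) - h.eval 0) := by ring
    rw [e3]
    exact dvd_sub (dvd_sub ha (hax.mul_right _)) e2
  have hb2 : (b : ℤ) ∣ h.eval (-1) := by
    have e1 := sub_dvd_eval_sub (x : ℤ) (-1) h
    rw [sub_neg_eq_add] at e1
    have hbx : (b : ℤ) ∣ (x : ℤ) + 1 := ⟨v ^ 2, by
      have : (x : ℤ) + 1 = ((x + 1 : ℕ) : ℤ) := by push_cast; ring
      rw [this, hbv]; push_cast; ring⟩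
    have e2 := hbx.trans e1
    have e3 : h.eval (-1) = (x + 1) * h.eval (x : ℤ) - x * h.eval (x : ℤ) - (h.eval (x : ℤ) - h.eval (-1)) := by ring
    rw [e3]
    exact dvd_sub (dvd_sub (hbx.mul_right _) hb) e2
  have ha3 : a ≤ (h.eval 0).natAbs := Nat.le_of_dvd (Int.natAbs_pos.mpr h0) (Int.natCast_dvd.mp ha2)
  have hb3 : b ≤ (h.eval (-1)).natAbs := Nat.le_of_dvd (Int.natAbs_pos.mpr h1) (Int.natCast_dvd.mp hb2)
  simp only [Set.mem_iUnion]
  exact ⟨a, Finset.mem_range.mpr (by omega), b, Finset.mem_range.mpr (by omega), hx, ⟨y, hy⟩, ⟨u, hau⟩, ⟨v, hbv⟩⟩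

end Pf

namespace Pf

lemma int_aeval (h : ℤ[X]) (q : ℤ) : h.aeval (q : ℚ) = ((h.eval q : ℤ) : ℚ) := by
  have := Polynomial.aeval_algebraMap_apply ℚ q h
  simpa using this

lemma ns_root (F : ℤ[X]) (q : ℤ) (hq : q ≠ 0) (hF : F.eval q ≠ 0) : NS ((X - C q) * F).reverse := by
  have hqQ : (q : ℚ) ≠ 0 := by exact_mod_cast hq
  refine ns_simple _ (1 / (q : ℚ)) (C (-(q : ℚ)) * F.reverse.map (Int.castRingHom ℚ)) ?_ ?_
  · rw [reverse_mul_of_domain, Polynomial.map_mul, ← mul_assoc]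
    congr 1
    have e : (X - C q : ℤ[X]).reverse = 1 - C q * X := by
      ext i
      rw [coeff_reverse, natDegree_X_sub_C]
      rcases i with _ | _ | i
      · rw [revAt_le (by omega)]
        simp only [coeff_sub, coeff_one, coeff_X, coeff_C, coeff_C_mul]; norm_num
      · rw [revAt_le (by omega)]
        simp only [coeff_sub, coeff_one, coeff_X, coeff_C, coeff_C_mul]; norm_num
      · rw [revAt_eq_self_of_lt (by omega)]
        simp only [coeff_sub, coeff_one, coeff_X, coeff_C, coeff_C_mul]; norm_num
    rw [e]
    simp only [Polynomial.map_sub, Polynomial.map_one, Polynomial.map_mul, map_X, Polynomial.map_C]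
    change (1 - C (q : ℚ) * X : ℚ[X]) = _
    have : (1 : ℚ[X]) = C (q : ℚ) * C (1 / (q : ℚ)) := by
      rw [← C_mul, mul_one_div_cancel hqQ, C_1]
    rw [map_neg]
    linear_combination this
  · have := rev_eval F q hqQ
    rw [int_aeval] at this
    rw [eval_mul, eval_C, eval_map]
    intro h3
    have h4 := (mul_eq_zero.mp h3).resolve_left (neg_ne_zero.mpr hqQ)
    rw [aeval_def] at this
    change eval₂ (algebraMap ℤ ℚ) (1 / (q : ℚ)) F.reverse = 0 at h4
    rw [h4, zero_mul] at this
    exact hF (by exact_mod_cast this.symm)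

lemma no_sqrt_three (t : ℚ) : t ^ 2 ≠ 3 := by
  intro h
  have h1 : IsSquare (3 : ℚ) := ⟨t, by rw [← h]; ring⟩
  have h2 : IsSquare ((3 : ℕ) : ℚ) := by exact_mod_cast h1
  rw [Rat.isSquare_natCast_iff] at h2
  obtain ⟨r, hr⟩ := h2
  have : r < 2 := by nlinarith
  interval_cases r <;> omega

lemma ns_three (h : ℤ[X]) (q : ℤ) (hq : q ≠ 0) (h3 : h.eval q = 3) (hc : q < 0 ∨ Even h.natDegree) : NS h.reverse := by
  have hqQ : (q : ℚ) ≠ 0 := by exact_mod_cast hq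
  refine ns_value _ (1 / (q : ℚ)) ?_
  rintro ⟨t, ht⟩
  have := rev_eval h q hqQ
  rw [int_aeval, h3, ht] at this
  rcases Nat.even_or_odd h.natDegree with hev | hodd
  · obtain ⟨j, hj⟩ := hev
    rw [hj] at this
    apply no_sqrt_three (t * (q : ℚ) ^ j)
    have e : ((3 : ℤ) : ℚ) = 3 := by norm_num
    rw [← e, ← this]; ring
  · have hq0 : q < 0 := by
      rcases hc with h | h
      · exact h
      · exact absurd hodd (Nat.not_odd_iff_even.mpr h)
    have h5 : (q : ℚ) ^ h.natDegree < 0 := hodd.pow_neg (by exact_mod_cast hq0)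
    have h6 : t ^ 2 * (q : ℚ) ^ h.natDegree ≤ 0 := mul_nonpos_of_nonneg_of_nonpos (sq_nonneg t) h5.le
    rw [this] at h6
    norm_num at h6

lemma fin_neg (p : ℤ[X]) (hp : p.Monic) (hd : 0 < p.natDegree) :
    Set.Finite {x : ℕ | ∃ y : ℤ, y ^ 2 = x * (x + 1) * (-(p.eval (x : ℤ)))} := by
  have ht := (p.map (Int.castRingHom ℝ)).tendsto_atTop_of_leadingCoeff_nonneg
    (by
      rw [degree_map_eq_of_injective (RingHom.injective_int _)]
      exact natDegree_pos_iff_degree_pos.mp hd) (by rw [(hp.map _).leadingCoeff]; norm_num)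
  have ht2 := ht.comp tendsto_natCast_atTop_atTop
  have ht3 := (ht2.eventually_gt_atTop 0)
  rw [Filter.eventually_atTop] at ht3
  obtain ⟨A, hA⟩ := ht3
  refine (Set.finite_lt_nat (A + 1)).subset ?_
  rintro x ⟨y, hy⟩
  by_contra hx
  simp only [Set.mem_setOf_eq, not_lt] at hx
  have h1 := hA x (by omega)
  simp only [Function.comp] at h1
  have h2 : (p.map (Int.castRingHom ℝ)).eval (x : ℝ) = ((p.eval (x : ℤ) : ℤ) : ℝ) := by
    have := Polynomial.eval_intCast_map (Int.castRingHom ℝ) p (x : ℤ)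
    simpa using this
  rw [h2] at h1
  have h3 : 0 < p.eval (x : ℤ) := by exact_mod_cast h1
  have hx0 : (0 : ℤ) < x := by
    have : 0 < x := by omega
    exact_mod_cast this
  have : 0 < (x : ℤ) * (x + 1) * p.eval (x : ℤ) := by positivity
  nlinarith [sq_nonneg y]

/-- the final reduction, for a polynomial of the form X(X+1)h -/
theorem fin_pairs (h : ℤ[X]) (hm : h.Monic) (hd : 0 < h.natDegree) (h0 : h.eval 0 ≠ 0) (h1 : h.eval (-1) ≠ 0)
    (hc : (∃ F : ℤ[X], h = (X - C (-2)) * F ∧ F.eval (-2) ≠ 0) ∨ h.eval (-4) = 3) :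
    Set.Finite {p : ℤ × ℤ | p.2 ^ 2 = (X * (X + 1) * h).eval p.1} := by
  have hsx : Set.Finite {x : ℤ | ∃ y : ℤ, y ^ 2 = (X * (X + 1) * h).eval x} := by
    have ns2 : NS h.reverse := by
      rcases hc with ⟨F, rfl, hF⟩ | h3
      · exact ns_root F (-2) (by norm_num) hF
      · exact ns_three h (-4) (by norm_num) h3 (Or.inl (by norm_num))
    have f1 := finG h hm h0 h1 ns2
    set h' : ℤ[X] := h.comp (-1 - X) with hh'
    have evh : ∀ x : ℤ, h'.eval x = h.eval (-1 - x) := fun x => by simp [hh']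
    have dlin : (-1 - X : ℤ[X]).natDegree = 1 := by
      rw [show (-1 - X : ℤ[X]) = -(X + C 1) by simp; ring, natDegree_neg, natDegree_X_add_C]
    have llin : (-1 - X : ℤ[X]).leadingCoeff = -1 := by
      rw [show (-1 - X : ℤ[X]) = -(X + C 1) by simp; ring, leadingCoeff_neg, leadingCoeff_X_add_C]
    have dh' : h'.natDegree = h.natDegree := by rw [hh', natDegree_comp, dlin, mul_one]
    have lh' : h'.leadingCoeff = (-1) ^ h.natDegree := by
      rw [hh', leadingCoeff_comp (by rw [dlin]; norm_num), hm.leadingCoeff, llin, one_mul]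
    have f2 : Set.Finite {x : ℕ | ∃ y : ℤ, y ^ 2 = x * (x + 1) * h'.eval (x : ℤ)} := by
      rcases Nat.even_or_odd h.natDegree with hev | hodd
      · have hm' : h'.Monic := by rw [Monic, lh', hev.neg_one_pow]
        refine finG h' hm' (by rw [evh]; simpa using h1) (by rw [evh]; simpa using h0) ?_
        rcases hc with ⟨F, hF, hF2⟩ | h3
        · have e : h' = (X - C 1) * (-(F.comp (-1 - X))) := by
            rw [hh', hF]; simp; ring
          rw [e]
          refine ns_root _ 1 (by norm_num) ?_
          simpa using hF2
        · exact ns_three h' 3 (by norm_num) (by rw [evh]; simpa using h3) (Or.inr (by rw [dh']; exact hev))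
      · have hm' : (-h').Monic := by rw [Monic, leadingCoeff_neg, lh', hodd.neg_one_pow, neg_neg]
        have := fin_neg (-h') hm' (by rw [natDegree_neg, dh']; exact hd)
        simpa using this
    refine ((f1.image (fun n : ℕ => (n : ℤ))).union (f2.image (fun n : ℕ => -1 - (n : ℤ)))).subset ?_
    rintro x ⟨y, hy⟩
    simp only [eval_mul, eval_add, eval_X, eval_one] at hy
    rcases le_or_gt 0 x with hx | hx
    · left
      lift x to ℕ using hx
      exact ⟨x, ⟨y, hy⟩, rfl⟩
    · right
      obtain ⟨n, hn⟩ : ∃ n : ℕ, x = -1 - (n : ℤ) := ⟨(-1 - x).toNat, by omega⟩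
      refine ⟨n, ⟨y, ?_⟩, hn.symm⟩
      rw [evh, ← hn, hy, hn]; ring
  have : {p : ℤ × ℤ | p.2 ^ 2 = (X * (X + 1) * h).eval p.1} ⊆
      ⋃ x ∈ {x : ℤ | ∃ y : ℤ, y ^ 2 = (X * (X + 1) * h).eval x},
        (fun y => (x, y)) '' (Set.Icc (-|(X * (X + 1) * h).eval x|) |(X * (X + 1) * h).eval x|) := by
    rintro ⟨x, y⟩ hxy
    simp only [Set.mem_setOf_eq] at hxy
    simp only [Set.mem_iUnion]
    refine ⟨x, ⟨y, hxy⟩, y, ?_, rfl⟩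
    rw [← hxy, abs_of_nonneg (sq_nonneg y)]
    exact ⟨by nlinarith [Int.le_self_sq (-y)], Int.le_self_sq y⟩
  exact (Set.Finite.biUnion hsx (fun x _ => (Set.finite_Icc _ _).image _)).subset this

end Pf

namespace Pf

/-- product of X + s + i for i below k -/
noncomputable def RR (s : ℤ) (k : ℕ) : ℤ[X] := ∏ i ∈ Finset.range k, (X + C (s + (i : ℤ)))

lemma RR_succ (s : ℤ) (k : ℕ) : RR s (k + 1) = (X + C s) * RR (s + 1) k := by
  rw [RR, Finset.prod_range_succ', mul_comm, RR]
  congr 1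
  · simp
  · refine Finset.prod_congr rfl fun i _ => ?_
    congr 2; push_cast; ring

lemma pP_eq (a : ℕ) (ha : 1 ≤ a) : pP a = X * (X + 1) * RR 2 (a - 1) := by
  obtain ⟨b, rfl⟩ : ∃ b, a = b + 1 := ⟨a - 1, by omega⟩
  have : pP (b + 1) = RR 0 (b + 1 + 1) := by simp [pP, RR]
  rw [this, RR_succ, RR_succ]
  simp only [Nat.add_sub_cancel]
  norm_num
  ring

lemma RR_monic (s : ℤ) (k : ℕ) : (RR s k).Monic := monic_prod_of_monic _ _ fun i _ => monic_X_add_C _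

lemma RR_deg (s : ℤ) (k : ℕ) : (RR s k).natDegree = k := by
  rw [RR, natDegree_prod_of_monic _ _ (fun i _ => monic_X_add_C _)]
  simp only [natDegree_X_add_C]; simp

lemma RR_pos (s : ℤ) (k : ℕ) (x : ℤ) (h : 0 < x + s) : 0 < (RR s k).eval x := by
  rw [RR, eval_prod]
  refine Finset.prod_pos fun i _ => ?_
  simp only [eval_add, eval_X, eval_C]; omega

theorem final (n k : ℕ) (a : ℕ → ℕ) (hn : 2 ≤ n) (hk : 1 ≤ k)
    (hmono : ∀ i j, i < j → j < k → a i < a j) (hlt : ∀ i, i < k → a i < n)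
    (hcase : 2 ≤ a 0 ∨ (3 ≤ k ∧ a 0 = 1 ∧ a 1 = 3 ∧ 5 ≤ a 2))
    (g : Polynomial ℤ) (hg : g = pP n + ∑ i ∈ Finset.range k, pP (a i)) :
    Set.Finite {p : ℤ × ℤ | p.2 ^ 2 = g.eval p.1} := by
  have hge : ∀ i < k, a 0 ≤ a i := by
    intro i hi
    rcases Nat.eq_zero_or_pos i with h | h
    · rw [h]
    · exact (hmono 0 i h hi).le
  have ha0 : 1 ≤ a 0 := by omega
  obtain ⟨h, hh⟩ : ∃ h : ℤ[X], h = RR 2 (n - 1) + ∑ i ∈ Finset.range k, RR 2 (a i - 1) := ⟨_, rfl⟩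
  have hgh : g = X * (X + 1) * h := by
    rw [hg, hh, mul_add, Finset.mul_sum, pP_eq n (by omega)]
    congr 1
    refine Finset.sum_congr rfl fun i hi => ?_
    exact pP_eq _ (ha0.trans (hge i (Finset.mem_range.mp hi)))
  have hdl : (∑ i ∈ Finset.range k, RR 2 (a i - 1)).degree < (RR 2 (n - 1)).degree := by
    rw [degree_eq_natDegree (RR_monic 2 (n - 1)).ne_zero, RR_deg]
    refine lt_of_le_of_lt (degree_sum_le _ _) ?_
    rw [Finset.sup_lt_iff (WithBot.bot_lt_coe _)]
    intro i hi
    rw [degree_eq_natDegree (RR_monic 2 _).ne_zero, RR_deg]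
    have h1 := hlt i (Finset.mem_range.mp hi)
    have h2 := hge i (Finset.mem_range.mp hi)
    exact_mod_cast (by omega : a i - 1 < n - 1)
  have hm : h.Monic := by rw [hh]; exact (RR_monic 2 (n - 1)).add_of_left hdl
  have hd : h.natDegree = n - 1 := by
    rw [hh, natDegree_add_eq_left_of_degree_lt hdl, RR_deg]
  have hpos : ∀ x : ℤ, 0 < x + 2 → 0 < h.eval x := by
    intro x hx
    rw [hh, eval_add, eval_finset_sum]
    exact add_pos_of_pos_of_nonneg (RR_pos _ _ _ hx) (Finset.sum_nonneg fun i _ => (RR_pos _ _ _ hx).le)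
  rw [hgh]
  refine fin_pairs h hm (by omega) (hpos 0 (by norm_num)).ne' (hpos (-1) (by norm_num)).ne' ?_
  rcases hcase with h2 | ⟨hk3, e0, e1, e2⟩
  · left
    refine ⟨RR 3 (n - 2) + ∑ i ∈ Finset.range k, RR 3 (a i - 2), ?_, ?_⟩
    · have es : ∀ b, 2 ≤ b → RR 2 (b - 1) = (X - C (-2)) * RR 3 (b - 2) := by
        intro b hb
        obtain ⟨c, rfl⟩ : ∃ c, b = c + 2 := ⟨b - 2, by omega⟩
        rw [show c + 2 - 1 = c + 1 by omega, RR_succ, show c + 2 - 2 = c by omega]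
        norm_num
      rw [hh, mul_add, Finset.mul_sum, es n hn]
      congr 1
      exact Finset.sum_congr rfl fun i hi => es _ (h2.trans (hge i (Finset.mem_range.mp hi)))
    · rw [eval_add, eval_finset_sum]
      exact (add_pos_of_pos_of_nonneg (RR_pos _ _ _ (by norm_num)) (Finset.sum_nonneg fun i _ => (RR_pos _ _ _ (by norm_num)).le)).ne'
  · right
    have van : ∀ b, 4 ≤ b → (RR 2 (b - 1)).eval (-4) = 0 := by
      intro b hb
      obtain ⟨c, rfl⟩ : ∃ c, b = c + 4 := ⟨b - 4, by omega⟩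
      rw [show c + 4 - 1 = c + 1 + 1 + 1 by omega, RR_succ, RR_succ, RR_succ]
      simp only [eval_mul, eval_add, eval_X, eval_C]
      norm_num
    obtain ⟨k', rfl⟩ : ∃ k', k = k' + 2 := ⟨k - 2, by omega⟩
    have hn4 : 4 ≤ n := by have := hlt 2 (by omega); omega
    rw [hh, eval_add, eval_finset_sum, van n hn4, Finset.sum_range_succ', Finset.sum_range_succ']
    have z : ∑ i ∈ Finset.range k', eval (-4) (RR 2 (a (i + 1 + 1) - 1)) = 0 := by
      refine Finset.sum_eq_zero fun i hi => van _ ?_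
      have hi := Finset.mem_range.mp hi
      rcases Nat.eq_zero_or_pos i with h | h
      · rw [h]; simpa using (by omega : 4 ≤ a 2)
      · have := hmono 2 (i + 1 + 1) (by omega) (by omega)
        omega
    rw [z]
    simp only [zero_add, e0, e1]
    rw [show 3 - 1 = 0 + 1 + 1 by omega, show 1 - 1 = 0 by omega, RR_succ, RR_succ]
    simp [RR]

end Pf

/-- Let `n ≥ 2` and `T = (a_1, …, a_k)` with `0 ≤ a_1 < a_2 < ⋯ < a_k < n`, and assume either
`a_1 ≥ 2`, or `k ≥ 3` with `a_1 = 1`, `a_2 = 3`, `a_3 ≥ 5`.  Then the set of pairs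
`{(x, y) ∈ ℤ × ℤ : y² = g_T(x)}` is finite. -/
theorem statement7 (n k : ℕ) (a : ℕ → ℕ) (hn : 2 ≤ n) (hk : 1 ≤ k)
    (hmono : ∀ i j, i < j → j < k → a i < a j)
    (hlt : ∀ i, i < k → a i < n)
    (hcase : 2 ≤ a 0 ∨ (3 ≤ k ∧ a 0 = 1 ∧ a 1 = 3 ∧ 5 ≤ a 2))
    (g : Polynomial ℤ) (hg : g = pP n + ∑ i ∈ Finset.range k, pP (a i)) :
    Set.Finite {p : ℤ × ℤ | p.2 ^ 2 = g.eval p.1} := by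
  exact Pf.final n k a hn hk hmono hlt hcase g hg
end

section
/- For every integer t, the pair (x, y) = (t³, t(t³ + 2)) satisfies y³ = x(x + 2)³. Consequently the set of integer pairs (x, y) with y³ = x(x + 2)³ is infinite. -/
/-- For every integer `t`, `(x, y) = (t³, t(t³ + 2))` satisfies `y³ = x(x + 2)³`; consequently
the set of integer pairs `(x, y)` with `y³ = x(x + 2)³` is infinite. -/
theorem statement8 :
    (∀ t : ℤ, (t * (t ^ 3 + 2)) ^ 3 = t ^ 3 * (t ^ 3 + 2) ^ 3) ∧
      Set.Infinite {p : ℤ × ℤ | p.2 ^ 3 = p.1 * (p.1 + 2) ^ 3} := by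
  have h : ∀ t : ℤ, (t * (t ^ 3 + 2)) ^ 3 = t ^ 3 * (t ^ 3 + 2) ^ 3 := fun t => by ring
  refine ⟨h, ?_⟩
  refine Set.infinite_of_injective_forall_mem
    (f := fun t : ℤ => ((t ^ 3, t * (t ^ 3 + 2)) : ℤ × ℤ)) ?_ (fun t => h t)
  intro a b hab
  have h1 : a ^ 3 = b ^ 3 := congrArg Prod.fst hab
  exact (Odd.strictMono_pow (by decide : Odd 3)).injective h1
end

section
/- For every integer k ≥ 1, p_{4k+3}( −(4k−1)/2 ) + p_{4k−1}( −(4k−1)/2 ) = ( ((16k² + 32k + 11)/4^{k+1}) · ∏_{i=0}^{2k−1} (2i+1) )², an identity of rational numbers. In particular, the equation y² = g_T(x) with n = 4k+3 and T = (4k−1) has a rational solution with x = −(4k−1)/2 and y ≠ 0. -/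
open Finset

lemma half_prod (m : ℕ) :
    ∏ i ∈ Finset.range (2 * m), (-(2 * (m : ℚ) - 1) / 2 + (i : ℚ)) =
      (-1) ^ m * (∏ i ∈ Finset.range m, (2 * (i : ℚ) + 1)) ^ 2 / 4 ^ m := by
  induction m with
  | zero => simp
  | succ m ih =>
    have h : ∏ i ∈ Finset.range (2 * m),
        (-(2 * ((m + 1 : ℕ) : ℚ) - 1) / 2 + ((i + 1 : ℕ) : ℚ)) =
        ∏ i ∈ Finset.range (2 * m), (-(2 * (m : ℚ) - 1) / 2 + (i : ℚ)) := by
      apply Finset.prod_congr rfl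
      intro i _
      push_cast
      ring
    rw [show 2 * (m + 1) = 2 * m + 1 + 1 by ring, Finset.prod_range_succ,
      Finset.prod_range_succ', h, ih, Finset.prod_range_succ]
    push_cast
    field_simp
    ring

/-- For every integer `k ≥ 1`,
`p_{4k+3}(-(4k-1)/2) + p_{4k-1}(-(4k-1)/2) = (((16k²+32k+11)/4^{k+1}) · ∏_{i=0}^{2k-1} (2i+1))²`
as rational numbers.  In particular `y² = g_T(x)` with `n = 4k+3`, `T = (4k-1)` has a rational
solution with `x = -(4k-1)/2` and `y ≠ 0`. -/
theorem statement14 (k : ℕ) (hk : 1 ≤ k) :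
    (∏ i ∈ Finset.range (4 * k + 4), (-(4 * (k : ℚ) - 1) / 2 + (i : ℚ))) +
        (∏ i ∈ Finset.range (4 * k), (-(4 * (k : ℚ) - 1) / 2 + (i : ℚ))) =
      (((16 * (k : ℚ) ^ 2 + 32 * (k : ℚ) + 11) / 4 ^ (k + 1)) *
          ∏ i ∈ Finset.range (2 * k), (2 * (i : ℚ) + 1)) ^ 2 ∧
      ∃ y : ℚ, y ≠ 0 ∧
        y ^ 2 = (∏ i ∈ Finset.range (4 * k + 4), (-(4 * (k : ℚ) - 1) / 2 + (i : ℚ))) +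
          (∏ i ∈ Finset.range (4 * k), (-(4 * (k : ℚ) - 1) / 2 + (i : ℚ))) := by
  have h := half_prod (2 * k)
  have e : (-1 : ℚ) ^ (2 * k) = 1 := by simp
  have e4 : (4 : ℚ) ^ (2 * k) = (4 ^ k) ^ 2 := by rw [← pow_mul, mul_comm]
  rw [e, e4, show 2 * (2 * k) = 4 * k by ring] at h
  push_cast at h
  rw [show (2 : ℚ) * (2 * (k : ℚ)) = 4 * k by ring] at h
  have main : (∏ i ∈ Finset.range (4 * k + 4), (-(4 * (k : ℚ) - 1) / 2 + (i : ℚ))) +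
        (∏ i ∈ Finset.range (4 * k), (-(4 * (k : ℚ) - 1) / 2 + (i : ℚ))) =
      (((16 * (k : ℚ) ^ 2 + 32 * (k : ℚ) + 11) / 4 ^ (k + 1)) *
          ∏ i ∈ Finset.range (2 * k), (2 * (i : ℚ) + 1)) ^ 2 := by
    rw [Finset.prod_range_succ, Finset.prod_range_succ, Finset.prod_range_succ,
      Finset.prod_range_succ, h, pow_succ (4 : ℚ) k]
    push_cast
    field_simp
    ring
  refine ⟨main, _, ?_, main.symm⟩
  have hp : 0 < ∏ i ∈ Finset.range (2 * k), (2 * (i : ℚ) + 1) :=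
    Finset.prod_pos fun i _ => by positivity
  positivity
end

section
/- Let m ≥ 1 be an odd integer. For every integer t, putting x = 2^{(m−1)/2} · t^m − 1 and y = 2^{(m−1)/2} · t^m, one has x(x+1) + y(y+1) = (2t²)^m. Hence for each odd m the equation z^m = p_1(x) + p_1(y) has infinitely many integer solutions. -/
/-- Let `m ≥ 1` be odd.  For every integer `t`, putting `x = 2^{(m-1)/2} t^m - 1` and
`y = 2^{(m-1)/2} t^m`, one has `x(x+1) + y(y+1) = (2t²)^m`.  Hence for each odd `m` the equation
`z^m = p₁(x) + p₁(y)` has infinitely many integer solutions. -/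
theorem statement15 (m : ℕ) (hm : 1 ≤ m) (hodd : Odd m) :
    (∀ t : ℤ,
      ((2 ^ ((m - 1) / 2) * t ^ m - 1) * ((2 ^ ((m - 1) / 2) * t ^ m - 1) + 1) +
          (2 ^ ((m - 1) / 2) * t ^ m) * ((2 ^ ((m - 1) / 2) * t ^ m) + 1)) =
        (2 * t ^ 2) ^ m) ∧
      Set.Infinite {s : ℤ × ℤ × ℤ |
        s.2.2 ^ m = s.1 * (s.1 + 1) + s.2.1 * (s.2.1 + 1)} := by
  have key : ∀ t : ℤ,
      ((2 ^ ((m - 1) / 2) * t ^ m - 1) * ((2 ^ ((m - 1) / 2) * t ^ m - 1) + 1) +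
          (2 ^ ((m - 1) / 2) * t ^ m) * ((2 ^ ((m - 1) / 2) * t ^ m) + 1)) =
        (2 * t ^ 2) ^ m := by
    intro t
    obtain ⟨k, rfl⟩ := hodd
    have hk : (2 * k + 1 - 1) / 2 = k := by omega
    rw [hk, mul_pow, pow_succ (2 : ℤ) (2 * k), mul_comm 2 k, pow_mul (2 : ℤ) k 2,
      ← pow_mul t 2, mul_comm 2 (k * 2 + 1), pow_mul t (k * 2 + 1) 2]
    ring
  refine ⟨key, ?_⟩
  refine Set.infinite_of_injective_forall_mem (f := fun n : ℕ =>
    ((2 ^ ((m - 1) / 2) * (n : ℤ) ^ m - 1, 2 ^ ((m - 1) / 2) * (n : ℤ) ^ m,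
      2 * (n : ℤ) ^ 2) : ℤ × ℤ × ℤ)) ?_ ?_
  · intro a b hab
    have h : 2 * (a : ℤ) ^ 2 = 2 * (b : ℤ) ^ 2 := congrArg (fun s => s.2.2) hab
    have h2 : a ^ 2 = b ^ 2 := by
      have : (a : ℤ) ^ 2 = (b : ℤ) ^ 2 := by linarith
      exact_mod_cast this
    exact Nat.pow_left_injective (n := 2) (by norm_num) h2
  · intro n
    exact (key n).symm
end

section
/- The set of triples (x, y, z) of polynomials in one variable with integer coefficients satisfying z³ = x(x+1)(x+2) + y(y+1)(y+2) (as an identity of polynomials) and deg x = deg y ≥ 1 is infinite. In particular, the Diophantine equation z³ = p_2(x) + p_2(y) has infinitely many solutions in polynomials with integer coefficients in which x and y have equal degree. -/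
open Polynomial

/-- The base solution from the paper, as polynomials in `t = X`. -/
noncomputable def baseX : Polynomial ℤ := 2592 * X ^ 9 + 432 * X ^ 6 - 18 * X ^ 3 - 2

noncomputable def baseY : Polynomial ℤ := -2592 * X ^ 9 + 432 * X ^ 6 + 18 * X ^ 3 - 2

noncomputable def baseZ : Polynomial ℤ := 6 * X ^ 2 * (432 * X ^ 6 - 1)

lemma base_eq : baseZ ^ 3 =
    baseX * (baseX + 1) * (baseX + 2) + baseY * (baseY + 1) * (baseY + 2) := by
  unfold baseX baseY baseZ
  ring

lemma natDegree_baseX : baseX.natDegree = 9 := by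
  unfold baseX
  compute_degree!

lemma natDegree_baseY : baseY.natDegree = 9 := by
  unfold baseY
  compute_degree!

/-- The set of triples `(x, y, z)` of polynomials with integer coefficients satisfying
`z³ = x(x+1)(x+2) + y(y+1)(y+2)` with `deg x = deg y ≥ 1` is infinite; i.e. the equation
`z³ = p₂(x) + p₂(y)` has infinitely many polynomial solutions with `x` and `y` of equal degree. -/
theorem statement16 :
    Set.Infinite {s : Polynomial ℤ × Polynomial ℤ × Polynomial ℤ |
      s.2.2 ^ 3 = s.1 * (s.1 + 1) * (s.1 + 2) + s.2.1 * (s.2.1 + 1) * (s.2.1 + 2) ∧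
        s.1.natDegree = s.2.1.natDegree ∧ 1 ≤ s.1.natDegree} := by
  -- substitute `t = X ^ (n + 1)` in the base solution
  refine Set.infinite_of_injective_forall_mem
    (f := fun n : ℕ => (baseX.comp (X ^ (n + 1)), baseY.comp (X ^ (n + 1)),
      baseZ.comp (X ^ (n + 1)))) ?_ ?_
  · intro m n h
    have h1 := congrArg (fun s => s.1.natDegree) h
    simp only [natDegree_comp, natDegree_baseX, natDegree_X_pow] at h1
    omega
  · intro n
    refine ⟨?_, ?_, ?_⟩
    · have h := congrArg (fun p => p.comp (X ^ (n + 1) : Polynomial ℤ)) base_eq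
      simpa using h
    · simp only [natDegree_comp, natDegree_baseX, natDegree_baseY]
    · simp only [natDegree_comp, natDegree_baseX, natDegree_X_pow]
      omega
end

section
/- The equation z² = p_3(x) + p_3(y), i.e. z² = x(x+1)(x+2)(x+3) + y(y+1)(y+2)(y+3), has infinitely many solutions in positive integers x, y, z. -/
lemma pell_large (n : ℕ) : ∃ t v : ℤ, (n : ℤ) + 2 < t ∧ 0 < v ∧ t ^ 2 - 2 * v ^ 2 = 1 := by
  induction n with
  | zero => exact ⟨3, 2, by norm_num, by norm_num, by norm_num⟩
  | succ k ih =>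
    obtain ⟨t, v, h1, h2, h3⟩ := ih
    refine ⟨3 * t + 4 * v, 2 * t + 3 * v, ?_, ?_, ?_⟩
    · push_cast; omega
    · omega
    · linear_combination h3

/-- The equation `z² = p₃(x) + p₃(y)`, i.e. `z² = x(x+1)(x+2)(x+3) + y(y+1)(y+2)(y+3)`, has
infinitely many solutions in positive integers `x, y, z`. -/
theorem statement18 :
    Set.Infinite {s : ℤ × ℤ × ℤ | 0 < s.1 ∧ 0 < s.2.1 ∧ 0 < s.2.2 ∧
      s.2.2 ^ 2 = s.1 * (s.1 + 1) * (s.1 + 2) * (s.1 + 3) +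
        s.2.1 * (s.2.1 + 1) * (s.2.1 + 2) * (s.2.1 + 3)} := by
  apply Set.Infinite.of_image Prod.fst
  apply Set.infinite_of_forall_exists_gt
  intro a
  obtain ⟨t, v, h1, h2, h3⟩ := pell_large a.toNat
  refine ⟨t - 2, ⟨(t - 2, t - 1, 2 * t * v), ⟨?_, ?_, ?_, ?_⟩, rfl⟩, ?_⟩
  · show 0 < t - 2
    omega
  · show 0 < t - 1
    omega
  · show 0 < 2 * t * v
    have : 0 < t := by omega
    positivity
  · show (2 * t * v) ^ 2 = (t - 2) * (t - 2 + 1) * (t - 2 + 2) * (t - 2 + 3) +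
        (t - 1) * (t - 1 + 1) * (t - 1 + 2) * (t - 1 + 3)
    linear_combination (-2 * t ^ 2) * h3
  · omega
end

section
/- Let F_n denote the n-th Fibonacci number (F_0 = 0, F_1 = 1, F_{n+2} = F_{n+1} + F_n). For every integer n ≥ 1, F_{6n} is even and (25·F_{12n}/2)² = p_4(5·F_{6n}/2) + p_4(−5·F_{6n}/2), where both 5·F_{6n}/2 and 25·F_{12n}/2 are integers. Consequently the equation z² = p_4(x) + p_4(y) has infinitely many solutions in integers x, y, z with z ≠ 0. -/
theorem fib_cassini_even (k : ℕ) :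
    (Nat.fib (2 * k + 1) : ℤ) ^ 2 - Nat.fib (2 * k + 1) * Nat.fib (2 * k)
      - (Nat.fib (2 * k) : ℤ) ^ 2 = 1 := by
  induction k with
  | zero => simp
  | succ k ih =>
    have a : Nat.fib (2 * (k + 1)) = Nat.fib (2 * k) + Nat.fib (2 * k + 1) := Nat.fib_add_two
    have b : Nat.fib (2 * (k + 1) + 1) = Nat.fib (2 * k + 1) + Nat.fib (2 * (k + 1)) :=
      Nat.fib_add_two
    rw [b, a]
    push_cast
    linear_combination ih

theorem fib_double_int (m : ℕ) :
    (Nat.fib (2 * m) : ℤ) = Nat.fib m * (2 * Nat.fib (m + 1) - Nat.fib m) := by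
  have h : Nat.fib m ≤ 2 * Nat.fib (m + 1) := by
    have := Nat.fib_le_fib_succ (n := m)
    omega
  rw [Nat.fib_two_mul]
  push_cast [h]
  ring

/-- For every `n ≥ 1`, the Fibonacci number `F_{6n}` is even and, with the integers
`x = 5 F_{6n} / 2` and `z = 25 F_{12n} / 2`, one has `z² = p₄(x) + p₄(-x)`.  Consequently the
equation `z² = p₄(x) + p₄(y)` has infinitely many integer solutions with `z ≠ 0`. -/
theorem statement19 :
    (∀ n : ℕ, 1 ≤ n →
      Even (Nat.fib (6 * n)) ∧
        ∃ x z : ℤ, 2 * x = 5 * (Nat.fib (6 * n) : ℤ) ∧ 2 * z = 25 * (Nat.fib (12 * n) : ℤ) ∧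
          z ^ 2 = x * (x + 1) * (x + 2) * (x + 3) * (x + 4) +
            (-x) * (-x + 1) * (-x + 2) * (-x + 3) * (-x + 4)) ∧
      Set.Infinite {s : ℤ × ℤ × ℤ | s.2.2 ≠ 0 ∧
        s.2.2 ^ 2 = s.1 * (s.1 + 1) * (s.1 + 2) * (s.1 + 3) * (s.1 + 4) +
          s.2.1 * (s.2.1 + 1) * (s.2.1 + 2) * (s.2.1 + 3) * (s.2.1 + 4)} := by
  have h1 : ∀ n : ℕ, 1 ≤ n →
      Even (Nat.fib (6 * n)) ∧
        ∃ x z : ℤ, 2 * x = 5 * (Nat.fib (6 * n) : ℤ) ∧ 2 * z = 25 * (Nat.fib (12 * n) : ℤ) ∧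
          z ^ 2 = x * (x + 1) * (x + 2) * (x + 3) * (x + 4) +
            (-x) * (-x + 1) * (-x + 2) * (-x + 3) * (-x + 4) := by
    intro n _
    have e1 : Even (Nat.fib (6 * n)) :=
      even_iff_two_dvd.2 ((by decide : 2 ∣ Nat.fib 6).trans (Nat.fib_dvd _ _ (Dvd.intro _ rfl)))
    refine ⟨e1, ?_⟩
    obtain ⟨c, hc⟩ := e1
    have hF : (Nat.fib (6 * n) : ℤ) = c + c := by exact_mod_cast hc
    have hcas := fib_cassini_even (3 * n)
    have hd := fib_double_int (6 * n)
    rw [show 2 * (3 * n) = 6 * n by ring] at hcas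
    rw [show 2 * (6 * n) = 12 * n by ring] at hd
    rw [hF] at hcas hd
    rw [hF, hd]
    generalize (Nat.fib (6 * n + 1) : ℤ) = G at *
    refine ⟨5 * c, 25 * (c * (2 * G - (c + c))), by ring, by ring, ?_⟩
    linear_combination 2500 * (c : ℤ) ^ 2 * hcas
  refine ⟨h1, ?_⟩
  choose _ x z hx hz h using fun n : ℕ => h1 (n + 1) (Nat.succ_pos n)
  refine Set.infinite_of_injective_forall_mem (f := fun n : ℕ => (x n, -x n, z n)) ?_ ?_
  · intro a b hab
    have hxab : x a = x b := congrArg Prod.fst hab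
    have ha := hx a
    have hb := hx b
    have hf : Nat.fib (6 * a + 4 + 2) = Nat.fib (6 * b + 4 + 2) := by
      have : (Nat.fib (6 * (a + 1)) : ℤ) = Nat.fib (6 * (b + 1)) := by linarith
      exact_mod_cast this
    have := Nat.fib_add_two_strictMono.injective hf
    omega
  · intro n
    refine ⟨?_, h n⟩
    have hp : 0 < Nat.fib (12 * (n + 1)) := Nat.fib_pos.2 (by omega)
    have hzn := hz n
    show z n ≠ 0
    omega
end
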